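/- Let ε > 0 and let X ⊂ ℙ(2,1,1,1) be a del Pezzo surface of degree 2 over the number field k, given by an equation t² = f(x_1,x_2,x_3) with f ∈ k[x_1,x_2,x_3] a non-singular quartic form, and suppose X contains a non-singular conic defined over k. Let U ⊂ X be the complement of the 56 exceptional curves, and let N(U,k,B) = #{x ∈ U(k) : H(x) ≤ B}, where the height of a point [t,x_1,x_2,x_3] is H_k([x_1,x_2,x_3]) on ℙ²(k). Then there exists a constant C = C(ε, X, k) such that N(U,k,B) ≤ C·B^{2+ε} for all B ≥ 1. -/

import Mathlib

open NumberField

/-- The normalized absolute value `∥x∥_w = |x|_w^{d_w}` at an infinite place `w`. -/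
noncomputable def plNorm {k : Type*} [Field k] [NumberField k]
    (w : InfinitePlace k) (x : k) : ℝ := w x ^ w.mult

/-- The height `H_k` of the projective point with integral homogeneous coordinates `y`:
`H_k = N(⟨y_0, …, y_n⟩)⁻¹ · ∏_{w | ∞} max_i ∥y_i∥_w`; this is independent of the choice
of integral representative. -/
noncomputable def heightFn {k : Type*} [Field k] [NumberField k] {m : ℕ}
    (y : Fin m → 𝓞 k) : ℝ :=
  (Ideal.absNorm (Ideal.span (Set.range y)) : ℝ)⁻¹ *
    ∏ w : InfinitePlace k, ⨆ i, plNorm w (y i)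

/-- The scaling equivalence on the affine cone of the weighted projective space
`ℙ(2,1,1,1)`: `(t, x) ∼ (λ²t, λx)` for `λ ∈ k^*`. -/
def wpRel (k : Type*) [Field k] (p q : k × (Fin 3 → k)) : Prop :=
  ∃ l : k, l ≠ 0 ∧ q.1 = l ^ 2 * p.1 ∧ q.2 = l • p.2

/-- The point with homogeneous coordinates `ξ ≠ 0` in `ℙ²` (over a field `K`) lies on a
bitangent line of the plane quartic `f = 0`, i.e. on a line on which `f` restricts to
the square of a quadratic form. -/
def liesOnBitangent {K : Type*} [Field K] (f : MvPolynomial (Fin 3) K)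
    (ξ : Fin 3 → K) : Prop :=
  ∃ P Q : Fin 3 → K, LinearIndependent K ![P, Q] ∧
    (∃ a b c : K, ∀ s u : K,
      MvPolynomial.eval (s • P + u • Q) f = (a * s ^ 2 + b * s * u + c * u ^ 2) ^ 2) ∧
    (∃ s u : K, ξ = s • P + u • Q)

/-- The number of ideal divisors is submultiplicative. -/
lemma ncard_dvd_mul_le {α : Type*} [CommMonoidWithZero α] [DecompositionMonoid α] (x y : α)
    (hx : {J : α | J ∣ x}.Finite) (hy : {J : α | J ∣ y}.Finite) :
    {J : α | J ∣ x * y}.ncard ≤ {J : α | J ∣ x}.ncard * {J : α | J ∣ y}.ncard := by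
  have hsub : {J : α | J ∣ x * y} ⊆
      (fun p : α × α => p.1 * p.2) '' ({J : α | J ∣ x} ×ˢ {J : α | J ∣ y}) := by
    intro J hJ
    obtain ⟨a, b, ha, hb, rfl⟩ := exists_dvd_and_dvd_of_dvd_mul hJ
    exact ⟨(a, b), ⟨ha, hb⟩, rfl⟩
  calc _ ≤ _ := Set.ncard_le_ncard hsub ((hx.prod hy).image _)
    _ ≤ _ := Set.ncard_image_le (hx.prod hy)
    _ = _ := Set.ncard_prod

lemma finite_setOf_ideal_dvd {K : Type*} [Field K] [NumberField K] {I : Ideal (𝓞 K)}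
    (hI : I ≠ 0) : {J : Ideal (𝓞 K) | J ∣ I}.Finite := by
  have := UniqueFactorizationMonoid.fintypeSubtypeDvd I hI
  exact Set.finite_coe_iff.1 (inferInstanceAs (Finite {J : Ideal (𝓞 K) // J ∣ I}))

/-- The divisor bound: an ideal `I` of the ring of integers has `O(N(I)^ε)` divisors. -/
theorem exists_ncard_ideal_dvd_le (K : Type*) [Field K] [NumberField K] {ε : ℝ} (hε : 0 < ε) :
    ∃ C : ℝ, 1 ≤ C ∧ ∀ I : Ideal (𝓞 K), I ≠ 0 →
      ({J : Ideal (𝓞 K) | J ∣ I}.ncard : ℝ) ≤ C * (Ideal.absNorm I : ℝ) ^ ε := by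
  classical
  obtain ⟨Y, hY⟩ := exists_nat_ge ((2 : ℝ) ^ (1 / ε))
  have hS : {I : Ideal (𝓞 K) | Ideal.absNorm I ≤ Y}.Finite := Ideal.finite_setOfPred_absNorm_le Y
  set S := hS.toFinset with hSdef
  -- a uniform bound for `(i + 1) / 2 ^ (ε i)`
  obtain ⟨A, hA1, hA⟩ : ∃ A : ℝ, 1 ≤ A ∧ ∀ i : ℕ, (i + 1 : ℝ) ≤ A * ((2 : ℝ) ^ i) ^ ε := by
    refine ⟨1 + 1 / (ε * Real.log 2), ?_, fun i => ?_⟩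
    · have := Real.log_pos one_lt_two
      have : 0 < 1 / (ε * Real.log 2) := by positivity
      linarith
    · have hl := Real.log_pos one_lt_two
      have h2 : ((2 : ℝ) ^ i) ^ ε = Real.exp (i * (ε * Real.log 2)) := by
        rw [← Real.rpow_natCast, ← Real.rpow_mul two_pos.le, Real.rpow_def_of_pos two_pos]
        congr 1; ring
      rw [h2]
      set t := ε * Real.log 2 with ht
      have htpos : 0 < t := by positivity
      have h3 : (i : ℝ) * t + 1 ≤ Real.exp (i * t) := Real.add_one_le_exp _
      have h4 : (0 : ℝ) ≤ i * t := by positivity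
      have h5 : (i + 1 : ℝ) ≤ (1 + 1 / t) * (i * t + 1) := by
        have : (1 + 1 / t) * (i * t + 1) = i * t + 1 + i + 1 / t := by field_simp; ring
        rw [this]
        have : 0 < 1 / t := by positivity
        linarith
      exact h5.trans (mul_le_mul_of_nonneg_left h3 (by positivity))
  refine ⟨A ^ S.card, one_le_pow₀ hA1, ?_⟩
  have key : ∀ I : Ideal (𝓞 K), I ≠ 0 → ({J : Ideal (𝓞 K) | J ∣ I}.ncard : ℝ) ≤
      A ^ (S.filter (fun p => Prime p ∧ p ∣ I)).card * (Ideal.absNorm I : ℝ) ^ ε := by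
    intro I
    induction I using UniqueFactorizationMonoid.induction_on_coprime with
    | h0 => intro h; exact absurd rfl h
    | @h1 x hx =>
      intro _
      have hx1 : x = 1 := by rwa [Ideal.isUnit_iff, ← Ideal.one_eq_top] at hx
      subst hx1
      have h1 : {J : Ideal (𝓞 K) | J ∣ 1} = {1} := by
        ext J; exact isUnit_iff_dvd_one.symm.trans isUnit_iff_eq_one
      rw [h1]
      simp only [Set.ncard_singleton, Nat.cast_one, map_one, Real.one_rpow, mul_one]
      exact one_le_pow₀ hA1
    | @hpr p i hp =>
      intro h0
      have hcard : ({J : Ideal (𝓞 K) | J ∣ p ^ i}.ncard) ≤ i + 1 := by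
        have : {J : Ideal (𝓞 K) | J ∣ p ^ i} ⊆
            ((Finset.range (i + 1)).image (p ^ ·) : Finset _) := by
          intro J hJ
          obtain ⟨j, hj, hJj⟩ := (dvd_prime_pow hp i).1 hJ
          rw [associated_iff_eq] at hJj
          simp only [Finset.coe_image, Set.mem_image]
          exact ⟨j, by simpa using Nat.lt_succ_of_le hj, hJj.symm⟩
        refine (Set.ncard_le_ncard this (Finset.finite_toSet _)).trans ?_
        rw [Set.ncard_coe_finset]
        exact Finset.card_image_le.trans (by simp)
      have hcard' : ({J : Ideal (𝓞 K) | J ∣ p ^ i}.ncard : ℝ) ≤ i + 1 := by exact_mod_cast hcard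
      have hp0 : p ≠ ⊥ := hp.ne_zero
      have hpp := Ideal.isPrime_of_prime hp
      have hN2 : 2 ≤ Ideal.absNorm p := by
        have h0 : Ideal.absNorm p ≠ 0 := by simpa [Ideal.absNorm_eq_zero_iff] using hp0
        have h1 : Ideal.absNorm p ≠ 1 := by
          simpa [Ideal.absNorm_eq_one_iff] using hpp.ne_top
        omega
      rcases Nat.eq_zero_or_pos i with rfl | hi
      · have h1 : {J : Ideal (𝓞 K) | J ∣ p ^ 0} = {1} := by
          rw [pow_zero]
          ext J; exact isUnit_iff_dvd_one.symm.trans isUnit_iff_eq_one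
        rw [h1]
        simp only [Set.ncard_singleton, Nat.cast_one, map_one, Real.one_rpow, mul_one, pow_zero]
        exact one_le_pow₀ hA1
      by_cases hs : Ideal.absNorm p ≤ Y
      · have hmem : p ∈ S.filter (fun q => Prime q ∧ q ∣ p ^ i) := by
          simp only [Finset.mem_filter, hSdef, Set.Finite.mem_toFinset, Set.mem_ofPred_eq]
          exact ⟨hs, hp, dvd_pow_self p hi.ne'⟩
        have hc : 1 ≤ (S.filter (fun q => Prime q ∧ q ∣ p ^ i)).card := Finset.card_pos.2 ⟨p, hmem⟩
        calc ({J : Ideal (𝓞 K) | J ∣ p ^ i}.ncard : ℝ) ≤ i + 1 := hcard'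
          _ ≤ A * ((2 : ℝ) ^ i) ^ ε := hA i
          _ ≤ A ^ (S.filter (fun q => Prime q ∧ q ∣ p ^ i)).card *
              (Ideal.absNorm (p ^ i) : ℝ) ^ ε := by
            gcongr
            · exact le_self_pow₀ hA1 (by omega)
            · rw [map_pow]; push_cast
              gcongr
              exact_mod_cast hN2
      · push Not at hs
        have hY2 : (2 : ℝ) ^ (1 / ε) ≤ Ideal.absNorm p := hY.trans (by exact_mod_cast hs.le)
        have h2 : (2 : ℝ) ≤ (Ideal.absNorm p : ℝ) ^ ε := by
          calc (2 : ℝ) = ((2 : ℝ) ^ (1 / ε)) ^ ε := by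
                rw [← Real.rpow_mul two_pos.le, one_div, inv_mul_cancel₀ hε.ne', Real.rpow_one]
            _ ≤ _ := by gcongr
        calc ({J : Ideal (𝓞 K) | J ∣ p ^ i}.ncard : ℝ) ≤ i + 1 := hcard'
          _ ≤ 2 ^ i := by
            have := Nat.lt_two_pow_self (n := i)
            exact_mod_cast this
          _ ≤ ((Ideal.absNorm p : ℝ) ^ ε) ^ i := by gcongr
          _ = 1 * (Ideal.absNorm (p ^ i) : ℝ) ^ ε := by
            rw [map_pow]; push_cast
            rw [one_mul, ← Real.rpow_natCast, ← Real.rpow_natCast, ← Real.rpow_mul (by positivity),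
              ← Real.rpow_mul (by positivity), mul_comm]
          _ ≤ _ := by
            gcongr
            exact one_le_pow₀ hA1
    | @hcp x y hxy ihx ihy =>
      intro h0
      have hx0 : x ≠ 0 := left_ne_zero_of_mul h0
      have hy0 : y ≠ 0 := right_ne_zero_of_mul h0
      have hcardle : (S.filter (fun p => Prime p ∧ p ∣ x)).card +
          (S.filter (fun p => Prime p ∧ p ∣ y)).card ≤
          (S.filter (fun p => Prime p ∧ p ∣ x * y)).card := by
        rw [← Finset.card_union_of_disjoint]
        · apply Finset.card_le_card
          intro p hp
          simp only [Finset.mem_union, Finset.mem_filter] at hp ⊢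
          rcases hp with ⟨h1, h2, h3⟩ | ⟨h1, h2, h3⟩
          · exact ⟨h1, h2, h3.mul_right _⟩
          · exact ⟨h1, h2, h3.mul_left _⟩
        · rw [Finset.disjoint_left]
          intro p hp hp'
          simp only [Finset.mem_filter] at hp hp'
          exact hp.2.1.not_isUnit (hxy hp.2.2 hp'.2.2)
      calc ({J : Ideal (𝓞 K) | J ∣ x * y}.ncard : ℝ)
          ≤ ({J : Ideal (𝓞 K) | J ∣ x}.ncard : ℝ) * ({J : Ideal (𝓞 K) | J ∣ y}.ncard : ℝ) := by
            exact_mod_cast ncard_dvd_mul_le x y (finite_setOf_ideal_dvd hx0)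
              (finite_setOf_ideal_dvd hy0)
        _ ≤ _ := mul_le_mul (ihx hx0) (ihy hy0) (by positivity) (by positivity)
        _ = A ^ ((S.filter (fun p => Prime p ∧ p ∣ x)).card +
            (S.filter (fun p => Prime p ∧ p ∣ y)).card) * (Ideal.absNorm (x * y) : ℝ) ^ ε := by
            rw [map_mul, pow_add]; push_cast
            rw [Real.mul_rpow (by positivity) (by positivity)]; ring
        _ ≤ _ := by gcongr
  intro I hI
  refine (key I hI).trans ?_
  gcongr
  exact Finset.filter_subset _ _

section Heights
variable {k : Type*} [Field k] [NumberField k]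

lemma plNorm_nonneg (w : InfinitePlace k) (x : k) : 0 ≤ plNorm w x :=
  pow_nonneg (apply_nonneg w x) _

lemma plNorm_mul (w : InfinitePlace k) (x y : k) : plNorm w (x * y) = plNorm w x * plNorm w y := by
  simp [plNorm, mul_pow]

lemma prod_plNorm (x : 𝓞 k) :
    ∏ w : InfinitePlace k, plNorm w (x : k) = (Ideal.absNorm (Ideal.span {x}) : ℝ) := by
  rw [Ideal.absNorm_span_singleton]
  simp only [plNorm]
  rw [InfinitePlace.prod_eq_abs_norm]
  rw [← Algebra.coe_norm_int]
  simp [Nat.cast_natAbs]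

lemma plNorm_le_iSup {m : ℕ} (w : InfinitePlace k) (y : Fin m → 𝓞 k) (i : Fin m) :
    plNorm w (y i) ≤ ⨆ i, plNorm w (y i) :=
  le_ciSup (f := fun i => plNorm w (y i : k)) (Set.finite_range _).bddAbove i

lemma apply_le_iSup {k : Type*} [Field k] {m : ℕ} (w : InfinitePlace k) (y : Fin m → 𝓞 k) (i : Fin m) :
    w (y i) ≤ ⨆ i, w (y i) :=
  le_ciSup (f := fun i => w (y i : k)) (Set.finite_range _).bddAbove i

lemma iSup_plNorm {m : ℕ} [Nonempty (Fin m)] (w : InfinitePlace k) (y : Fin m → 𝓞 k) :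
    ⨆ i, plNorm w (y i) = (⨆ i, w (y i)) ^ w.mult := by
  apply le_antisymm
  · apply ciSup_le
    intro i
    exact pow_le_pow_left₀ (apply_nonneg w _) (apply_le_iSup w y i) _
  · obtain ⟨i, hi⟩ := exists_eq_ciSup_of_finite (f := fun i => w (y i : k))
    rw [← hi]
    exact plNorm_le_iSup w y i

lemma iSup_plNorm_pos {m : ℕ} (w : InfinitePlace k) {y : Fin m → 𝓞 k} (hy : y ≠ 0) :
    0 < ⨆ i, plNorm w (y i) := by
  obtain ⟨i, hi⟩ := Function.ne_iff.1 hy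
  refine lt_of_lt_of_le ?_ (plNorm_le_iSup w y i)
  apply pow_pos
  rw [InfinitePlace.pos_iff]
  simpa using hi

lemma span_range_ne_bot {k : Type*} [Field k] {m : ℕ} {y : Fin m → 𝓞 k} (hy : y ≠ 0) :
    Ideal.span (Set.range y) ≠ ⊥ := by
  obtain ⟨i, hi⟩ := Function.ne_iff.1 hy
  intro h
  rw [Ideal.span_eq_bot] at h
  exact hi (h _ ⟨i, rfl⟩)

lemma absNorm_pos_of_ne_bot {I : Ideal (𝓞 k)} (hI : I ≠ ⊥) : 0 < (Ideal.absNorm I : ℝ) := by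
  have : Ideal.absNorm I ≠ 0 := by simpa [Ideal.absNorm_eq_zero_iff] using hI
  positivity

lemma absNorm_mul_heightFn {m : ℕ} {y : Fin m → 𝓞 k} (hy : y ≠ 0) :
    (Ideal.absNorm (Ideal.span (Set.range y)) : ℝ) * heightFn y =
      ∏ w : InfinitePlace k, ⨆ i, plNorm w (y i) := by
  have := absNorm_pos_of_ne_bot (span_range_ne_bot hy)
  rw [heightFn]; field_simp

lemma absNorm_le_of_le {I J : Ideal (𝓞 k)} (hJ : J ≠ ⊥) (h : J ≤ I) :
    (Ideal.absNorm I : ℝ) ≤ Ideal.absNorm J := by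
  have h1 : Ideal.absNorm I ∣ Ideal.absNorm J := Ideal.absNorm_dvd_absNorm_of_le h
  have h2 : Ideal.absNorm J ≠ 0 := by simpa [Ideal.absNorm_eq_zero_iff] using hJ
  exact_mod_cast Nat.le_of_dvd (Nat.pos_of_ne_zero h2) h1

lemma one_le_heightFn {m : ℕ} {y : Fin m → 𝓞 k} (hy : y ≠ 0) : 1 ≤ heightFn y := by
  have hpos := absNorm_pos_of_ne_bot (span_range_ne_bot hy)
  obtain ⟨i, hi⟩ := Function.ne_iff.1 hy
  have hi' : Ideal.span {y i} ≠ ⊥ := by simpa using hi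
  have h1 : (Ideal.absNorm (Ideal.span (Set.range y)) : ℝ) ≤
      Ideal.absNorm (Ideal.span (Set.range y)) * heightFn y := by
    rw [absNorm_mul_heightFn hy]
    refine (absNorm_le_of_le hi' (Ideal.span_mono (by rintro _ rfl; exact ⟨i, rfl⟩))).trans ?_
    rw [← prod_plNorm]
    exact Finset.prod_le_prod (fun w _ => plNorm_nonneg w _) (fun w _ => plNorm_le_iSup w y i)
  nlinarith

lemma heightFn_mul_left {m : ℕ} {c : 𝓞 k} (hc : c ≠ 0) {y : Fin m → 𝓞 k} (hy : y ≠ 0) :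
    heightFn (fun i => c * y i) = heightFn y := by
  have hspan : Ideal.span (Set.range fun i => c * y i) =
      Ideal.span {c} * Ideal.span (Set.range y) := by
    rw [Ideal.span_mul_span']
    congr 1
    ext x
    simp
  have h1 : (Ideal.absNorm (Ideal.span {c}) : ℝ) ≠ 0 :=
    (absNorm_pos_of_ne_bot (by simpa using hc)).ne'
  have h2 := (absNorm_pos_of_ne_bot (span_range_ne_bot hy)).ne'
  rw [heightFn, heightFn, hspan, map_mul]
  have : ∀ w : InfinitePlace k, ⨆ i, plNorm w ((c * y i : 𝓞 k) : k) =
      plNorm w c * ⨆ i, plNorm w (y i) := by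
    intro w
    rw [Real.mul_iSup_of_nonneg (plNorm_nonneg _ _)]
    congr 1; ext i
    push_cast
    exact plNorm_mul _ _ _
  simp_rw [this]
  rw [Finset.prod_mul_distrib, prod_plNorm]
  push_cast
  field_simp

lemma heightFn_eq_of_mul_eq {m : ℕ} {g c : 𝓞 k} (hg : g ≠ 0) (hc : c ≠ 0) {y z : Fin m → 𝓞 k}
    (hz : z ≠ 0) (h : ∀ i, g * y i = c * z i) : heightFn y = heightFn z := by
  have hy : y ≠ 0 := by
    rintro rfl
    obtain ⟨i, hi⟩ := Function.ne_iff.1 hz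
    have := h i
    simp only [Pi.zero_apply, mul_zero] at this hi
    exact (mul_ne_zero hc hi) this.symm
  rw [← heightFn_mul_left hg hy, ← heightFn_mul_left hc hz]
  congr 1; ext i; rw [h i]

open Module in
/-- Minkowski's theorem in the form of a lower bound on the volume needed to find a short
element in an integral ideal. -/
lemma exists_mem_ideal_lt (k : Type*) [Field k] [NumberField k] :
    ∃ C : ℝ, 1 ≤ C ∧ ∀ (J : Ideal (𝓞 k)), J ≠ ⊥ → ∀ f : InfinitePlace k → ℝ, (∀ w, 0 < f w) →
      C * Ideal.absNorm J ≤ ∏ w, f w ^ w.mult →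
      ∃ c ∈ J, c ≠ 0 ∧ ∀ w : InfinitePlace k, w (c : k) < f w := by
  classical
  set V := MeasureTheory.volume (ZSpan.fundamentalDomain (mixedEmbedding.latticeBasis k)) with hV
  have hVtop : V ≠ ⊤ := by
    have := mixedEmbedding.minkowskiBound_lt_top k 1
    have hb := ZSpan.fundamentalDomain_isBounded (mixedEmbedding.latticeBasis k)
    exact hb.measure_lt_top.ne
  refine ⟨V.toReal * 2 ^ finrank ℝ (mixedEmbedding.mixedSpace k) + 1, ?_, ?_⟩
  · have : 0 ≤ V.toReal := ENNReal.toReal_nonneg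
    have : 0 ≤ V.toReal * 2 ^ finrank ℝ (mixedEmbedding.mixedSpace k) := by positivity
    linarith
  intro J hJ f hf hle
  have hJpos := absNorm_pos_of_ne_bot hJ
  set I : (FractionalIdeal (nonZeroDivisors (𝓞 k)) k)ˣ :=
    Units.mk0 (J : FractionalIdeal (nonZeroDivisors (𝓞 k)) k)
      (by simpa using hJ) with hI
  let F : InfinitePlace k → NNReal := fun w => ⟨f w, (hf w).le⟩
  have hkey : mixedEmbedding.minkowskiBound k I < MeasureTheory.volume
      (mixedEmbedding.convexBodyLT k F) := by
    rw [mixedEmbedding.convexBodyLT_volume, mixedEmbedding.minkowskiBound,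
      mixedEmbedding.volume_fundamentalDomain_fractionalIdealLatticeBasis, ← hV]
    have h1 : (FractionalIdeal.absNorm (I : FractionalIdeal (nonZeroDivisors (𝓞 k)) k) : ℚ)
        = (Ideal.absNorm J : ℚ) := by
      simp [hI, FractionalIdeal.coeIdeal_absNorm]
    have h2 : (1 : ENNReal) ≤ (mixedEmbedding.convexBodyLTFactor k : ENNReal) := by
      exact_mod_cast mixedEmbedding.one_le_convexBodyLTFactor k
    refine lt_of_lt_of_le ?_ (le_mul_of_one_le_left zero_le h2)
    rw [h1]
    have h3 : (((∏ w, F w ^ w.mult : NNReal)) : ENNReal) = ENNReal.ofReal (∏ w, f w ^ w.mult) := by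
      rw [← ENNReal.ofReal_coe_nnreal]
      congr 1
      push_cast
      rfl
    have h4 : ENNReal.ofReal ((Ideal.absNorm J : ℚ) : ℝ) * V *
          2 ^ finrank ℝ (mixedEmbedding.mixedSpace k)
        = ENNReal.ofReal (Ideal.absNorm J *
          (V.toReal * 2 ^ finrank ℝ (mixedEmbedding.mixedSpace k))) := by
      rw [ENNReal.ofReal_mul (by positivity), ENNReal.ofReal_mul ENNReal.toReal_nonneg,
        ENNReal.ofReal_toReal hVtop, ENNReal.ofReal_pow (by norm_num)]
      simp [mul_assoc]
    calc _ = ENNReal.ofReal (Ideal.absNorm J *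
            (V.toReal * 2 ^ finrank ℝ (mixedEmbedding.mixedSpace k))) := h4
      _ < ENNReal.ofReal (∏ w, f w ^ w.mult) := by
        rw [ENNReal.ofReal_lt_ofReal_iff]
        · nlinarith
        · exact Finset.prod_pos fun w _ => pow_pos (hf w) _
      _ = _ := by rw [← h3]
  obtain ⟨a, haI, ha0, hlt⟩ := mixedEmbedding.exists_ne_zero_mem_ideal_lt k I hkey
  have haJ : a ∈ (J : FractionalIdeal (nonZeroDivisors (𝓞 k)) k) := by simpa [hI] using haI
  rw [FractionalIdeal.mem_coeIdeal] at haJ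
  obtain ⟨c, hcJ, rfl⟩ := haJ
  refine ⟨c, hcJ, ?_, fun w => ?_⟩
  · rintro rfl; simp at ha0
  · exact hlt w

/-- Every projective point has integral homogeneous coordinates that are simultaneously small at
all infinite places. -/
theorem exists_small_rep (k : Type*) [Field k] [NumberField k] :
    ∃ C : ℝ, 1 ≤ C ∧ ∀ {m : ℕ} (z : Fin m → 𝓞 k), z ≠ 0 →
      ∃ (g c : 𝓞 k) (y : Fin m → 𝓞 k), g ≠ 0 ∧ c ≠ 0 ∧ (∀ i, g * y i = c * z i) ∧
        ∀ (w : InfinitePlace k) i,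
          w (y i : k) ≤ C * heightFn z ^ (1 / (Module.finrank ℚ k : ℝ)) := by
  obtain ⟨C, hC1, hC⟩ := exists_mem_ideal_lt k
  refine ⟨C, hC1, ?_⟩
  intro m z hz
  obtain ⟨i0, hi0⟩ := Function.ne_iff.1 hz
  have : Nonempty (Fin m) := ⟨i0⟩
  set I := Ideal.span (Set.range z) with hI
  have hI0 : I ≠ ⊥ := span_range_ne_bot hz
  set g := z i0 with hg
  have hg0 : g ≠ 0 := hi0
  have hgI : g ∈ I := Ideal.subset_span ⟨i0, rfl⟩
  obtain ⟨J, hJ⟩ : I ∣ Ideal.span {g} := by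
    rw [Ideal.dvd_span_singleton]; exact hgI
  have hJ0 : J ≠ ⊥ := by
    rintro rfl
    rw [Ideal.mul_bot, Ideal.span_singleton_eq_bot] at hJ
    exact hg0 hJ
  set d : ℝ := (Module.finrank ℚ k : ℝ) with hd
  have hdpos : 0 < d := by rw [hd]; exact_mod_cast Module.finrank_pos
  set H := heightFn z with hH
  have hH1 : 1 ≤ H := one_le_heightFn hz
  have hw : ∀ w : InfinitePlace k, 0 < ⨆ i, w (z i : k) := by
    intro w
    exact lt_of_lt_of_le (InfinitePlace.pos_iff.2 (by simpa using hi0)) (apply_le_iSup w z i0)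
  have hgw : ∀ w : InfinitePlace k, 0 < w (g : k) := fun w =>
    InfinitePlace.pos_iff.2 (by simpa using hg0)
  set f : InfinitePlace k → ℝ := fun w => C * H ^ (1 / d) * w (g : k) / ⨆ i, w (z i : k) with hf
  have hfpos : ∀ w, 0 < f w := fun w => by
    have := hw w
    have := hgw w
    have : 0 < H ^ (1 / d) := by positivity
    simp only [hf]; positivity
  have hprod : C * Ideal.absNorm J ≤ ∏ w, f w ^ w.mult := by
    have h1 : ∏ w, f w ^ w.mult = C ^ (Module.finrank ℚ k) * Ideal.absNorm J := by
      simp only [hf, div_pow, mul_pow]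
      rw [Finset.prod_div_distrib, Finset.prod_mul_distrib, Finset.prod_mul_distrib,
        Finset.prod_pow_eq_pow_sum, Finset.prod_pow_eq_pow_sum, InfinitePlace.sum_mult_eq]
      have e1 : (H ^ (1 / d)) ^ (Module.finrank ℚ k) = H := by
        rw [← Real.rpow_natCast, ← Real.rpow_mul (by positivity), one_div,
          inv_mul_cancel₀ hdpos.ne', Real.rpow_one]
      have e2 : ∏ w : InfinitePlace k, w (g : k) ^ w.mult = Ideal.absNorm I * Ideal.absNorm J := by
        have := prod_plNorm g
        rw [hJ, map_mul] at this
        exact_mod_cast this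
      have e3 : ∏ w : InfinitePlace k, (⨆ i, w (z i : k)) ^ w.mult = Ideal.absNorm I * H := by
        rw [absNorm_mul_heightFn hz]
        exact Finset.prod_congr rfl fun w _ => (iSup_plNorm w z).symm
      rw [e1, e2, e3]
      have := absNorm_pos_of_ne_bot hI0
      field_simp
    rw [h1]
    gcongr
    exact le_self_pow₀ hC1 Module.finrank_pos.ne'
  obtain ⟨c, hcJ, hc0, hclt⟩ := hC J hJ0 f hfpos hprod
  have hdiv : ∀ i, g ∣ c * z i := by
    intro i
    rw [← Ideal.mem_span_singleton, hJ, mul_comm c]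
    exact Ideal.mul_mem_mul (Ideal.subset_span ⟨i, rfl⟩) hcJ
  choose y hy using hdiv
  refine ⟨g, c, y, hg0, hc0, fun i => (hy i).symm, fun w i => ?_⟩
  have h1 : w (g : k) * w (y i : k) = w (c : k) * w (z i : k) := by
    rw [← map_mul w, ← map_mul w]
    congr 1
    exact_mod_cast congrArg (algebraMap (𝓞 k) k) (hy i).symm
  have h2 : w (c : k) * w (z i : k) ≤ f w * ⨆ i, w (z i : k) :=
    mul_le_mul (hclt w).le (apply_le_iSup w z i) (apply_nonneg _ _) (hfpos w).le
  have h3 : f w * ⨆ i, w (z i : k) = w (g : k) * (C * H ^ (1 / d)) := by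
    simp only [hf]
    have := (hw w).ne'
    field_simp
  rw [← h1, h3] at h2
  exact le_of_mul_le_mul_left h2 (hgw w)
end Heights

open Module in
/-- There are `O(Y ^ d)` algebraic integers all of whose conjugates are at most `Y`. -/
theorem exists_ncard_box_le (k : Type*) [Field k] [NumberField k] :
    ∃ C : ℝ, 1 ≤ C ∧ ∀ Y : ℝ, 1 ≤ Y →
      {a : 𝓞 k | ∀ w : InfinitePlace k, w (a : k) ≤ Y}.Finite ∧
      ({a : 𝓞 k | ∀ w : InfinitePlace k, w (a : k) ≤ Y}.ncard : ℝ) ≤ C * Y ^ finrank ℚ k := by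
  classical
  obtain ⟨c, hc⟩ : ∃ c : ℝ, ∀ (α : 𝓞 k) i, ‖((RingOfIntegers.basis k).repr α i : ℝ)‖ ≤
      c * house (algebraMap (𝓞 k) k α) := by
    have h := house.basis_repr_norm_le_const_mul_house k
    simp only [Basis.repr_reindex, Finsupp.mapDomain_equiv_apply, integralBasis_repr_apply,
      eq_intCast, Rat.cast_intCast, Complex.norm_intCast] at h
    have key : ∀ (e : (k →+* ℂ) ≃ Free.ChooseBasisIndex ℤ (𝓞 k)) (c : ℝ),
        (∀ (α : 𝓞 k) (i : k →+* ℂ),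
        |((RingOfIntegers.basis k).repr α (e i) : ℝ)| ≤
          c * house (algebraMap (𝓞 k) k α)) →
        ∃ c : ℝ, ∀ (α : 𝓞 k) i, ‖((RingOfIntegers.basis k).repr α i : ℝ)‖ ≤
          c * house (algebraMap (𝓞 k) k α) := fun e c hc => ⟨c, fun α i => by
      simpa using hc α (e.symm i)⟩
    exact key _ _ h
  set c' := max c 0 with hc'
  refine ⟨(2 * c' + 1) ^ finrank ℚ k, one_le_pow₀ (by have : 0 ≤ c' := le_max_right _ _; linarith),
    fun Y hY => ?_⟩
  have hc'0 : 0 ≤ c' := le_max_right _ _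
  set N : ℤ := ⌊c' * Y⌋ with hN
  have hN0 : 0 ≤ N := Int.floor_nonneg.2 (by positivity)
  set F : 𝓞 k → (Free.ChooseBasisIndex ℤ (𝓞 k) → ℤ) := fun a => (RingOfIntegers.basis k).repr a
    with hF
  have hFinj : Function.Injective F := by
    intro a b hab
    apply (RingOfIntegers.basis k).repr.injective
    exact DFunLike.coe_injective hab
  set T : Finset (Free.ChooseBasisIndex ℤ (𝓞 k) → ℤ) :=
    Fintype.piFinset (fun _ => Finset.Icc (-N) N) with hT
  have hmaps : ∀ a ∈ {a : 𝓞 k | ∀ w : InfinitePlace k, w (a : k) ≤ Y}, F a ∈ (T : Set _) := by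
    intro a ha
    simp only [hT, Finset.mem_coe, Fintype.mem_piFinset, Finset.mem_Icc, ← abs_le]
    intro j
    have h1 := hc a j
    rw [Real.norm_eq_abs] at h1
    have h2 : house (algebraMap (𝓞 k) k a) ≤ Y := by
      rw [house, pi_norm_le_iff_of_nonneg (by linarith)]
      intro φ
      have := ha (InfinitePlace.mk φ)
      rwa [InfinitePlace.apply] at this
    rw [hN, Int.le_floor]
    push_cast
    refine h1.trans ?_
    calc c * house (algebraMap (𝓞 k) k a) ≤ c' * house (algebraMap (𝓞 k) k a) := by
          gcongr
          · exact house_nonneg _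
          · exact le_max_left _ _
      _ ≤ c' * Y := by gcongr
  have hfin : {a : 𝓞 k | ∀ w : InfinitePlace k, w (a : k) ≤ Y}.Finite :=
    Set.Finite.of_injOn hmaps hFinj.injOn T.finite_toSet
  refine ⟨hfin, ?_⟩
  have hcard := Set.ncard_le_ncard_of_injOn F hmaps hFinj.injOn T.finite_toSet
  rw [Set.ncard_coe_finset] at hcard
  have hTcard : T.card = (2 * N + 1).toNat ^ finrank ℚ k := by
    rw [hT, Fintype.card_piFinset]
    simp only [Int.card_Icc, Finset.prod_const, Finset.card_univ]
    rw [← finrank_eq_card_chooseBasisIndex, RingOfIntegers.rank]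
    congr 2; ring
  rw [hTcard] at hcard
  have h3 : (((2 * N + 1).toNat : ℕ) : ℝ) = 2 * N + 1 := by
    have : (((2 * N + 1).toNat : ℤ)) = 2 * N + 1 := Int.toNat_of_nonneg (by omega)
    exact_mod_cast this
  calc ({a : 𝓞 k | ∀ w : InfinitePlace k, w (a : k) ≤ Y}.ncard : ℝ)
      ≤ ((2 * N + 1).toNat ^ finrank ℚ k : ℕ) := by exact_mod_cast hcard
    _ = (2 * N + 1 : ℝ) ^ finrank ℚ k := by push_cast; rw [h3]
    _ ≤ ((2 * c' + 1) * Y) ^ finrank ℚ k := by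
      have : (N : ℝ) ≤ c' * Y := Int.floor_le _
      have : (0 : ℝ) ≤ N := by exact_mod_cast hN0
      gcongr
      nlinarith
    _ = _ := mul_pow _ _ _

lemma exists_finset_primes (n : ℕ) (hn : n ≠ 0) (J : ℕ) :
    ∃ s : Finset ℕ, s.card = J ∧ ∀ p ∈ s, p.Prime ∧ n < p ∧ p ≤ 2 ^ J * n := by
  induction J with
  | zero => exact ⟨∅, rfl, by simp⟩
  | succ J ih =>
    obtain ⟨s, hs, hp⟩ := ih
    obtain ⟨q, hq, hq1, hq2⟩ := Nat.exists_prime_lt_and_le_two_mul (2 ^ J * n) (by positivity)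
    refine ⟨insert q s, ?_, ?_⟩
    · rw [Finset.card_insert_of_notMem, hs]
      intro h
      have := (hp q h).2.2
      omega
    · intro p h
      rw [Finset.mem_insert] at h
      rw [pow_succ]
      have h2J : 1 ≤ 2 ^ J := Nat.one_le_two_pow
      rcases h with rfl | h
      · exact ⟨hq, lt_of_le_of_lt (by nlinarith) hq1, by linarith⟩
      · obtain ⟨h1, h2, h3⟩ := hp p h
        exact ⟨h1, h2, by nlinarith⟩

/-- A polynomially bounded integer is coprime to some prime of subpolynomial size. -/
lemma exists_prime_not_dvd (A κ ε : ℝ) (hA : 0 ≤ A) (hε : 0 < ε) (P : ℕ) :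
    ∃ C : ℝ, 1 ≤ C ∧ ∀ B : ℝ, 1 ≤ B → ∀ N : ℕ, N ≠ 0 → (N : ℝ) ≤ A * B ^ κ →
      ∃ p : ℕ, p.Prime ∧ ¬ p ∣ N ∧ P < p ∧ (p : ℝ) ≤ C * B ^ ε := by
  obtain ⟨J0, hJ0⟩ := exists_nat_ge (κ / ε)
  set J := J0 + 1 with hJ
  set Q := P + ⌈A⌉₊ + 2 with hQ
  refine ⟨2 ^ J * (2 * Q), ?_, fun B hB N hN0 hN => ?_⟩
  · have h1 : (1 : ℝ) ≤ 2 ^ J := one_le_pow₀ (by norm_num)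
    have h2 : (2 : ℝ) ≤ Q := by
      have : 2 ≤ Q := by omega
      exact_mod_cast this
    nlinarith
  have hBε : 1 ≤ B ^ ε := Real.one_le_rpow hB hε.le
  set n := ⌈B ^ ε⌉₊ * Q with hn
  have hceil : B ^ ε ≤ ⌈B ^ ε⌉₊ := Nat.le_ceil _
  have hceil1 : 1 ≤ ⌈B ^ ε⌉₊ := Nat.one_le_ceil_iff.2 (by linarith)
  have hn0 : n ≠ 0 := by
    have : 0 < Q := by omega
    positivity
  obtain ⟨s, hs, hp⟩ := exists_finset_primes n hn0 J
  obtain ⟨p, hps, hpN⟩ : ∃ p ∈ s, ¬ p ∣ N := by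
    by_contra! hcon
    have hdvd : ∏ p ∈ s, p ∣ N :=
      Finset.prod_primes_dvd N (fun p h => (hp p h).1.prime) hcon
    have h1 : n ^ J ≤ ∏ p ∈ s, p := by
      rw [← hs]
      exact Finset.pow_card_le_prod s _ _ fun p h => (hp p h).2.1.le
    have h2 : n ^ J ≤ N := h1.trans (Nat.le_of_dvd (Nat.pos_of_ne_zero hN0) hdvd)
    have h3 : ((n : ℝ)) ^ J ≤ A * B ^ κ := le_trans (by exact_mod_cast h2) hN
    have hQA : A + 1 ≤ Q := by
      have := Nat.le_ceil A
      rw [hQ]; push_cast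
      have : (0 : ℝ) ≤ P := by positivity
      linarith
    have h4 : (A + 1) * B ^ κ ≤ (n : ℝ) ^ J := by
      rw [hn]; push_cast
      rw [mul_pow, mul_comm]
      gcongr
      · calc B ^ κ ≤ B ^ (ε * J) := by
              apply Real.rpow_le_rpow_of_exponent_le hB
              rw [div_le_iff₀ hε] at hJ0
              have : (J0 : ℝ) ≤ J := by rw [hJ]; push_cast; linarith
              nlinarith
          _ = (B ^ ε) ^ J := by rw [Real.rpow_mul (by linarith), Real.rpow_natCast]
          _ ≤ _ := by gcongr
      · calc A + 1 ≤ Q := hQA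
          _ ≤ (Q : ℝ) ^ J := le_self_pow₀ (by linarith) (by omega)
    have : 0 < B ^ κ := by positivity
    nlinarith
  refine ⟨p, (hp p hps).1, hpN, ?_, ?_⟩
  · have h1 := (hp p hps).2.1
    have : P ≤ n := by
      rw [hn]; nlinarith
    omega
  · have h1 : (p : ℝ) ≤ 2 ^ J * n := by exact_mod_cast (hp p hps).2.2
    refine h1.trans ?_
    rw [hn]; push_cast
    have h2 : (⌈B ^ ε⌉₊ : ℝ) ≤ 2 * B ^ ε := by
      have := Nat.ceil_lt_add_one (a := B ^ ε) (by linarith)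
      linarith
    calc (2 : ℝ) ^ J * (⌈B ^ ε⌉₊ * Q) ≤ 2 ^ J * (2 * B ^ ε * Q) := by gcongr
      _ = _ := by ring

/-- Above a rational prime `p` there is a prime ideal, of norm between `p` and `p ^ d`. -/
lemma exists_prime_ideal_over (k : Type*) [Field k] [NumberField k] {p : ℕ} (hp : p.Prime) :
    ∃ 𝔭 : Ideal (𝓞 k), 𝔭.IsPrime ∧ 𝔭 ≠ ⊥ ∧ (p : 𝓞 k) ∈ 𝔭 ∧ p ≤ Ideal.absNorm 𝔭 ∧
      Ideal.absNorm 𝔭 ≤ p ^ Module.finrank ℚ k := by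
  have hnorm : Ideal.absNorm (Ideal.span {(p : 𝓞 k)}) = p ^ Module.finrank ℚ k := by
    rw [Ideal.absNorm_span_singleton]
    have := Algebra.norm_algebraMap (S := 𝓞 k) (p : ℤ)
    rw [map_natCast, RingOfIntegers.rank] at this
    rw [this]
    simp [Int.natAbs_pow]
  have hne : Ideal.span {(p : 𝓞 k)} ≠ ⊤ := by
    intro h
    rw [← Ideal.absNorm_eq_one_iff, hnorm] at h
    have := Nat.one_lt_pow (Module.finrank_pos (R := ℚ) (M := k)).ne' hp.one_lt
    omega
  obtain ⟨𝔭, hmax, hle⟩ := Ideal.exists_le_maximal _ hne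
  have hdvd : Ideal.absNorm 𝔭 ∣ p ^ Module.finrank ℚ k := by
    rw [← hnorm]; exact Ideal.absNorm_dvd_absNorm_of_le hle
  have hmem : (p : 𝓞 k) ∈ 𝔭 := hle (Ideal.mem_span_singleton_self _)
  refine ⟨𝔭, hmax.isPrime, ?_, hmem, ?_, Nat.le_of_dvd (pow_pos hp.pos _) hdvd⟩
  · rintro rfl
    rw [Ideal.mem_bot] at hmem
    exact hp.ne_zero (by exact_mod_cast hmem)
  · obtain ⟨j, -, hj⟩ := (Nat.dvd_prime_pow hp).1 hdvd
    have : j ≠ 0 := by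
      rintro rfl
      rw [pow_zero, Ideal.absNorm_eq_one_iff] at hj
      exact hmax.ne_top hj
    rw [hj]
    exact Nat.le_self_pow this p

section Ternary

variable {R : Type*} [CommRing R]

/-- The value at `x` of the ternary quadratic form with coefficient vector `c`. -/
def qf (c : Fin 6 → R) (x : Fin 3 → R) : R :=
  c 0 * x 0 ^ 2 + c 1 * x 1 ^ 2 + c 2 * x 2 ^ 2 +
    c 3 * (x 1 * x 2) + c 4 * (x 0 * x 2) + c 5 * (x 0 * x 1)

/-- The polar form of `qf c`. -/
def polarForm (c : Fin 6 → R) (x y : Fin 3 → R) : R :=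
  2 * (c 0 * (x 0 * y 0) + c 1 * (x 1 * y 1) + c 2 * (x 2 * y 2)) +
    c 3 * (x 1 * y 2 + x 2 * y 1) + c 4 * (x 0 * y 2 + x 2 * y 0) + c 5 * (x 0 * y 1 + x 1 * y 0)

/-- The determinant of the polar form of `qf c`. -/
def qdisc (c : Fin 6 → R) : R :=
  8 * (c 0 * c 1 * c 2) + 2 * (c 3 * c 4 * c 5) -
    2 * (c 0 * c 3 ^ 2 + c 1 * c 4 ^ 2 + c 2 * c 5 ^ 2)

/-- The determinant of three vectors. -/
def det3 (x y z : Fin 3 → R) : R :=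
  x 0 * (y 1 * z 2 - y 2 * z 1) - x 1 * (y 0 * z 2 - y 2 * z 0) + x 2 * (y 0 * z 1 - y 1 * z 0)

/-- The value at `x` of the linear form with coefficients `l`. -/
def linForm (l x : Fin 3 → R) : R := l 0 * x 0 + l 1 * x 1 + l 2 * x 2

/-- The member of the pencil of conics attached to `f = q₁ q₂ + q₃²` with parameter `(a : b)`. -/
def pencil (q₁ q₂ q₃ : Fin 6 → R) (a b : R) : Fin 6 → R :=
  fun i => a ^ 2 * q₁ i + 2 * a * b * q₃ i - b ^ 2 * q₂ i

lemma qf_pencil (q₁ q₂ q₃ : Fin 6 → R) (a b : R) (x : Fin 3 → R) :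
    qf (pencil q₁ q₂ q₃ a b) x = a ^ 2 * qf q₁ x + 2 * a * b * qf q₃ x - b ^ 2 * qf q₂ x := by
  simp only [qf, pencil]; ring

lemma map_qf {S : Type*} [CommRing S] (φ : R →+* S) (c : Fin 6 → R) (x : Fin 3 → R) :
    φ (qf c x) = qf (fun i => φ (c i)) (fun i => φ (x i)) := by
  simp [qf]

lemma map_qdisc {S : Type*} [CommRing S] (φ : R →+* S) (c : Fin 6 → R) :
    φ (qdisc c) = qdisc (fun i => φ (c i)) := by
  simp [qdisc, map_ofNat]

lemma map_det3 {S : Type*} [CommRing S] (φ : R →+* S) (x y z : Fin 3 → R) :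
    φ (det3 x y z) = det3 (fun i => φ (x i)) (fun i => φ (y i)) (fun i => φ (z i)) := by
  simp [det3]

lemma map_pencil {S : Type*} [CommRing S] (φ : R →+* S) (q₁ q₂ q₃ : Fin 6 → R) (a b : R) :
    (fun i => φ (pencil q₁ q₂ q₃ a b i)) =
      pencil (fun i => φ (q₁ i)) (fun i => φ (q₂ i)) (fun i => φ (q₃ i)) (φ a) (φ b) := by
  funext i; simp [pencil, map_ofNat]

lemma qf_smul (c : Fin 6 → R) (r : R) (x : Fin 3 → R) :
    qf c (fun i => r * x i) = r ^ 2 * qf c x := by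
  simp only [qf]; ring

lemma qf_sub (c : Fin 6 → R) (r s : R) (x y : Fin 3 → R) :
    qf c (fun i => r * x i - s * y i) =
      r ^ 2 * qf c x + s ^ 2 * qf c y - r * s * polarForm c x y := by
  simp only [qf, polarForm]; ring

/-- The Gram determinant of three vectors. -/
lemma det3_sq_mul_qdisc (c : Fin 6 → R) (x y z : Fin 3 → R) :
    det3 x y z ^ 2 * qdisc c =
      8 * (qf c x * qf c y * qf c z) +
        2 * (polarForm c x y * polarForm c y z * polarForm c x z) -
        2 * (qf c x * polarForm c y z ^ 2 + qf c y * polarForm c x z ^ 2 +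
          qf c z * polarForm c x y ^ 2) := by
  simp only [qf, polarForm, det3, qdisc]; ring

lemma det3_mul_det3 (l m n x y z : Fin 3 → R) :
    det3 l m n * det3 x y z =
      linForm l x * (linForm m y * linForm n z - linForm m z * linForm n y) -
      linForm l y * (linForm m x * linForm n z - linForm m z * linForm n x) +
      linForm l z * (linForm m x * linForm n y - linForm m y * linForm n x) := by
  simp only [det3, linForm]; ring

/-- Two vectors are proportional (over a domain) iff their cross product vanishes. -/
def NonProp (x y : Fin 3 → R) : Prop := ∃ i j, x i * y j - x j * y i ≠ 0

lemma NonProp.exists_det3_ne_zero {x y : Fin 3 → R} (h : NonProp x y) :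
    ∃ z, det3 x y z ≠ 0 := by
  by_contra! hcon
  have h0 := hcon ![1, 0, 0]
  have h1 := hcon ![0, 1, 0]
  have h2 := hcon ![0, 0, 1]
  simp [det3] at h0 h1 h2
  obtain ⟨i, j, hij⟩ := h
  apply hij
  fin_cases i <;> fin_cases j <;> simp only [Fin.zero_eta, Fin.mk_one, Fin.reduceFinMk] <;>
    first
    | linear_combination h0
    | linear_combination -h0
    | linear_combination h1
    | linear_combination -h1
    | linear_combination h2
    | linear_combination -h2
    | exact sub_self _

lemma polarForm_ne_zero [IsDomain R] {c : Fin 6 → R} (hc : qdisc c ≠ 0) {x y : Fin 3 → R}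
    (hxy : NonProp x y) (hx : qf c x = 0) (hy : qf c y = 0) : polarForm c x y ≠ 0 := by
  intro h
  obtain ⟨z, hz⟩ := hxy.exists_det3_ne_zero
  have := det3_sq_mul_qdisc c x y z
  rw [hx, hy, h] at this
  simp [hz, hc] at this

lemma det3_sq_mul_qdisc_of_isotropic {c : Fin 6 → R} {x y z : Fin 3 → R}
    (hx : qf c x = 0) (hy : qf c y = 0) (hz : qf c z = 0) :
    det3 x y z ^ 2 * qdisc c = 2 * (polarForm c x y * polarForm c y z * polarForm c x z) := by
  rw [det3_sq_mul_qdisc, hx, hy, hz]; ring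

/-- Three distinct points of a non-singular conic are not collinear. -/
lemma det3_ne_zero [IsDomain R] {c : Fin 6 → R} (h2 : (2 : R) ≠ 0) (hc : qdisc c ≠ 0)
    {x y z : Fin 3 → R} (hxy : NonProp x y) (hyz : NonProp y z) (hxz : NonProp x z)
    (hx : qf c x = 0) (hy : qf c y = 0) (hz : qf c z = 0) : det3 x y z ≠ 0 := by
  intro h
  have := det3_sq_mul_qdisc_of_isotropic hx hy hz
  rw [h] at this
  simp [h2, polarForm_ne_zero hc hxy hx hy, polarForm_ne_zero hc hyz hy hz,
    polarForm_ne_zero hc hxz hx hz] at this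

/-- On the conic with parameter `(a : b)`, the form with parameter `(μ : γ)` is divisible by
`γ a - μ b`, up to the factor `b ^ 2`. -/
lemma sq_mul_qf_pencil_right (q₁ q₂ q₃ : Fin 6 → R) (a b μ γ : R) (x : Fin 3 → R)
    (h : qf (pencil q₁ q₂ q₃ a b) x = 0) :
    b ^ 2 * qf (pencil q₁ q₂ q₃ μ γ) x =
      (γ * a - μ * b) * (-(qf q₁ x * (b * μ + γ * a)) - 2 * qf q₃ x * (b * γ)) := by
  rw [qf_pencil] at h ⊢
  linear_combination γ ^ 2 * h

lemma sq_mul_qf_pencil_left (q₁ q₂ q₃ : Fin 6 → R) (a b μ γ : R) (x : Fin 3 → R)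
    (h : qf (pencil q₁ q₂ q₃ a b) x = 0) :
    a ^ 2 * qf (pencil q₁ q₂ q₃ μ γ) x =
      (γ * a - μ * b) * (2 * qf q₃ x * (a * μ) - qf q₂ x * (a * γ + μ * b)) := by
  rw [qf_pencil] at h ⊢
  linear_combination μ ^ 2 * h

/-- A divisibility for determinants of three points in the same residue class. -/
lemma dvd_mul_det3 {D N : R} {l l' v x y z : Fin 3 → R}
    (hd : ∀ p ∈ ({x, y, z} : Set (Fin 3 → R)), D ∣ N * (linForm l p * linForm l' p))
    (hs : ∀ p ∈ ({x, y, z} : Set (Fin 3 → R)), ∀ q ∈ ({x, y, z} : Set (Fin 3 → R)),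
      ∃ r s, linForm l p = r * D + s * linForm l q) :
    D ∣ N * (det3 l l' v * det3 x y z) := by
  have key : ∀ p ∈ ({x, y, z} : Set (Fin 3 → R)), ∀ q ∈ ({x, y, z} : Set (Fin 3 → R)),
      D ∣ N * (linForm l p * linForm l' q) := by
    intro p hp q hq
    obtain ⟨r, s, h⟩ := hs p hp q hq
    obtain ⟨t, ht⟩ := hd q hq
    exact ⟨N * r * linForm l' q + s * t, by rw [h]; linear_combination s * ht⟩
  have hx : x ∈ ({x, y, z} : Set (Fin 3 → R)) := by simp
  have hy : y ∈ ({x, y, z} : Set (Fin 3 → R)) := by simp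
  have hz : z ∈ ({x, y, z} : Set (Fin 3 → R)) := by simp
  obtain ⟨t₁, h₁⟩ := key x hx y hy
  obtain ⟨t₂, h₂⟩ := key x hx z hz
  obtain ⟨t₃, h₃⟩ := key y hy x hx
  obtain ⟨t₄, h₄⟩ := key y hy z hz
  obtain ⟨t₅, h₅⟩ := key z hz x hx
  obtain ⟨t₆, h₆⟩ := key z hz y hy
  rw [det3_mul_det3]
  refine ⟨t₁ * linForm v z - t₂ * linForm v y - t₃ * linForm v z + t₄ * linForm v x +
    t₅ * linForm v y - t₆ * linForm v x, ?_⟩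
  linear_combination linForm v z * h₁ - linForm v y * h₂ - linForm v z * h₃ + linForm v x * h₄ +
    linForm v y * h₅ - linForm v x * h₆

/-- If `κ` lies in all the ideals `(D i, D j)` and every `D i` divides `n`, then the product of
the `D i` divides `n` up to a power of `κ`. -/
lemma prod_dvd_pow_mul {ι : Type*} [DecidableEq ι] (D : ι → R) (κ n : R) (s : Finset ι)
    (hκ : ∀ i j, i ≠ j → ∃ u v, κ = u * D i + v * D j) (hn : ∀ i ∈ s, D i ∣ n) :
    ∏ i ∈ s, D i ∣ κ ^ (s.card ^ 2) * n := by
  induction s using Finset.induction_on with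
  | empty => simp
  | insert i s his ih =>
    obtain ⟨t, ht⟩ := ih fun j hj => hn j (Finset.mem_insert_of_mem hj)
    obtain ⟨t', ht'⟩ := hn i (Finset.mem_insert_self _ _)
    have key : ∀ s' ⊆ s, ∃ u v, κ ^ s'.card = u * D i + v * ∏ j ∈ s', D j := by
      intro s' hs'
      induction s' using Finset.induction_on with
      | empty => exact ⟨0, 1, by simp⟩
      | insert j s' hj ih' =>
        obtain ⟨u, v, huv⟩ := ih' (fun k hk => hs' (Finset.mem_insert_of_mem hk))
        obtain ⟨u', v', huv'⟩ := hκ i j (by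
          rintro rfl; exact his (hs' (Finset.mem_insert_self _ _)))
        rw [Finset.card_insert_of_notMem hj, Finset.prod_insert hj, pow_succ, huv]
        refine ⟨u * κ + v * (∏ j ∈ s', D j) * u', v * v', ?_⟩
        linear_combination v * (∏ j ∈ s', D j) * huv'
    obtain ⟨u, v, huv⟩ := key s le_rfl
    rw [Finset.prod_insert his, Finset.card_insert_of_notMem his]
    have he : (s.card + 1) ^ 2 = s.card ^ 2 + s.card + (s.card + 1) := by ring
    rw [he, pow_add, pow_add]
    refine ⟨κ ^ (s.card + 1) * (u * t + v * κ ^ (s.card ^ 2) * t'), ?_⟩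
    linear_combination κ ^ (s.card + 1) * (κ ^ (s.card ^ 2) * n * huv + u * D i * ht +
      v * (∏ j ∈ s, D j) * κ ^ (s.card ^ 2) * ht')

end Ternary

section Params

variable {k : Type*} [Field k] [NumberField k]

lemma prod_const_pow_mult (c : ℝ) :
    ∏ w : InfinitePlace k, c ^ w.mult = c ^ Module.finrank ℚ k := by
  rw [Finset.prod_pow_eq_pow_sum, InfinitePlace.sum_mult_eq]

/-- Every projective point has an integral representative whose coordinates have size
comparable with `H ^ (1 / d)` at every infinite place and generate an ideal of bounded norm. -/
theorem exists_balanced_rep (k : Type*) [Field k] [NumberField k] :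
    ∃ (C : ℝ) (M : ℕ), 1 ≤ C ∧ M ≠ 0 ∧ ∀ {m : ℕ} (z : Fin m → 𝓞 k), z ≠ 0 →
      ∃ (g c : 𝓞 k) (y : Fin m → 𝓞 k), g ≠ 0 ∧ c ≠ 0 ∧ (∀ i, g * y i = c * z i) ∧
        (∀ (w : InfinitePlace k) i,
          w (y i : k) ≤ C * heightFn z ^ (1 / (Module.finrank ℚ k : ℝ))) ∧
        (∀ w : InfinitePlace k, ∃ i,
          heightFn z ^ (1 / (Module.finrank ℚ k : ℝ)) ≤ C * w (y i : k)) ∧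
        (M : 𝓞 k) ∈ Ideal.span (Set.range y) := by
  classical
  obtain ⟨C, hC1, hC⟩ := exists_small_rep k
  set d := Module.finrank ℚ k with hd
  have hd0 : 0 < d := Module.finrank_pos
  refine ⟨C ^ d, (⌊C ^ d⌋₊).factorial, one_le_pow₀ hC1, Nat.factorial_ne_zero _, fun {m} z hz => ?_⟩
  obtain ⟨g, c, y, hg, hc, hgy, hy⟩ := hC z hz
  have hheight := heightFn_eq_of_mul_eq hg hc hz hgy
  have hy0 : y ≠ 0 := by
    rintro rfl
    obtain ⟨i, hi⟩ := Function.ne_iff.1 hz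
    have := hgy i
    simp only [Pi.zero_apply, mul_zero] at this hi
    exact (mul_ne_zero hc hi) this.symm
  have hne : Nonempty (Fin m) := (Function.ne_iff.1 hz).nonempty
  have hH1 := one_le_heightFn hz
  set H := heightFn z with hH
  set Y := H ^ (1 / (d : ℝ)) with hY
  have hYd : Y ^ d = H := by
    rw [hY, ← Real.rpow_natCast, ← Real.rpow_mul (by linarith)]
    rw [one_div, inv_mul_cancel₀ (by positivity), Real.rpow_one]
  have hY1 : 1 ≤ Y := Real.one_le_rpow hH1 (by positivity)
  have hCd : C ≤ C ^ d := le_self_pow₀ hC1 hd0.ne'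
  set s : InfinitePlace k → ℝ := fun w => ⨆ i, w (y i : k) with hs
  have hs0 : ∀ w, 0 ≤ s w := fun w => Real.iSup_nonneg fun i => apply_nonneg w _
  have hsle : ∀ w, s w ≤ C * Y := fun w => ciSup_le fun i => hy w i
  have hN := absNorm_mul_heightFn hy0
  rw [hheight] at hN
  simp only [iSup_plNorm] at hN
  change _ = ∏ w, s w ^ w.mult at hN
  have hNpos := absNorm_pos_of_ne_bot (span_range_ne_bot hy0)
  have hN1 : (1 : ℝ) ≤ Ideal.absNorm (Ideal.span (Set.range y)) := by
    exact_mod_cast (by exact_mod_cast hNpos : 0 < Ideal.absNorm (Ideal.span (Set.range y)))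
  have hCY : 0 < C * Y := by positivity
  refine ⟨g, c, y, hg, hc, hgy, fun w i => (hy w i).trans (by gcongr), fun w => ?_, ?_⟩
  · obtain ⟨i, hi⟩ := exists_eq_ciSup_of_finite (f := fun i => w (y i : k))
    refine ⟨i, ?_⟩
    rw [hi]
    change Y ≤ C ^ d * s w
    have h1 : ∏ w, (s w / (C * Y)) ^ w.mult ≤ s w / (C * Y) := by
      rw [← Finset.mul_prod_erase _ _ (Finset.mem_univ w)]
      have h2 : ∀ w, s w / (C * Y) ≤ 1 := fun w => (div_le_one hCY).2 (hsle w)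
      have h3 : ∀ w, 0 ≤ s w / (C * Y) := fun w => div_nonneg (hs0 w) hCY.le
      calc _ ≤ (s w / (C * Y)) * 1 := by
            apply mul_le_mul
            · exact pow_le_of_le_one (h3 w) (h2 w) (InfinitePlace.mult_pos).ne'
            · exact Finset.prod_le_one (fun v _ => pow_nonneg (h3 v) _)
                (fun v _ => pow_le_one₀ (h3 v) (h2 v))
            · exact Finset.prod_nonneg (fun v _ => pow_nonneg (h3 v) _)
            · exact h3 w
        _ = _ := mul_one _
    simp only [div_pow, Finset.prod_div_distrib] at h1
    rw [← hN, prod_const_pow_mult, mul_pow, ← hd, hYd] at h1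
    rw [div_le_div_iff₀ (by positivity) hCY] at h1
    have h4 : H * (C * Y) ≤ s w * (C ^ d * H) :=
      le_trans (by gcongr; nlinarith) h1
    have h5 : C * Y ≤ s w * C ^ d := by
      have : H * (C * Y) ≤ H * (s w * C ^ d) := by linarith
      exact le_of_mul_le_mul_left this (by linarith)
    nlinarith
  · have h1 : (Ideal.absNorm (Ideal.span (Set.range y)) : ℝ) ≤ C ^ d := by
      have : (Ideal.absNorm (Ideal.span (Set.range y)) : ℝ) * H ≤ C ^ d * H := by
        rw [hN]
        calc _ ≤ ∏ w : InfinitePlace k, (C * Y) ^ w.mult :=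
              Finset.prod_le_prod (fun w _ => pow_nonneg (hs0 w) _)
                (fun w _ => pow_le_pow_left₀ (hs0 w) (hsle w) _)
          _ = _ := by rw [prod_const_pow_mult, mul_pow, ← hd, hYd]
      exact le_of_mul_le_mul_right this (by linarith)
    have h2 : Ideal.absNorm (Ideal.span (Set.range y)) ∣ (⌊C ^ d⌋₊).factorial :=
      Nat.dvd_factorial (by exact_mod_cast hNpos) (Nat.le_floor h1)
    obtain ⟨t, ht⟩ := h2
    rw [ht]; push_cast
    exact Ideal.mul_mem_right _ _ (Ideal.absNorm_mem _)

lemma AbsoluteValue.qf_le {F : Type*} [CommRing F] (v : AbsoluteValue F ℝ) {c : Fin 6 → F}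
    {x : Fin 3 → F} {H X : ℝ} (hc : ∀ i, v (c i) ≤ H) (hx : ∀ j, v (x j) ≤ X) :
    v (qf c x) ≤ 6 * H * X ^ 2 := by
  have hX : 0 ≤ X := (v.nonneg _).trans (hx 0)
  have hH : 0 ≤ H := (v.nonneg _).trans (hc 0)
  have key : ∀ i j l, v (c i * (x j * x l)) ≤ H * X ^ 2 := by
    intro i j l
    rw [v.map_mul, v.map_mul, sq]
    have := v.nonneg (x j)
    have := v.nonneg (x l)
    gcongr
    exacts [hc i, hx j, hx l]
  have e : qf c x = c 0 * (x 0 * x 0) + c 1 * (x 1 * x 1) + c 2 * (x 2 * x 2) +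
    c 3 * (x 1 * x 2) + c 4 * (x 0 * x 2) + c 5 * (x 0 * x 1) := by
    simp only [qf]; ring
  rw [e]
  have t1 := v.add_le (c 0 * (x 0 * x 0) + c 1 * (x 1 * x 1) + c 2 * (x 2 * x 2) +
    c 3 * (x 1 * x 2) + c 4 * (x 0 * x 2)) (c 5 * (x 0 * x 1))
  have t2 := v.add_le (c 0 * (x 0 * x 0) + c 1 * (x 1 * x 1) + c 2 * (x 2 * x 2) +
    c 3 * (x 1 * x 2)) (c 4 * (x 0 * x 2))
  have t3 := v.add_le (c 0 * (x 0 * x 0) + c 1 * (x 1 * x 1) + c 2 * (x 2 * x 2))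
    (c 3 * (x 1 * x 2))
  have t4 := v.add_le (c 0 * (x 0 * x 0) + c 1 * (x 1 * x 1)) (c 2 * (x 2 * x 2))
  have t5 := v.add_le (c 0 * (x 0 * x 0)) (c 1 * (x 1 * x 1))
  have := key 0 0 0
  have := key 1 1 1
  have := key 2 2 2
  have := key 3 1 2
  have := key 4 0 2
  have := key 5 0 1
  linarith

lemma exists_place_bound (s : Set k) (hs : s.Finite) :
    ∃ H : ℝ, 1 ≤ H ∧ ∀ w : InfinitePlace k, ∀ c ∈ s, w c ≤ H := by
  have hfin : ((Set.univ : Set (InfinitePlace k)) ×ˢ s).Finite := Set.finite_univ.prod hs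
  obtain ⟨H, hH⟩ := (hfin.image fun p : InfinitePlace k × k => p.1 p.2).bddAbove
  refine ⟨max H 1, le_max_right _ _, fun w c hc => le_trans (hH ?_) (le_max_left _ _)⟩
  exact ⟨(w, c), ⟨Set.mem_univ _, hc⟩, rfl⟩

lemma absNorm_mul_heightFn_le {m : ℕ} {y : Fin m → 𝓞 k} (hy : y ≠ 0) {Z : ℝ}
    (h : ∀ (w : InfinitePlace k) i, w (y i : k) ≤ Z) :
    (Ideal.absNorm (Ideal.span (Set.range y)) : ℝ) * heightFn y ≤ Z ^ Module.finrank ℚ k := by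
  have hne : Nonempty (Fin m) := (Function.ne_iff.1 hy).nonempty
  rw [absNorm_mul_heightFn hy, ← prod_const_pow_mult]
  refine Finset.prod_le_prod (fun w _ => (iSup_plNorm_pos w hy).le) fun w _ => ?_
  exact ciSup_le fun i => pow_le_pow_left₀ (apply_nonneg w _) (h w i) _

lemma one_le_absNorm {I : Ideal (𝓞 k)} (hI : I ≠ ⊥) : (1 : ℝ) ≤ Ideal.absNorm I := by
  have := absNorm_pos_of_ne_bot hI
  exact_mod_cast (by exact_mod_cast this : 0 < Ideal.absNorm I)

/-- A point `x` with `q₁(x) q₂(x) + q₃(x)²` a square lies on a conic of the pencil with parameter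
of height at most the size of `x`. -/
theorem exists_parameter (q₁ q₂ q₃ : Fin 6 → 𝓞 k) :
    ∃ C : ℝ, 1 ≤ C ∧ ∀ X : ℝ, 1 ≤ X → ∀ x : Fin 3 → 𝓞 k,
      (∀ (w : InfinitePlace k) j, w (x j : k) ≤ X) →
      (∃ T, T ^ 2 = qf q₃ x ^ 2 + qf q₁ x * qf q₂ x) →
      ∃ a b : 𝓞 k, ![a, b] ≠ 0 ∧ qf (pencil q₁ q₂ q₃ a b) x = 0 ∧
        heightFn ![a, b] ≤ C * X ^ Module.finrank ℚ k := by
  set d := Module.finrank ℚ k with hd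
  obtain ⟨H, hH1, hH⟩ := exists_place_bound (k := k)
    (Set.range (fun i => (q₁ i : k)) ∪ Set.range (fun i => (q₂ i : k)) ∪
      Set.range (fun i => (q₃ i : k)))
    (((Set.finite_range _).union (Set.finite_range _)).union (Set.finite_range _))
  refine ⟨(18 * H) ^ d, one_le_pow₀ (by linarith), fun X hX x hx ⟨T, hT⟩ => ?_⟩
  have hsize : ∀ (w : InfinitePlace k) (q : Fin 6 → 𝓞 k), (∀ i, w (q i : k) ≤ H) →
      w (qf q x : 𝓞 k) ≤ 6 * H * X ^ 2 := by
    intro w q hq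
    have := map_qf (algebraMap (𝓞 k) k) q x
    rw [show ((qf q x : 𝓞 k) : k) = algebraMap (𝓞 k) k (qf q x) from rfl, this]
    exact w.1.qf_le hq (hx w)
  have h1 := fun w => hsize w q₁ (fun i => hH w _ (by simp))
  have h2 := fun w => hsize w q₂ (fun i => hH w _ (by simp))
  have h3 := fun w => hsize w q₃ (fun i => hH w _ (by simp))
  have hXd : 1 ≤ X ^ d := one_le_pow₀ hX
  by_cases hA : qf q₁ x = 0
  · have hne : (![1, 0] : Fin 2 → 𝓞 k) ≠ 0 := fun h => by simpa using congrFun h 0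
    refine ⟨1, 0, hne, by rw [qf_pencil, hA]; ring, ?_⟩
    have h4 := absNorm_mul_heightFn_le hne (Z := 1) (by
      intro w i; fin_cases i <;> simp)
    have h5 := one_le_absNorm (span_range_ne_bot hne)
    have h6 := one_le_heightFn hne
    rw [one_pow] at h4
    have h7 : heightFn (![1, 0] : Fin 2 → 𝓞 k) ≤ 1 := by nlinarith
    have h8 : 1 ≤ (18 * H) ^ d := one_le_pow₀ (by linarith)
    nlinarith
  set A := qf q₁ x with hAdef
  set y : Fin 2 → 𝓞 k := ![T - qf q₃ x, A] with hy
  set y' : Fin 2 → 𝓞 k := ![-T - qf q₃ x, A] with hy'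
  have hy0 : y ≠ 0 := fun h => hA (by simpa [hy] using congrFun h 1)
  have hy0' : y' ≠ 0 := fun h => hA (by simpa [hy'] using congrFun h 1)
  have hP : qf (pencil q₁ q₂ q₃ (T - qf q₃ x) A) x = 0 := by
    rw [qf_pencil]; linear_combination A * hT
  have hP' : qf (pencil q₁ q₂ q₃ (-T - qf q₃ x) A) x = 0 := by
    rw [qf_pencil]; linear_combination A * hT
  suffices heightFn y ≤ (18 * H) ^ d * X ^ d ∨ heightFn y' ≤ (18 * H) ^ d * X ^ d by
    rcases this with h | h
    · exact ⟨_, _, hy0, hP, h⟩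
    · exact ⟨_, _, hy0', hP', h⟩
  have hI := span_range_ne_bot hy0
  have hI' := span_range_ne_bot hy0'
  have hmem : ∀ i j, y i * y' j ∈ Ideal.span {A} := by
    intro i j
    rw [Ideal.mem_span_singleton]
    fin_cases i <;> fin_cases j <;> simp [hy, hy']
    exact ⟨-qf q₂ x, by linear_combination -hT⟩
  have hle : Ideal.span (Set.range y) * Ideal.span (Set.range y') ≤ Ideal.span {A} := by
    rw [Ideal.span_mul_span', Ideal.span_le]
    rintro _ ⟨_, ⟨i, rfl⟩, _, ⟨j, rfl⟩, rfl⟩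
    exact hmem i j
  have hNle := absNorm_le_of_le (mul_ne_zero hI hI') hle
  rw [map_mul] at hNle
  push_cast at hNle
  have hprod : ∏ w : InfinitePlace k, ((⨆ i, plNorm w (y i : k)) * ⨆ i, plNorm w (y' i : k)) ≤
      ∏ w : InfinitePlace k, plNorm w (A : k) * (18 * H * X ^ 2) ^ w.mult := by
    refine Finset.prod_le_prod (fun w _ =>
      mul_nonneg (iSup_plNorm_pos w hy0).le (iSup_plNorm_pos w hy0').le) fun w _ => ?_
    obtain ⟨i, hi⟩ := exists_eq_ciSup_of_finite (f := fun i => plNorm w (y i : k))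
    obtain ⟨j, hj⟩ := exists_eq_ciSup_of_finite (f := fun i => plNorm w (y' i : k))
    rw [← hi, ← hj]
    simp only [plNorm]
    rw [← mul_pow, ← mul_pow]
    refine pow_le_pow_left₀ (mul_nonneg (apply_nonneg w _) (apply_nonneg w _)) ?_ _
    have hT2 : w (T : k) ≤ 12 * H * X ^ 2 := by
      have e : ((T : k)) ^ 2 = (qf q₃ x : 𝓞 k) ^ 2 + (A : k) * (qf q₂ x : 𝓞 k) := by
        exact_mod_cast congrArg (algebraMap (𝓞 k) k) hT
      have := w.1.add_le ((qf q₃ x : 𝓞 k) ^ 2 : k) ((A : k) * (qf q₂ x : 𝓞 k))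
      rw [← e] at this
      change w ((T : k) ^ 2) ≤ w (((qf q₃ x : 𝓞 k) : k) ^ 2) + w ((A : k) * (qf q₂ x : 𝓞 k)) at this
      rw [map_pow w, map_pow w, map_mul w] at this
      have g1 : w (A : k) * w (qf q₂ x : 𝓞 k) ≤ (6 * H * X ^ 2) * (6 * H * X ^ 2) :=
        mul_le_mul (h1 w) (h2 w) (apply_nonneg w _) (by positivity)
      have g2 : w (qf q₃ x : 𝓞 k) ^ 2 ≤ (6 * H * X ^ 2) ^ 2 :=
        pow_le_pow_left₀ (apply_nonneg w _) (h3 w) 2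
      have g3 : 0 ≤ 6 * H * X ^ 2 := by positivity
      nlinarith [apply_nonneg w (T : k)]
    have hHX : 0 ≤ 6 * H * X ^ 2 := by positivity
    have hbm : w ((T - qf q₃ x : 𝓞 k) : k) ≤ 18 * H * X ^ 2 := by
      have := w.1.sub_le_add (T : k) (qf q₃ x : 𝓞 k)
      change w ((T : k) - (qf q₃ x : 𝓞 k)) ≤ w (T : k) + w (qf q₃ x : 𝓞 k) at this
      push_cast
      linarith [h3 w]
    have hbp : w ((-T - qf q₃ x : 𝓞 k) : k) ≤ 18 * H * X ^ 2 := by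
      have := w.1.sub_le_add (-T : k) (qf q₃ x : 𝓞 k)
      rw [w.1.map_neg] at this
      change w ((-T : k) - (qf q₃ x : 𝓞 k)) ≤ w (T : k) + w (qf q₃ x : 𝓞 k) at this
      push_cast
      linarith [h3 w]
    have hbA : w (A : k) ≤ 18 * H * X ^ 2 := by linarith [h1 w]
    have hA0 := apply_nonneg w (A : k)
    fin_cases i <;> fin_cases j <;> simp [hy, hy'] <;> push_cast at hbm hbp
    · rw [← map_mul w]
      have e : ((T : k) - (qf q₃ x : 𝓞 k)) * (-(T : k) - (qf q₃ x : 𝓞 k)) =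
          - ((A : k) * (qf q₂ x : 𝓞 k)) := by
        have : ((T : k)) ^ 2 = (qf q₃ x : 𝓞 k) ^ 2 + (A : k) * (qf q₂ x : 𝓞 k) := by
          exact_mod_cast congrArg (algebraMap (𝓞 k) k) hT
        linear_combination -this
      rw [e]
      change w.1 _ ≤ _
      rw [w.1.map_neg, w.1.map_mul]
      exact mul_le_mul_of_nonneg_left ((h2 w).trans (by linarith)) hA0
    · rw [mul_comm]; gcongr
    · gcongr
    · gcongr
  rw [Finset.prod_mul_distrib, Finset.prod_mul_distrib, ← absNorm_mul_heightFn hy0,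
    ← absNorm_mul_heightFn hy0', prod_plNorm, prod_const_pow_mult] at hprod
  have hNI := absNorm_pos_of_ne_bot hI
  have hNI' := absNorm_pos_of_ne_bot hI'
  set N := (Ideal.absNorm (Ideal.span (Set.range y)) : ℝ)
  set N' := (Ideal.absNorm (Ideal.span (Set.range y')) : ℝ)
  have hfinal : heightFn y * heightFn y' ≤ (18 * H * X ^ 2) ^ d := by
    have : (N * N') * (heightFn y * heightFn y') ≤ (N * N') * (18 * H * X ^ 2) ^ d := by
      calc _ = N * heightFn y * (N' * heightFn y') := by ring
        _ ≤ _ := hprod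
        _ ≤ _ := by gcongr
    exact le_of_mul_le_mul_left this (by positivity)
  by_contra! hcon
  have hC1 : 1 ≤ (18 * H) ^ d := one_le_pow₀ (by linarith)
  have : ((18 * H) ^ d * X ^ d) * ((18 * H) ^ d * X ^ d) < heightFn y * heightFn y' :=
    mul_lt_mul'' hcon.1 hcon.2 (by positivity) (by positivity)
  have e : (18 * H * X ^ 2) ^ d = (18 * H) ^ d * (X ^ d * X ^ d) := by
    rw [mul_pow, ← pow_mul, mul_comm 2 d, pow_mul, sq]
  rw [e] at hfinal
  have : (18 * H) ^ d * (X ^ d * X ^ d) ≤ (18 * H) ^ d * ((18 * H) ^ d * (X ^ d * X ^ d)) :=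
    mul_le_mul_of_nonneg_left (le_mul_of_one_le_left (by positivity) hC1) (by positivity)
  nlinarith

end Params

/-- A pencil of conics `a² q₁ + 2 a b q₃ - b² q₂` over `𝓞 k` together with a splitting of its six
singular members over `K`. -/
structure SplitPencil (k K : Type*) [Field k] [NumberField k] [Field K] [NumberField K]
    [Algebra k K] where
  /-- The first quadratic form. -/
  q₁ : Fin 6 → 𝓞 k
  /-- The second quadratic form. -/
  q₂ : Fin 6 → 𝓞 k
  /-- The third quadratic form. -/
  q₃ : Fin 6 → 𝓞 k
  /-- The common denominator of the singular parameters. -/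
  γ : 𝓞 K
  /-- The numerators of the singular parameters. -/
  μ : Fin 6 → 𝓞 K
  /-- The common denominator of the linear factors. -/
  e : 𝓞 K
  /-- The first linear factors. -/
  l : Fin 6 → Fin 3 → 𝓞 K
  /-- The second linear factors. -/
  l' : Fin 6 → Fin 3 → 𝓞 K
  /-- Linear forms completing the linear factors to a basis. -/
  v : Fin 6 → Fin 3 → 𝓞 K
  γ_ne_zero : γ ≠ 0
  μ_injective : Function.Injective μ
  det_ne_zero : ∀ i, det3 (l i) (l' i) (v i) ≠ 0
  factor : ∀ i (x : Fin 3 → 𝓞 K),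
    e * qf (pencil (fun j => algebraMap (𝓞 k) (𝓞 K) (q₁ j)) (fun j => algebraMap (𝓞 k) (𝓞 K) (q₂ j))
      (fun j => algebraMap (𝓞 k) (𝓞 K) (q₃ j)) (μ i) γ) x = linForm (l i) x * linForm (l' i) x
  qdisc_eq_zero : ∀ a b : 𝓞 k, ![a, b] ≠ 0 → qdisc (pencil q₁ q₂ q₃ a b) = 0 →
    ∃ i, γ * algebraMap (𝓞 k) (𝓞 K) a = μ i * algebraMap (𝓞 k) (𝓞 K) b

namespace SplitPencil

variable {k K : Type*} [Field k] [NumberField k] [Field K] [NumberField K] [Algebra k K]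
  (P : SplitPencil k K)

/-- The conic of the pencil with parameter `(a : b)`. -/
def conic (a b : 𝓞 k) : Fin 6 → 𝓞 k := pencil P.q₁ P.q₂ P.q₃ a b

/-- The resultant of `(a : b)` with the `i`-th singular parameter. -/
def D (a b : 𝓞 k) (i : Fin 6) : 𝓞 K :=
  P.γ * algebraMap (𝓞 k) (𝓞 K) a - P.μ i * algebraMap (𝓞 k) (𝓞 K) b

/-- The value of the first linear factor of the `i`-th singular conic. -/
def L (i : Fin 6) (x : Fin 3 → 𝓞 k) : 𝓞 K := linForm (P.l i) fun j => algebraMap (𝓞 k) (𝓞 K) (x j)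

/-- The value of the second linear factor of the `i`-th singular conic. -/
def L' (i : Fin 6) (x : Fin 3 → 𝓞 k) : 𝓞 K :=
  linForm (P.l' i) fun j => algebraMap (𝓞 k) (𝓞 K) (x j)

/-- The determinant expressing the independence of the `i`-th linear factors. -/
def E (i : Fin 6) : 𝓞 K := det3 (P.l i) (P.l' i) (P.v i)

/-- A multiple of all resultants of pairs of singular parameters. -/
def κ (M : ℕ) : 𝓞 K := M * P.γ * ∏ p ∈ (Finset.univ : Finset (Fin 6)).offDiag, (P.μ p.1 - P.μ p.2)

/-- The value at `x` of the `i`-th singular conic. -/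
def sing (i : Fin 6) (x : Fin 3 → 𝓞 k) : 𝓞 K :=
  qf (pencil (fun j => algebraMap (𝓞 k) (𝓞 K) (P.q₁ j)) (fun j => algebraMap (𝓞 k) (𝓞 K) (P.q₂ j))
      (fun j => algebraMap (𝓞 k) (𝓞 K) (P.q₃ j)) (P.μ i) P.γ) fun j => algebraMap (𝓞 k) (𝓞 K) (x j)

lemma e_mul_sing (i : Fin 6) (x : Fin 3 → 𝓞 k) : P.e * P.sing i x = P.L i x * P.L' i x :=
  P.factor i _

lemma κ_ne_zero {M : ℕ} (hM : M ≠ 0) : P.κ M ≠ 0 := by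
  refine mul_ne_zero (mul_ne_zero (by exact_mod_cast hM) P.γ_ne_zero) ?_
  rw [Finset.prod_ne_zero_iff]
  intro p hp
  rw [Finset.mem_offDiag] at hp
  exact sub_ne_zero.2 fun h => hp.2.2 (P.μ_injective h)

lemma E_ne_zero (i : Fin 6) : P.E i ≠ 0 := P.det_ne_zero i

lemma map_conic_eq_zero {a b : 𝓞 k} {x : Fin 3 → 𝓞 k} (hx : qf (P.conic a b) x = 0) :
    qf (pencil (fun j => algebraMap (𝓞 k) (𝓞 K) (P.q₁ j))
      (fun j => algebraMap (𝓞 k) (𝓞 K) (P.q₂ j))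
      (fun j => algebraMap (𝓞 k) (𝓞 K) (P.q₃ j)) (algebraMap (𝓞 k) (𝓞 K) a)
      (algebraMap (𝓞 k) (𝓞 K) b)) (fun j => algebraMap (𝓞 k) (𝓞 K) (x j)) = 0 := by
  rw [← map_pencil, ← map_qf, ← conic, hx, map_zero]

lemma sq_mul_sing_right {a b : 𝓞 k} {x : Fin 3 → 𝓞 k} (hx : qf (P.conic a b) x = 0) (i : Fin 6) :
    algebraMap (𝓞 k) (𝓞 K) b ^ 2 * P.sing i x = P.D a b i *
      (-(algebraMap (𝓞 k) (𝓞 K) (qf P.q₁ x) * (algebraMap (𝓞 k) (𝓞 K) b * P.μ i +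
        P.γ * algebraMap (𝓞 k) (𝓞 K) a)) -
        2 * algebraMap (𝓞 k) (𝓞 K) (qf P.q₃ x) * (algebraMap (𝓞 k) (𝓞 K) b * P.γ)) := by
  have := sq_mul_qf_pencil_right _ _ _ _ _ (P.μ i) P.γ _ (P.map_conic_eq_zero hx)
  rw [← map_qf, ← map_qf] at this
  exact this

lemma sq_mul_sing_left {a b : 𝓞 k} {x : Fin 3 → 𝓞 k} (hx : qf (P.conic a b) x = 0) (i : Fin 6) :
    algebraMap (𝓞 k) (𝓞 K) a ^ 2 * P.sing i x = P.D a b i *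
      (2 * algebraMap (𝓞 k) (𝓞 K) (qf P.q₃ x) * (algebraMap (𝓞 k) (𝓞 K) a * P.μ i) -
        algebraMap (𝓞 k) (𝓞 K) (qf P.q₂ x) * (algebraMap (𝓞 k) (𝓞 K) a * P.γ +
        P.μ i * algebraMap (𝓞 k) (𝓞 K) b)) := by
  have := sq_mul_qf_pencil_left _ _ _ _ _ (P.μ i) P.γ _ (P.map_conic_eq_zero hx)
  rw [← map_qf, ← map_qf] at this
  exact this

lemma exists_eq_mul_add_mul {k K : Type*} [Field k] [Field K] [Algebra k K] {M : ℕ} {a b : 𝓞 k}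
    (hM : (M : 𝓞 k) ∈ Ideal.span (Set.range ![a, b])) :
    ∃ u v : 𝓞 K, (M : 𝓞 K) = u * algebraMap (𝓞 k) (𝓞 K) a + v * algebraMap (𝓞 k) (𝓞 K) b := by
  have : Set.range ![a, b] = {a, b} := by simp [Matrix.range_cons, Set.pair_comm]
  rw [this, Ideal.mem_span_pair] at hM
  obtain ⟨u, v, h⟩ := hM
  refine ⟨algebraMap (𝓞 k) (𝓞 K) u, algebraMap (𝓞 k) (𝓞 K) v, ?_⟩
  rw [← map_mul, ← map_mul, ← map_add, h, map_natCast]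

lemma D_dvd {M : ℕ} {a b : 𝓞 k} (hM : (M : 𝓞 k) ∈ Ideal.span (Set.range ![a, b]))
    {x : Fin 3 → 𝓞 k} (hx : qf (P.conic a b) x = 0) (i : Fin 6) :
    P.D a b i ∣ (M : 𝓞 K) ^ 3 * (P.L i x * P.L' i x) := by
  obtain ⟨u, v, h⟩ := exists_eq_mul_add_mul (K := K) hM
  set a' := algebraMap (𝓞 k) (𝓞 K) a
  set b' := algebraMap (𝓞 k) (𝓞 K) b
  have h1 : P.D a b i ∣ a' ^ 2 * P.sing i x := ⟨_, P.sq_mul_sing_left hx i⟩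
  have h2 : P.D a b i ∣ b' ^ 2 * P.sing i x := ⟨_, P.sq_mul_sing_right hx i⟩
  rw [← e_mul_sing, h]
  have e : (u * a' + v * b') ^ 3 * (P.e * P.sing i x) =
      (P.e * (u ^ 3 * a' + 3 * u ^ 2 * v * b')) * (a' ^ 2 * P.sing i x) +
      (P.e * (v ^ 3 * b' + 3 * u * v ^ 2 * a')) * (b' ^ 2 * P.sing i x) := by ring
  rw [e]
  exact dvd_add (Dvd.dvd.mul_left h1 _) (Dvd.dvd.mul_left h2 _)

lemma exists_κ_eq {M : ℕ} {a b : 𝓞 k} (hM : (M : 𝓞 k) ∈ Ideal.span (Set.range ![a, b]))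
    (i j : Fin 6) (hij : i ≠ j) : ∃ u v, P.κ M = u * P.D a b i + v * P.D a b j := by
  obtain ⟨u, v, h⟩ := exists_eq_mul_add_mul (K := K) hM
  obtain ⟨t, ht⟩ : P.μ j - P.μ i ∣
      ∏ p ∈ (Finset.univ : Finset (Fin 6)).offDiag, (P.μ p.1 - P.μ p.2) :=
    Finset.dvd_prod_of_mem (fun p : Fin 6 × Fin 6 => P.μ p.1 - P.μ p.2) (a := (j, i))
      (by simp [hij.symm])
  rw [κ, ht, h, D, D]
  exact ⟨t * (u * P.μ j + v * P.γ), -(t * (u * P.μ i + v * P.γ)), by ring⟩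

/-- The determinant of three points of a conic of the pencil in the same residue classes is
divisible by all resultants, up to a bounded factor. -/
lemma prod_D_dvd {M : ℕ} {a b : 𝓞 k} (hM : (M : 𝓞 k) ∈ Ideal.span (Set.range ![a, b]))
    {x y z : Fin 3 → 𝓞 k} (hc : ∀ p ∈ ({x, y, z} : Set (Fin 3 → 𝓞 k)), qf (P.conic a b) p = 0)
    (hs : ∀ i, ∀ p ∈ ({x, y, z} : Set (Fin 3 → 𝓞 k)), ∀ q ∈ ({x, y, z} : Set (Fin 3 → 𝓞 k)),
      ∃ r s, P.L i p = r * P.D a b i + s * P.L i q) :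
    ∏ i, P.D a b i ∣ (P.κ M ^ 36 * (M : 𝓞 K) ^ 3 * ∏ i, P.E i) *
      algebraMap (𝓞 k) (𝓞 K) (det3 x y z) := by
  have h := prod_dvd_pow_mul (P.D a b) (P.κ M)
    ((M : 𝓞 K) ^ 3 * ((∏ i, P.E i) * algebraMap (𝓞 k) (𝓞 K) (det3 x y z))) Finset.univ
    (P.exists_κ_eq hM) (fun i _ => ?_)
  · rw [Finset.card_univ, Fintype.card_fin] at h
    convert h using 1
    ring
  · have h1 := dvd_mul_det3 (D := P.D a b i) (N := (M : 𝓞 K) ^ 3) (l := P.l i) (l' := P.l' i)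
      (v := P.v i) (x := fun j => algebraMap (𝓞 k) (𝓞 K) (x j))
      (y := fun j => algebraMap (𝓞 k) (𝓞 K) (y j)) (z := fun j => algebraMap (𝓞 k) (𝓞 K) (z j))
      (by
        rintro _ (rfl | rfl | rfl)
        · exact P.D_dvd hM (hc x (by simp)) i
        · exact P.D_dvd hM (hc y (by simp)) i
        · exact P.D_dvd hM (hc z (by simp)) i)
      (by
        have := hs i
        rintro _ (rfl | rfl | rfl) _ (rfl | rfl | rfl)
        exacts [hs i x (by simp) x (by simp), hs i x (by simp) y (by simp),
          hs i x (by simp) z (by simp), hs i y (by simp) x (by simp),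
          hs i y (by simp) y (by simp), hs i y (by simp) z (by simp),
          hs i z (by simp) x (by simp), hs i z (by simp) y (by simp),
          hs i z (by simp) z (by simp)])
    rw [← map_det3] at h1
    refine h1.trans (mul_dvd_mul_left _ (mul_dvd_mul_right ?_ _))
    exact Finset.dvd_prod_of_mem P.E (Finset.mem_univ i)

end SplitPencil

section PrimePowers

variable {R : Type*} [CommRing R] [IsDedekindDomain R]

lemma mem_pow_of_sq_mem {I : Ideal R} {a : R} {n : ℕ} (h : a ^ 2 ∈ I ^ (2 * n)) : a ∈ I ^ n := by
  rw [mul_comm, pow_mul, ← Ideal.dvd_span_singleton, ← Ideal.span_singleton_pow,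
    UniqueFactorizationMonoid.pow_dvd_pow_iff_dvd two_ne_zero] at h
  exact Ideal.dvd_span_singleton.1 h

lemma qf_mem_pow {R : Type*} [CommRing R] {I : Ideal R} {m : ℕ} (c : Fin 6 → R)
    {x : Fin 3 → R} (hx : ∀ i, x i ∈ I ^ m) :
    qf c x ∈ I ^ (2 * m) := by
  have key : ∀ i j, x i * x j ∈ I ^ (2 * m) := fun i j => by
    rw [two_mul, pow_add]; exact Ideal.mul_mem_mul (hx i) (hx j)
  have e : qf c x = c 0 * (x 0 * x 0) + c 1 * (x 1 * x 1) + c 2 * (x 2 * x 2) +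
    c 3 * (x 1 * x 2) + c 4 * (x 0 * x 2) + c 5 * (x 0 * x 1) := by
    simp only [qf]; ring
  rw [e]
  refine Ideal.add_mem _ (Ideal.add_mem _ (Ideal.add_mem _ (Ideal.add_mem _ (Ideal.add_mem _
    ?_ ?_) ?_) ?_) ?_) ?_ <;> exact Ideal.mul_mem_left _ _ (key _ _)

lemma polarForm_mem_pow {𝔭 : Ideal R} [𝔭.IsPrime] {m : ℕ} {c : Fin 6 → R} {x y : Fin 3 → R}
    (hx : qf c x = 0) (hy : qf c y = 0) {j : Fin 3} (hxj : x j ∉ 𝔭) (hyj : y j ∉ 𝔭)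
    (h : ∀ i, y j * x i - x j * y i ∈ 𝔭 ^ m) : polarForm c x y ∈ 𝔭 ^ (2 * m) := by
  have h1 := qf_mem_pow c h
  rw [qf_sub, hx, hy] at h1
  have h2 : (y j * x j) * polarForm c x y ∈ 𝔭 ^ (2 * m) := by
    have := neg_mem h1
    convert this using 1
    ring
  rcases Ideal.IsPrime.mul_mem_pow 𝔭 h2 with h3 | h3
  · rcases Ideal.IsPrime.mem_or_mem ‹_› h3 with h4 | h4
    exacts [absurd h4 hyj, absurd h4 hxj]
  · exact h3

/-- Three points of a conic congruent modulo `𝔭 ^ m` have determinant in `𝔭 ^ (3 m)`. -/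
lemma det3_mem_pow {𝔭 : Ideal R} [𝔭.IsPrime] {m : ℕ} {c : Fin 6 → R} (hc : qdisc c ∉ 𝔭)
    {x y z : Fin 3 → R} (hq : ∀ p ∈ ({x, y, z} : Set (Fin 3 → R)), qf c p = 0) {j : Fin 3}
    (hj : ∀ p ∈ ({x, y, z} : Set (Fin 3 → R)), p j ∉ 𝔭)
    (h : ∀ p ∈ ({x, y, z} : Set (Fin 3 → R)), ∀ q ∈ ({x, y, z} : Set (Fin 3 → R)),
      ∀ i, q j * p i - p j * q i ∈ 𝔭 ^ m) :
    det3 x y z ∈ 𝔭 ^ (3 * m) := by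
  have hx : x ∈ ({x, y, z} : Set (Fin 3 → R)) := by simp
  have hy : y ∈ ({x, y, z} : Set (Fin 3 → R)) := by simp
  have hz : z ∈ ({x, y, z} : Set (Fin 3 → R)) := by simp
  have h1 := polarForm_mem_pow (hq x hx) (hq y hy) (hj x hx) (hj y hy) (h x hx y hy)
  have h2 := polarForm_mem_pow (hq y hy) (hq z hz) (hj y hy) (hj z hz) (h y hy z hz)
  have h3 := polarForm_mem_pow (hq x hx) (hq z hz) (hj x hx) (hj z hz) (h x hx z hz)
  apply mem_pow_of_sq_mem
  have h4 : det3 x y z ^ 2 * qdisc c ∈ 𝔭 ^ (2 * (3 * m)) := by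
    rw [det3_sq_mul_qdisc_of_isotropic (hq x hx) (hq y hy) (hq z hz)]
    have e : 2 * (3 * m) = 2 * m + 2 * m + 2 * m := by ring
    rw [e, pow_add, pow_add]
    exact Ideal.mul_mem_left _ _ (Ideal.mul_mem_mul (Ideal.mul_mem_mul h1 h2) h3)
  rw [mul_comm (det3 x y z ^ 2)] at h4
  exact (Ideal.IsPrime.mul_mem_pow 𝔭 h4).resolve_left hc

end PrimePowers

section NormBound

variable {k K : Type*} [Field k] [NumberField k] [Field K] [NumberField K] [Algebra k K]

lemma finrank_mul_finrank_ringOfIntegers :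
    Module.finrank ℚ k * Module.finrank (𝓞 k) (𝓞 K) = Module.finrank ℚ K := by
  rw [← IsFractionRing.finrank_eq (𝓞 k) k (𝓞 K) K, Module.finrank_mul_finrank]

lemma absNorm_mul_pow_le {p : ℕ} (hp : p.Prime) {𝔭 : Ideal (𝓞 k)} (hp𝔭 : (p : 𝓞 k) ∈ 𝔭)
    {δ t : 𝓞 K} {r : 𝓞 k} {s : ℕ} (hpδ : ¬ p ∣ Ideal.absNorm (Ideal.span {δ})) (hr : r ∈ 𝔭 ^ s)
    (ht : t * algebraMap (𝓞 k) (𝓞 K) r ≠ 0) (hδ : δ ∣ t * algebraMap (𝓞 k) (𝓞 K) r) :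
    Ideal.absNorm (Ideal.span {δ}) * (Ideal.absNorm 𝔭 ^ s) ^ Module.finrank (𝓞 k) (𝓞 K) ≤
      Ideal.absNorm (Ideal.span {t * algebraMap (𝓞 k) (𝓞 K) r}) := by
  rw [← map_pow, ← Ideal.absNorm_algebraMap, ← map_mul, Ideal.map_pow]
  apply Nat.le_of_dvd
  · apply Nat.pos_of_ne_zero
    simpa [Ideal.absNorm_eq_zero_iff] using ht
  apply Ideal.absNorm_dvd_absNorm_of_le
  rw [← Ideal.dvd_iff_le]
  have hcop : IsCoprime (Ideal.span {δ}) (𝔭.map (algebraMap (𝓞 k) (𝓞 K))) := by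
    rw [Ideal.isCoprime_iff_exists]
    have h1 : (p : 𝓞 K) ∈ 𝔭.map (algebraMap (𝓞 k) (𝓞 K)) := by
      have := Ideal.mem_map_of_mem (algebraMap (𝓞 k) (𝓞 K)) hp𝔭
      rwa [map_natCast] at this
    have h2 : ((Ideal.absNorm (Ideal.span {δ}) : ℕ) : 𝓞 K) ∈ Ideal.span {δ} := Ideal.absNorm_mem _
    have h3 : IsCoprime (Ideal.absNorm (Ideal.span {δ}) : ℤ) (p : ℤ) :=
      (Nat.isCoprime_iff_coprime.2 ((Nat.Prime.coprime_iff_not_dvd hp).2 hpδ)).symm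
    obtain ⟨u, v, huv⟩ := h3
    refine ⟨u * (Ideal.absNorm (Ideal.span {δ}) : ℕ), Ideal.mul_mem_left _ _ h2, v * (p : 𝓞 K),
      Ideal.mul_mem_left _ _ h1, ?_⟩
    exact_mod_cast congrArg (Int.cast : ℤ → 𝓞 K) huv
  apply (hcop.pow_right).mul_dvd
  · rw [Ideal.dvd_span_singleton, Ideal.mem_span_singleton]; exact hδ
  · rw [Ideal.dvd_span_singleton, ← Ideal.map_pow]
    exact Ideal.mul_mem_left _ _ (Ideal.mem_map_of_mem _ hr)

end NormBound

lemma AbsoluteValue.linForm_le {R : Type*} [CommRing R] (v : AbsoluteValue R ℝ) {l x : Fin 3 → R}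
    {H X : ℝ} (hl : ∀ i, v (l i) ≤ H) (hx : ∀ i, v (x i) ≤ X) : v (linForm l x) ≤ 3 * H * X := by
  have h : ∀ i, v (l i * x i) ≤ H * X := fun i => by
    rw [map_mul]
    exact mul_le_mul (hl i) (hx i) (v.nonneg _) ((v.nonneg _).trans (hl i))
  rw [linForm]
  refine (v.add_le _ _).trans ?_
  have := v.add_le (l 0 * x 0) (l 1 * x 1)
  linarith [h 0, h 1, h 2]

namespace SplitPencil

variable {k K : Type*} [Field k] [NumberField k] [Field K] [NumberField K] [Algebra k K]
  (P : SplitPencil k K)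

/-- The data of the pencil have size at most `H` for the absolute value `v`. -/
structure BoundedBy (v : AbsoluteValue (𝓞 K) ℝ) (H : ℝ) : Prop where
  q₁ : ∀ i, v (algebraMap (𝓞 k) (𝓞 K) (P.q₁ i)) ≤ H
  q₂ : ∀ i, v (algebraMap (𝓞 k) (𝓞 K) (P.q₂ i)) ≤ H
  q₃ : ∀ i, v (algebraMap (𝓞 k) (𝓞 K) (P.q₃ i)) ≤ H
  γ : v P.γ ≤ H
  μ : ∀ i, v (P.μ i) ≤ H
  e : v P.e ≤ H
  l : ∀ i j, v (P.l i j) ≤ H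
  l' : ∀ i j, v (P.l' i j) ≤ H
  l_third : ∀ i j, v (P.v i j) ≤ H
  E : ∀ i, 1 ≤ H * v (P.E i)
  res : ∀ i j, i ≠ j → 1 ≤ H * v (P.γ * (P.μ j - P.μ i))

variable {P} {v : AbsoluteValue (𝓞 K) ℝ} {H : ℝ}

lemma BoundedBy.mul_sing_le (hP : P.BoundedBy v H) (hH : 1 ≤ H) {C₀ X Y : ℝ} (hC : 1 ≤ C₀)
    (hY : 1 ≤ Y) {a b : 𝓞 k} (ha : v (algebraMap (𝓞 k) (𝓞 K) a) ≤ C₀ * Y)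
    (hb : v (algebraMap (𝓞 k) (𝓞 K) b) ≤ C₀ * Y)
    (hab : Y ≤ C₀ * v (algebraMap (𝓞 k) (𝓞 K) a) ∨ Y ≤ C₀ * v (algebraMap (𝓞 k) (𝓞 K) b))
    {x : Fin 3 → 𝓞 k} (hc : qf (P.conic a b) x = 0)
    (hx : ∀ j, v (algebraMap (𝓞 k) (𝓞 K) (x j)) ≤ X) (i : Fin 6) :
    Y * v (P.sing i x) ≤ 24 * H ^ 2 * C₀ ^ 3 * X ^ 2 * v (P.D a b i) := by
  have hq₁ := v.qf_le hP.q₁ hx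
  have hq₂ := v.qf_le hP.q₂ hx
  have hq₃ := v.qf_le hP.q₃ hx
  rw [← map_qf] at hq₁ hq₂ hq₃
  have h2 : v 2 ≤ 2 := by
    have := v.add_le 1 1
    rw [one_add_one_eq_two, map_one] at this
    linarith
  set a' := algebraMap (𝓞 k) (𝓞 K) a
  set b' := algebraMap (𝓞 k) (𝓞 K) b
  set Q := 6 * H * X ^ 2 with hQ
  have hQ0 : 0 ≤ Q := by positivity
  have bd : ∀ s t : 𝓞 K, ∀ S T : ℝ, v s ≤ S → v t ≤ T → v (s * t) ≤ S * T := fun s t S T hs ht => by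
    rw [map_mul]; exact mul_le_mul hs ht (v.nonneg _) ((v.nonneg _).trans hs)
  have fin : ∀ u : 𝓞 K, ∀ t : 𝓞 K, Y ≤ C₀ * v u → u ^ 2 * P.sing i x = P.D a b i * t →
      v t ≤ 4 * Q * H * C₀ * Y →
      Y * v (P.sing i x) ≤ 24 * H ^ 2 * C₀ ^ 3 * X ^ 2 * v (P.D a b i) := by
    intro u t hu h ht
    have h3 : v u ^ 2 * v (P.sing i x) = v (P.D a b i) * v t := by
      rw [← map_pow, ← map_mul, h, map_mul]
    have h4 : Y ^ 2 ≤ C₀ ^ 2 * v u ^ 2 := by rw [← mul_pow]; gcongr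
    have h5 : Y * (Y * v (P.sing i x)) ≤ Y * (24 * H ^ 2 * C₀ ^ 3 * X ^ 2 * v (P.D a b i)) :=
      calc Y * (Y * v (P.sing i x)) = Y ^ 2 * v (P.sing i x) := by ring
        _ ≤ C₀ ^ 2 * v u ^ 2 * v (P.sing i x) := by gcongr
        _ = C₀ ^ 2 * (v (P.D a b i) * v t) := by rw [← h3]; ring
        _ ≤ C₀ ^ 2 * (v (P.D a b i) * (4 * Q * H * C₀ * Y)) := by gcongr
        _ = _ := by rw [hQ]; ring
    exact le_of_mul_le_mul_left h5 (by linarith)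
  rcases hab with h | h
  · refine fin a' _ h (P.sq_mul_sing_left hc i) ?_
    have h3 := bd _ _ _ _ (bd _ _ _ _ h2 hq₃) (bd _ _ _ _ ha (hP.μ i))
    have h4 := bd _ _ _ _ hq₂ ((v.add_le _ _).trans
      (add_le_add (bd _ _ _ _ ha hP.γ) (bd _ _ _ _ (hP.μ i) hb)))
    have h5 := v.sub_le_add (2 * algebraMap (𝓞 k) (𝓞 K) (qf P.q₃ x) * (a' * P.μ i))
      (algebraMap (𝓞 k) (𝓞 K) (qf P.q₂ x) * (a' * P.γ + P.μ i * b'))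
    refine h5.trans ((add_le_add h3 h4).trans (le_of_eq ?_))
    ring
  · refine fin b' _ h (P.sq_mul_sing_right hc i) ?_
    have h3 := bd _ _ _ _ (bd _ _ _ _ h2 hq₃) (bd _ _ _ _ hb hP.γ)
    have h4 := bd _ _ _ _ hq₁ ((v.add_le _ _).trans
      (add_le_add (bd _ _ _ _ hb (hP.μ i)) (bd _ _ _ _ hP.γ ha)))
    have h5 := v.sub_le_add (-(algebraMap (𝓞 k) (𝓞 K) (qf P.q₁ x) * (b' * P.μ i + P.γ * a')))
      (2 * algebraMap (𝓞 k) (𝓞 K) (qf P.q₃ x) * (b' * P.γ))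
    rw [v.map_neg] at h5
    refine h5.trans ((add_le_add h4 h3).trans (le_of_eq ?_))
    ring

lemma BoundedBy.mul_L_mul_L'_le (hP : P.BoundedBy v H) (hH : 1 ≤ H) {C₀ X Y : ℝ} (hC : 1 ≤ C₀)
    (hY : 1 ≤ Y) {a b : 𝓞 k} (ha : v (algebraMap (𝓞 k) (𝓞 K) a) ≤ C₀ * Y)
    (hb : v (algebraMap (𝓞 k) (𝓞 K) b) ≤ C₀ * Y)
    (hab : Y ≤ C₀ * v (algebraMap (𝓞 k) (𝓞 K) a) ∨ Y ≤ C₀ * v (algebraMap (𝓞 k) (𝓞 K) b))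
    {x : Fin 3 → 𝓞 k} (hc : qf (P.conic a b) x = 0)
    (hx : ∀ j, v (algebraMap (𝓞 k) (𝓞 K) (x j)) ≤ X) (i : Fin 6) :
    Y * (v (P.L i x) * v (P.L' i x)) ≤ 24 * H ^ 3 * C₀ ^ 3 * X ^ 2 * v (P.D a b i) := by
  rw [← map_mul, ← e_mul_sing, map_mul]
  have h1 := hP.mul_sing_le hH hC hY ha hb hab hc hx i
  have h0 : 0 ≤ Y * v (P.sing i x) := by have := v.nonneg (P.sing i x); positivity
  calc Y * (v P.e * v (P.sing i x)) = v P.e * (Y * v (P.sing i x)) := by ring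
    _ ≤ H * (24 * H ^ 2 * C₀ ^ 3 * X ^ 2 * v (P.D a b i)) := mul_le_mul hP.e h1 h0 (by linarith)
    _ = _ := by ring

lemma BoundedBy.mul_det3_le (hP : P.BoundedBy v H) (hH : 1 ≤ H) {C₀ X Y : ℝ} (hC : 1 ≤ C₀)
    (hY : 1 ≤ Y) {a b : 𝓞 k} (ha : v (algebraMap (𝓞 k) (𝓞 K) a) ≤ C₀ * Y)
    (hb : v (algebraMap (𝓞 k) (𝓞 K) b) ≤ C₀ * Y)
    (hab : Y ≤ C₀ * v (algebraMap (𝓞 k) (𝓞 K) a) ∨ Y ≤ C₀ * v (algebraMap (𝓞 k) (𝓞 K) b))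
    {x y z : Fin 3 → 𝓞 k} (hc : ∀ p ∈ ({x, y, z} : Set (Fin 3 → 𝓞 k)), qf (P.conic a b) p = 0)
    (hx : ∀ p ∈ ({x, y, z} : Set (Fin 3 → 𝓞 k)), ∀ j, v (algebraMap (𝓞 k) (𝓞 K) (p j)) ≤ X)
    (i : Fin 6) (hs : ∀ p ∈ ({x, y, z} : Set (Fin 3 → 𝓞 k)),
      ∀ q ∈ ({x, y, z} : Set (Fin 3 → 𝓞 k)), v (P.L i p) ≤ 2 * v (P.L i q)) :
    Y * v (algebraMap (𝓞 k) (𝓞 K) (det3 x y z)) ≤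
      864 * H ^ 5 * C₀ ^ 3 * X ^ 3 * v (P.D a b i) := by
  have hX : 0 ≤ X := (v.nonneg _).trans (hx x (by simp) 0)
  let V (p : Fin 3 → 𝓞 k) := linForm (P.v i) fun j => algebraMap (𝓞 k) (𝓞 K) (p j)
  set W := 144 * H ^ 4 * C₀ ^ 3 * X ^ 3 * v (P.D a b i) with hW
  have key : ∀ p ∈ ({x, y, z} : Set (Fin 3 → 𝓞 k)), ∀ q ∈ ({x, y, z} : Set (Fin 3 → 𝓞 k)),
      ∀ r ∈ ({x, y, z} : Set (Fin 3 → 𝓞 k)), Y * v (P.L i p * (P.L' i q * V r)) ≤ W := by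
    intro p hp q hq r hr
    have h1 := hP.mul_L_mul_L'_le hH hC hY ha hb hab (hc q hq) (hx q hq) i
    have h2 : v (V r) ≤ 3 * H * X := v.linForm_le (hP.l_third i) (hx r hr)
    have h3 := hs p hp q hq
    have h4 := v.nonneg (P.L i p)
    have h5 := v.nonneg (P.L' i q)
    have h6 := v.nonneg (P.L i q)
    have h7 := v.nonneg (V r)
    rw [map_mul, map_mul]
    calc Y * (v (P.L i p) * (v (P.L' i q) * v (V r)))
        ≤ Y * (2 * v (P.L i q) * (v (P.L' i q) * (3 * H * X))) := by gcongr
      _ = 6 * H * X * (Y * (v (P.L i q) * v (P.L' i q))) := by ring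
      _ ≤ 6 * H * X * (24 * H ^ 3 * C₀ ^ 3 * X ^ 2 * v (P.D a b i)) := by gcongr
      _ = W := by rw [hW]; ring
  have e : P.E i * algebraMap (𝓞 k) (𝓞 K) (det3 x y z) =
      P.L i x * (P.L' i y * V z) - P.L i x * (P.L' i z * V y) -
      (P.L i y * (P.L' i x * V z) - P.L i y * (P.L' i z * V x)) +
      (P.L i z * (P.L' i x * V y) - P.L i z * (P.L' i y * V x)) := by
    rw [map_det3, SplitPencil.E, det3_mul_det3]
    simp only [L, L', V]
    ring
  have hx' : x ∈ ({x, y, z} : Set (Fin 3 → 𝓞 k)) := by simp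
  have hy' : y ∈ ({x, y, z} : Set (Fin 3 → 𝓞 k)) := by simp
  have hz' : z ∈ ({x, y, z} : Set (Fin 3 → 𝓞 k)) := by simp
  have h6 : Y * v (P.E i * algebraMap (𝓞 k) (𝓞 K) (det3 x y z)) ≤ 6 * W := by
    have g1 := v.sub_le_add (P.L i x * (P.L' i y * V z)) (P.L i x * (P.L' i z * V y))
    have g2 := v.sub_le_add (P.L i y * (P.L' i x * V z)) (P.L i y * (P.L' i z * V x))
    have g3 := v.sub_le_add (P.L i z * (P.L' i x * V y)) (P.L i z * (P.L' i y * V x))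
    have g4 := v.sub_le_add (P.L i x * (P.L' i y * V z) - P.L i x * (P.L' i z * V y))
      (P.L i y * (P.L' i x * V z) - P.L i y * (P.L' i z * V x))
    have g5 := v.add_le (P.L i x * (P.L' i y * V z) - P.L i x * (P.L' i z * V y) -
      (P.L i y * (P.L' i x * V z) - P.L i y * (P.L' i z * V x)))
      (P.L i z * (P.L' i x * V y) - P.L i z * (P.L' i y * V x))
    rw [← e] at g5
    have := mul_le_mul_of_nonneg_left (g5.trans (add_le_add (g4.trans (add_le_add g1 g2)) g3))
      (by linarith : 0 ≤ Y)
    linarith [key x hx' y hy' z hz', key x hx' z hz' y hy', key y hy' x hx' z hz',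
      key y hy' z hz' x hx', key z hz' x hx' y hy', key z hz' y hy' x hx']
  have h0 : 0 ≤ Y * v (algebraMap (𝓞 k) (𝓞 K) (det3 x y z)) := by
    have := v.nonneg (algebraMap (𝓞 k) (𝓞 K) (det3 x y z)); positivity
  rw [map_mul] at h6
  calc Y * v (algebraMap (𝓞 k) (𝓞 K) (det3 x y z))
      ≤ (H * v (P.E i)) * (Y * v (algebraMap (𝓞 k) (𝓞 K) (det3 x y z))) :=
        le_mul_of_one_le_left h0 (hP.E i)
    _ = H * (Y * (v (P.E i) * v (algebraMap (𝓞 k) (𝓞 K) (det3 x y z)))) := by ring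
    _ ≤ H * (6 * W) := by gcongr
    _ = _ := by rw [hW]; ring

lemma BoundedBy.le_D (hP : P.BoundedBy v H) (hH : 1 ≤ H) {C₀ Y : ℝ} (hC : 1 ≤ C₀)
    {a b : 𝓞 k}
    (hab : Y ≤ C₀ * v (algebraMap (𝓞 k) (𝓞 K) a) ∨ Y ≤ C₀ * v (algebraMap (𝓞 k) (𝓞 K) b))
    {i j : Fin 6} (hij : i ≠ j) (h : v (P.D a b i) ≤ v (P.D a b j)) :
    Y ≤ 2 * H ^ 2 * C₀ * v (P.D a b j) := by
  have hDj := v.nonneg (P.D a b j)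
  suffices ∀ u : 𝓞 K, v (P.γ * (P.μ j - P.μ i) * u) ≤ 2 * H * v (P.D a b j) →
      v u ≤ 2 * H ^ 2 * v (P.D a b j) by
    have ha : v (algebraMap (𝓞 k) (𝓞 K) a) ≤ 2 * H ^ 2 * v (P.D a b j) := by
      refine this _ ?_
      have e : P.γ * (P.μ j - P.μ i) * algebraMap (𝓞 k) (𝓞 K) a =
          P.μ j * P.D a b i - P.μ i * P.D a b j := by simp only [D]; ring
      rw [e]
      refine (v.sub_le_add _ _).trans ?_
      rw [map_mul, map_mul]
      have h1 := mul_le_mul (hP.μ j) h (v.nonneg _) (by linarith)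
      have h2 := mul_le_mul_of_nonneg_right (hP.μ i) hDj
      linarith
    have hb : v (algebraMap (𝓞 k) (𝓞 K) b) ≤ 2 * H ^ 2 * v (P.D a b j) := by
      refine this _ ?_
      have e : P.γ * (P.μ j - P.μ i) * algebraMap (𝓞 k) (𝓞 K) b =
          P.γ * (P.D a b i - P.D a b j) := by simp only [D]; ring
      rw [e, map_mul]
      have h1 : v (P.D a b i - P.D a b j) ≤ 2 * v (P.D a b j) :=
        (v.sub_le_add _ _).trans (by linarith)
      have := mul_le_mul hP.γ h1 (v.nonneg _) (by linarith)
      linarith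
    rcases hab with h' | h' <;> refine h'.trans ?_
    · have := mul_le_mul_of_nonneg_left ha (by linarith : 0 ≤ C₀); linarith
    · have := mul_le_mul_of_nonneg_left hb (by linarith : 0 ≤ C₀); linarith
  intro u hu
  rw [map_mul] at hu
  calc v u ≤ H * v (P.γ * (P.μ j - P.μ i)) * v u := le_mul_of_one_le_left (v.nonneg _)
        (hP.res i j hij)
    _ = H * (v (P.γ * (P.μ j - P.μ i)) * v u) := by ring
    _ ≤ H * (2 * H * v (P.D a b j)) := by gcongr
    _ = _ := by ring

/-- Three points of the conic with parameter `(a : b)` in the same archimedean class have small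
determinant. -/
lemma BoundedBy.pow_mul_det3_le (hP : P.BoundedBy v H) (hH : 1 ≤ H) {C₀ X Y : ℝ} (hC : 1 ≤ C₀)
    (hY : 1 ≤ Y) {a b : 𝓞 k} (ha : v (algebraMap (𝓞 k) (𝓞 K) a) ≤ C₀ * Y)
    (hb : v (algebraMap (𝓞 k) (𝓞 K) b) ≤ C₀ * Y)
    (hab : Y ≤ C₀ * v (algebraMap (𝓞 k) (𝓞 K) a) ∨ Y ≤ C₀ * v (algebraMap (𝓞 k) (𝓞 K) b))
    {x y z : Fin 3 → 𝓞 k} (hc : ∀ p ∈ ({x, y, z} : Set (Fin 3 → 𝓞 k)), qf (P.conic a b) p = 0)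
    (hx : ∀ p ∈ ({x, y, z} : Set (Fin 3 → 𝓞 k)), ∀ j, v (algebraMap (𝓞 k) (𝓞 K) (p j)) ≤ X)
    (hs : ∀ i, ∀ p ∈ ({x, y, z} : Set (Fin 3 → 𝓞 k)),
      ∀ q ∈ ({x, y, z} : Set (Fin 3 → 𝓞 k)), v (P.L i p) ≤ 2 * v (P.L i q)) :
    Y ^ 6 * v (algebraMap (𝓞 k) (𝓞 K) (det3 x y z)) ≤
      (864 * H ^ 5 * C₀ ^ 3 * (2 * H ^ 2 * C₀) ^ 5) * X ^ 3 * v (∏ i, P.D a b i) := by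
  obtain ⟨i, -, hi⟩ := Finset.exists_min_image Finset.univ (fun i => v (P.D a b i)) ⟨0, by simp⟩
  have h1 := hP.mul_det3_le hH hC hY ha hb hab hc hx i (hs i)
  have h2 : Y ^ 5 ≤ (2 * H ^ 2 * C₀) ^ 5 * ∏ j ∈ Finset.univ.erase i, v (P.D a b j) := by
    have hcard : (Finset.univ.erase i : Finset (Fin 6)).card = 5 := by simp
    rw [← hcard, ← Finset.prod_const, ← Finset.prod_const, ← Finset.prod_mul_distrib]
    refine Finset.prod_le_prod (fun _ _ => by linarith) fun j hj => ?_
    exact hP.le_D hH hC hab (Finset.ne_of_mem_erase hj).symm (hi j (Finset.mem_univ _))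
  rw [map_prod, ← Finset.mul_prod_erase _ _ (Finset.mem_univ i)]
  have h0 := v.nonneg (algebraMap (𝓞 k) (𝓞 K) (det3 x y z))
  have h3 : 0 ≤ ∏ j ∈ Finset.univ.erase i, v (P.D a b j) := Finset.prod_nonneg fun _ _ => v.nonneg _
  calc Y ^ 6 * v (algebraMap (𝓞 k) (𝓞 K) (det3 x y z))
      = Y ^ 5 * (Y * v (algebraMap (𝓞 k) (𝓞 K) (det3 x y z))) := by ring
    _ ≤ ((2 * H ^ 2 * C₀) ^ 5 * ∏ j ∈ Finset.univ.erase i, v (P.D a b j)) *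
      (864 * H ^ 5 * C₀ ^ 3 * X ^ 3 * v (P.D a b i)) := mul_le_mul h2 h1 (by positivity)
        (by positivity)
    _ = _ := by ring

end SplitPencil

/-- The restriction of an infinite place to the ring of integers. -/
noncomputable def integerAbs {K : Type*} [Field K] [NumberField K] (w : InfinitePlace K) :
    AbsoluteValue (𝓞 K) ℝ :=
  w.1.comp (f := algebraMap (𝓞 K) K) RingOfIntegers.coe_injective

lemma integerAbs_apply {K : Type*} [Field K] [NumberField K] (w : InfinitePlace K) (x : 𝓞 K) :
    integerAbs w x = w (x : K) := rfl

lemma prod_integerAbs {K : Type*} [Field K] [NumberField K] (x : 𝓞 K) :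
    ∏ w : InfinitePlace K, integerAbs w x ^ w.mult = (Ideal.absNorm (Ideal.span {x}) : ℝ) :=
  prod_plNorm x

namespace SplitPencil

variable {k K : Type*} [Field k] [NumberField k] [Field K] [NumberField K] [Algebra k K]
  (P : SplitPencil k K)

lemma exists_boundedBy : ∃ H : ℝ, 1 ≤ H ∧ ∀ w : InfinitePlace K, P.BoundedBy (integerAbs w) H := by
  let s : Set K := (⋃ i, {((algebraMap (𝓞 k) (𝓞 K) (P.q₁ i) : 𝓞 K) : K)}) ∪
    (⋃ i, {((algebraMap (𝓞 k) (𝓞 K) (P.q₂ i) : 𝓞 K) : K)}) ∪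
    (⋃ i, {((algebraMap (𝓞 k) (𝓞 K) (P.q₃ i) : 𝓞 K) : K)}) ∪ {(P.γ : K)} ∪ (⋃ i, {(P.μ i : K)}) ∪
    {(P.e : K)} ∪ (⋃ i, ⋃ j, {(P.l i j : K)}) ∪ (⋃ i, ⋃ j, {(P.l' i j : K)}) ∪
    (⋃ i, ⋃ j, {(P.v i j : K)}) ∪ (⋃ i, {(P.E i : K)⁻¹}) ∪
    (⋃ i, ⋃ j, {((P.γ * (P.μ j - P.μ i) : 𝓞 K) : K)⁻¹})
  have hs : s.Finite := by
    refine .union (.union (.union (.union (.union (.union (.union (.union (.union (.union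
      ?_ ?_) ?_) ?_) ?_) ?_) ?_) ?_) ?_) ?_) ?_ <;> exact Set.toFinite _
  obtain ⟨H, hH, h⟩ := exists_place_bound s hs
  have hinv : ∀ (w : InfinitePlace K) (x : 𝓞 K), x ≠ 0 → (x : K)⁻¹ ∈ s →
      1 ≤ H * integerAbs w x := by
    intro w x hx hxs
    have h1 := h w _ hxs
    have hx' : (x : K) ≠ 0 := by simpa using hx
    have h2 : 0 < w (x : K) := w.pos_iff.2 hx'
    rw [map_inv₀] at h1
    rw [integerAbs_apply]
    calc (1 : ℝ) = (w (x : K))⁻¹ * w (x : K) := (inv_mul_cancel₀ h2.ne').symm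
      _ ≤ _ := by gcongr
  refine ⟨H, hH, fun w => ⟨fun i => h w _ ?_, fun i => h w _ ?_, fun i => h w _ ?_, h w _ ?_,
    fun i => h w _ ?_, h w _ ?_, fun i j => h w _ ?_, fun i j => h w _ ?_, fun i j => h w _ ?_,
    fun i => hinv w _ (P.E_ne_zero i) ?_, fun i j hij => hinv w _ ?_ ?_⟩⟩
  · simp [s]
  · simp [s]
  · simp [s]
  · simp [s]
  · simp [s]
  · simp [s]
  · exact .inl (.inl (.inl (.inl (.inr (Set.mem_iUnion₂.2 ⟨i, j, rfl⟩)))))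
  · exact .inl (.inl (.inl (.inr (Set.mem_iUnion₂.2 ⟨i, j, rfl⟩))))
  · exact .inl (.inl (.inr (Set.mem_iUnion₂.2 ⟨i, j, rfl⟩)))
  · exact .inl (.inr (Set.mem_iUnion.2 ⟨i, rfl⟩))
  · exact mul_ne_zero P.γ_ne_zero (sub_ne_zero.2 fun e => hij (P.μ_injective e).symm)
  · exact .inr (Set.mem_iUnion₂.2 ⟨i, j, rfl⟩)

/-- The parameter `(a : b)` is of size `Y` at all places, almost coprime, and not singular. -/
structure GoodParam (M : ℕ) (C₀ Y : ℝ) (a b : 𝓞 k) : Prop where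
  le_left : ∀ w : InfinitePlace k, w (a : k) ≤ C₀ * Y
  le_right : ∀ w : InfinitePlace k, w (b : k) ≤ C₀ * Y
  ge : ∀ w : InfinitePlace k, Y ≤ C₀ * w (a : k) ∨ Y ≤ C₀ * w (b : k)
  mem_span : (M : 𝓞 k) ∈ Ideal.span (Set.range ![a, b])
  D_ne_zero : ∀ i, P.D a b i ≠ 0

/-- Three distinct points in the same residue and archimedean classes cannot be too close
modulo `𝔭`. -/
lemma exists_three_point_bound {M : ℕ} (hM : M ≠ 0) {C₀ : ℝ} (hC : 1 ≤ C₀) :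
    ∃ A : ℝ, 1 ≤ A ∧ ∀ X Y : ℝ, 1 ≤ X → 1 ≤ Y → ∀ a b : 𝓞 k, P.GoodParam M C₀ Y a b →
      ∀ (p : ℕ) (𝔭 : Ideal (𝓞 k)), p.Prime → 𝔭.IsPrime → (p : 𝓞 k) ∈ 𝔭 →
      ¬ p ∣ Ideal.absNorm (Ideal.span {∏ i, P.D a b i}) → qdisc (P.conic a b) ∉ 𝔭 →
      ∀ (m : ℕ) (j : Fin 3) (x y z : Fin 3 → 𝓞 k),
      NonProp x y → NonProp y z → NonProp x z →
      (∀ p ∈ ({x, y, z} : Set (Fin 3 → 𝓞 k)), qf (P.conic a b) p = 0 ∧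
        (∀ (w : InfinitePlace k) j, w (p j : k) ≤ X) ∧ p j ∉ 𝔭) →
      (∀ p ∈ ({x, y, z} : Set (Fin 3 → 𝓞 k)), ∀ q ∈ ({x, y, z} : Set (Fin 3 → 𝓞 k)),
        (∀ i, ∃ r s, P.L i p = r * P.D a b i + s * P.L i q) ∧
        (∀ (w : InfinitePlace K) i, w (P.L i p : K) ≤ 2 * w (P.L i q : K)) ∧
        ∀ i, q j * p i - p j * q i ∈ 𝔭 ^ m) →
      (Ideal.absNorm 𝔭 : ℝ) ^ m * Y ^ (2 * Module.finrank ℚ k) ≤ (A * X) ^ Module.finrank ℚ k := by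
  obtain ⟨H, hH, hP⟩ := P.exists_boundedBy
  set t : 𝓞 K := P.κ M ^ 36 * (M : 𝓞 K) ^ 3 * ∏ i, P.E i with ht
  have ht0 : t ≠ 0 := mul_ne_zero (mul_ne_zero (pow_ne_zero _ (P.κ_ne_zero hM))
    (pow_ne_zero _ (by exact_mod_cast hM))) (Finset.prod_ne_zero_iff.2 fun i _ => P.E_ne_zero i)
  set C₄ : ℝ := 864 * H ^ 5 * C₀ ^ 3 * (2 * H ^ 2 * C₀) ^ 5 with hC₄
  have hC₄1 : 1 ≤ C₄ := by
    have h1 : 1 ≤ H ^ 5 := one_le_pow₀ hH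
    have h2 : 1 ≤ C₀ ^ 3 := one_le_pow₀ hC
    have h3 : 1 ≤ (2 * H ^ 2 * C₀) ^ 5 :=
      one_le_pow₀ (one_le_mul_of_one_le_of_one_le
        (one_le_mul_of_one_le_of_one_le one_le_two (one_le_pow₀ hH)) hC)
    exact one_le_mul_of_one_le_of_one_le (one_le_mul_of_one_le_of_one_le
      (one_le_mul_of_one_le_of_one_le (by norm_num) h1) h2) h3
  have hNt : (1 : ℝ) ≤ Ideal.absNorm (Ideal.span {t}) := one_le_absNorm (by simpa using ht0)
  refine ⟨Ideal.absNorm (Ideal.span {t}) * C₄, one_le_mul_of_one_le_of_one_le hNt hC₄1, ?_⟩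
  intro X Y hX hY a b hab p 𝔭 hp h𝔭 hp𝔭 hpD hq m j x y z hxy hyz hxz h1 h2
  set δ := ∏ i, P.D a b i with hδ
  have hδ0 : δ ≠ 0 := Finset.prod_ne_zero_iff.2 fun i _ => hab.D_ne_zero i
  have hdet0 : det3 x y z ≠ 0 := det3_ne_zero two_ne_zero (fun e => hq (e ▸ 𝔭.zero_mem)) hxy hyz hxz
    (h1 x (by simp)).1 (h1 y (by simp)).1 (h1 z (by simp)).1
  have hdet : det3 x y z ∈ 𝔭 ^ (3 * m) := det3_mem_pow hq (fun p hp => (h1 p hp).1)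
    (fun p hp => (h1 p hp).2.2) fun p hp q hq => (h2 p hp q hq).2.2
  have hdvd : δ ∣ t * algebraMap (𝓞 k) (𝓞 K) (det3 x y z) :=
    P.prod_D_dvd hab.mem_span (fun p hp => (h1 p hp).1) fun i p hp q hq => (h2 p hp q hq).1 i
  set r := algebraMap (𝓞 k) (𝓞 K) (det3 x y z) with hr
  have hr0 : r ≠ 0 := (map_ne_zero_iff _ (FaithfulSMul.algebraMap_injective (𝓞 k) (𝓞 K))).2 hdet0
  have h3 := absNorm_mul_pow_le hp hp𝔭 hpD hdet (mul_ne_zero ht0 hr0) hdvd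
  rw [← Ideal.span_singleton_mul_span_singleton, map_mul] at h3
  have h3' : (Ideal.absNorm (Ideal.span {δ}) : ℝ) * ((Ideal.absNorm 𝔭 : ℝ) ^ (3 * m)) ^
      Module.finrank (𝓞 k) (𝓞 K) ≤
        Ideal.absNorm (Ideal.span {t}) * Ideal.absNorm (Ideal.span {r}) := by
    exact_mod_cast h3
  have h4 : (Y ^ 6) ^ Module.finrank ℚ K * (Ideal.absNorm (Ideal.span {r}) : ℝ) ≤
      (C₄ * X ^ 3) ^ Module.finrank ℚ K * Ideal.absNorm (Ideal.span {δ}) := by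
    rw [← prod_integerAbs, ← prod_integerAbs, ← prod_const_pow_mult, ← prod_const_pow_mult,
      ← Finset.prod_mul_distrib, ← Finset.prod_mul_distrib]
    refine Finset.prod_le_prod (fun w _ => ?_) fun w _ => ?_
    · have := (integerAbs w).nonneg r; positivity
    rw [← mul_pow, ← mul_pow]
    refine pow_le_pow_left₀ ?_ ?_ _
    · have := (integerAbs w).nonneg r; positivity
    exact (hP w).pow_mul_det3_le hH hC hY (hab.le_left (w.comap (algebraMap k K)))
      (hab.le_right (w.comap (algebraMap k K))) (hab.ge (w.comap (algebraMap k K)))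
      (fun p hp => (h1 p hp).1) (fun p hp j => (h1 p hp).2.1 (w.comap (algebraMap k K)) j)
      fun i p hp q hq => (h2 p hp q hq).2.1 w i
  have hNδ : (1 : ℝ) ≤ Ideal.absNorm (Ideal.span {δ}) := one_le_absNorm (by simpa using hδ0)
  set Nδ : ℝ := ((Ideal.absNorm (Ideal.span {δ}) : ℕ) : ℝ)
  set Nr : ℝ := ((Ideal.absNorm (Ideal.span {r}) : ℕ) : ℝ)
  set Nt : ℝ := ((Ideal.absNorm (Ideal.span {t}) : ℕ) : ℝ)
  set Np : ℝ := ((Ideal.absNorm 𝔭 : ℕ) : ℝ)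
  have hdim := finrank_mul_finrank_ringOfIntegers (k := k) (K := K)
  have hd1 : 0 < Module.finrank ℚ k := Module.finrank_pos
  have hD1 : 0 < Module.finrank ℚ K := Module.finrank_pos
  set d := Module.finrank ℚ k
  set d' := Module.finrank (𝓞 k) (𝓞 K)
  have hd' : d' ≠ 0 := by rintro h; rw [h, mul_zero] at hdim; omega
  rw [← hdim] at h4 hD1
  have h5 : (Np ^ (3 * m)) ^ d' * (Y ^ 6) ^ (d * d') ≤ Nt * (C₄ * X ^ 3) ^ (d * d') := by
    have : Nδ * ((Np ^ (3 * m)) ^ d' * (Y ^ 6) ^ (d * d')) ≤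
        Nδ * (Nt * (C₄ * X ^ 3) ^ (d * d')) :=
      calc Nδ * ((Np ^ (3 * m)) ^ d' * (Y ^ 6) ^ (d * d'))
          = (Nδ * (Np ^ (3 * m)) ^ d') * (Y ^ 6) ^ (d * d') := by ring
        _ ≤ Nt * Nr * (Y ^ 6) ^ (d * d') := by gcongr
        _ = Nt * ((Y ^ 6) ^ (d * d') * Nr) := by ring
        _ ≤ Nt * ((C₄ * X ^ 3) ^ (d * d') * Nδ) := by gcongr
        _ = _ := by ring
    exact le_of_mul_le_mul_left this (by linarith)
  have hA : 1 ≤ Nt * C₄ := one_le_mul_of_one_le_of_one_le hNt hC₄1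
  have h6 : (Np ^ m * Y ^ (2 * d)) ^ (3 * d') ≤ ((Nt * C₄ * X) ^ d) ^ (3 * d') :=
    calc (Np ^ m * Y ^ (2 * d)) ^ (3 * d')
        = (Np ^ (3 * m)) ^ d' * (Y ^ 6) ^ (d * d') := by
          rw [mul_pow]; simp only [← pow_mul]; congr 2 <;> ring
      _ ≤ Nt * (C₄ * X ^ 3) ^ (d * d') := h5
      _ ≤ Nt ^ (d * d') * (C₄ * X ^ 3) ^ (d * d') := by
          gcongr; exact le_self_pow₀ hNt hD1.ne'
      _ = (Nt * C₄ * X ^ 3) ^ (d * d') := by rw [← mul_pow]; ring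
      _ ≤ ((Nt * C₄) ^ 3 * X ^ 3) ^ (d * d') := by
          gcongr; exact le_self_pow₀ hA (by norm_num)
      _ = _ := by rw [← mul_pow]; simp only [← pow_mul]; congr 1; ring
  exact (pow_le_pow_iff_left₀ (by positivity) (by positivity) (by positivity)).1 h6

end SplitPencil

lemma exists_log_bins_le (n r : ℕ) {Z ε : ℝ} (hZ : 1 ≤ Z) (hε : 0 < ε) :
    ∃ C : ℝ, 1 ≤ C ∧ ∀ X : ℝ, 1 ≤ X →
      ((2 * ⌈n * Real.logb 2 (Z * X)⌉₊ + 1 : ℕ) : ℝ) ^ r ≤ C * X ^ ε := by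
  set η := ε / (r + 1) with hη
  have hη0 : 0 < η := by positivity
  have hl2 : 0 < Real.log 2 := Real.log_pos one_lt_two
  set C := 2 * (n * (Z ^ η / η / Real.log 2)) + 3 with hC
  have hC1 : 1 ≤ C := by
    have : 0 ≤ n * (Z ^ η / η / Real.log 2) := by positivity
    linarith
  refine ⟨C ^ r, one_le_pow₀ hC1, fun X hX => ?_⟩
  have hX0 : 0 < X := by linarith
  have hXη : 1 ≤ X ^ η := Real.one_le_rpow hX hη0.le
  have hlog : 0 ≤ n * Real.logb 2 (Z * X) :=
    mul_nonneg (Nat.cast_nonneg _)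
      (Real.logb_nonneg one_lt_two (one_le_mul_of_one_le_of_one_le hZ hX))
  have h1 : n * Real.logb 2 (Z * X) ≤ n * (Z ^ η / η / Real.log 2) * X ^ η := by
    have := Real.log_le_rpow_div (x := Z * X) (by positivity) hη0
    rw [Real.mul_rpow (by positivity) hX0.le] at this
    rw [Real.logb, mul_assoc]
    gcongr
    calc Real.log (Z * X) / Real.log 2 ≤ Z ^ η * X ^ η / η / Real.log 2 := by gcongr
      _ = _ := by ring
  have h2 : ((2 * ⌈n * Real.logb 2 (Z * X)⌉₊ + 1 : ℕ) : ℝ) ≤ C * X ^ η := by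
    have := (Nat.ceil_lt_add_one hlog).le
    push_cast
    rw [hC]
    nlinarith
  calc ((2 * ⌈n * Real.logb 2 (Z * X)⌉₊ + 1 : ℕ) : ℝ) ^ r ≤ (C * X ^ η) ^ r := by gcongr
    _ = C ^ r * X ^ (η * r) := by rw [mul_pow, ← Real.rpow_mul_natCast hX0.le]
    _ ≤ C ^ r * X ^ ε := by
      gcongr ?_ * ?_
      refine Real.rpow_le_rpow_of_exponent_le hX ?_
      rw [hη, div_mul_eq_mul_div, div_le_iff₀ (by positivity)]
      nlinarith

section Places

variable {K : Type*} [Field K] [NumberField K]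

lemma absNorm_span_singleton_le {z : 𝓞 K} {Z : ℝ} (h : ∀ w : InfinitePlace K, w (z : K) ≤ Z) :
    (Ideal.absNorm (Ideal.span {z}) : ℝ) ≤ Z ^ Module.finrank ℚ K := by
  rw [← prod_plNorm, ← prod_const_pow_mult]
  exact Finset.prod_le_prod (fun w _ => plNorm_nonneg w _)
    fun w _ => pow_le_pow_left₀ (apply_nonneg w _) (h w) _

lemma one_le_pow_mul_apply {z : 𝓞 K} (hz : z ≠ 0) {Z : ℝ} (hZ : 1 ≤ Z)
    (h : ∀ w : InfinitePlace K, w (z : K) ≤ Z) (w : InfinitePlace K) :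
    1 ≤ Z ^ Module.finrank ℚ K * w (z : K) := by
  rcases le_total 1 (w (z : K)) with h1 | h1
  · exact one_le_mul_of_one_le_of_one_le (one_le_pow₀ hZ) h1
  have h2 : (1 : ℝ) ≤ ∏ w : InfinitePlace K, plNorm w (z : K) := by
    rw [prod_plNorm]; exact one_le_absNorm (by simpa using hz)
  classical
  rw [← Finset.mul_prod_erase _ _ (Finset.mem_univ w)] at h2
  have h3 : ∏ w' ∈ Finset.univ.erase w, plNorm w' (z : K) ≤ Z ^ Module.finrank ℚ K := by
    rw [← prod_const_pow_mult, ← Finset.mul_prod_erase _ _ (Finset.mem_univ w)]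
    refine le_trans ?_ (le_mul_of_one_le_left ?_ (one_le_pow₀ hZ))
    · exact Finset.prod_le_prod (fun w _ => plNorm_nonneg w _)
        fun w _ => pow_le_pow_left₀ (apply_nonneg w _) (h w) _
    · positivity
  have h4 : plNorm w (z : K) ≤ w (z : K) :=
    pow_le_of_le_one (apply_nonneg w _) h1 w.mult_ne_zero
  calc (1 : ℝ) ≤ _ := h2
    _ ≤ w (z : K) * Z ^ Module.finrank ℚ K :=
      mul_le_mul h4 h3 (Finset.prod_nonneg fun w _ => plNorm_nonneg w _) (apply_nonneg w _)
    _ = _ := mul_comm _ _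

lemma floor_logb_mem_Icc {z : 𝓞 K} (hz : z ≠ 0) {Z : ℝ} (hZ : 1 ≤ Z)
    (h : ∀ w : InfinitePlace K, w (z : K) ≤ Z) (w : InfinitePlace K) :
    ⌊Real.logb 2 (w (z : K))⌋ ∈ Finset.Icc
      (-(⌈Module.finrank ℚ K * Real.logb 2 Z⌉₊ : ℤ)) ⌈Module.finrank ℚ K * Real.logb 2 Z⌉₊ := by
  have hw : 0 < w (z : K) := w.pos_iff.2 (by simpa using hz)
  have hlogZ := Real.logb_nonneg one_lt_two hZ
  have hd : (1 : ℝ) ≤ Module.finrank ℚ K := by exact_mod_cast Module.finrank_pos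
  have hceil := Nat.le_ceil (Module.finrank ℚ K * Real.logb 2 Z)
  rw [Finset.mem_Icc, Int.le_floor]
  constructor
  · have h1 := Real.logb_nonneg one_lt_two (one_le_pow_mul_apply hz hZ h w)
    rw [Real.logb_mul (by positivity) hw.ne', Real.logb_pow] at h1
    push_cast
    linarith
  · have h1 := Real.logb_le_logb_of_le one_lt_two hw (h w)
    have h2 := Int.floor_le (Real.logb 2 (w (z : K)))
    have : (⌊Real.logb 2 (w (z : K))⌋ : ℝ) ≤ (⌈Module.finrank ℚ K * Real.logb 2 Z⌉₊ : ℝ) := by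
      nlinarith
    exact_mod_cast this

lemma le_two_mul_of_floor_logb_eq {s t : ℝ} (hs : 0 < s) (ht : 0 < t)
    (h : ⌊Real.logb 2 s⌋ = ⌊Real.logb 2 t⌋) : s ≤ 2 * t := by
  have h1 := (abs_lt.1 (Int.abs_sub_lt_one_of_floor_eq_floor h)).2
  rw [← Real.logb_div hs.ne' ht.ne', Real.logb_lt_iff_lt_rpow one_lt_two (by positivity),
    Real.rpow_one, div_lt_iff₀ ht] at h1
  exact h1.le

end Places

section Residues

variable {R : Type*} [CommRing R]

/-- The vector `x` has the normalized residue class `c` modulo `I ^ m`. -/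
def HasResidue (I : Ideal R) (m : ℕ) (x : Fin 3 → R)
    (c : Fin 3 × (R ⧸ I ^ m) × (R ⧸ I ^ m)) : Prop :=
  x c.1 ∉ I ∧ ∃ u : R, Ideal.Quotient.mk (I ^ m) (u * x c.1) = 1 ∧
    Ideal.Quotient.mk (I ^ m) (u * x (c.1 + 1)) = c.2.1 ∧
    Ideal.Quotient.mk (I ^ m) (u * x (c.1 + 2)) = c.2.2

lemma exists_hasResidue {I : Ideal R} [hI : I.IsMaximal] (m : ℕ) {x : Fin 3 → R} {j : Fin 3}
    (hj : x j ∉ I) : ∃ c, HasResidue I m x c := by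
  have h : IsCoprime (Ideal.span {x j}) (I ^ m) := by
    apply IsCoprime.pow_right
    obtain ⟨y, i, hi, hy⟩ := hI.exists_inv hj
    exact Ideal.isCoprime_iff_exists.2 ⟨_, Ideal.mul_mem_left _ y (Ideal.mem_span_singleton_self _),
      i, hi, hy⟩
  obtain ⟨s, hs, t, ht, hst⟩ := Ideal.isCoprime_iff_exists.1 h
  obtain ⟨u, rfl⟩ := Ideal.mem_span_singleton'.1 hs
  refine ⟨(j, Ideal.Quotient.mk _ (u * x (j + 1)), Ideal.Quotient.mk _ (u * x (j + 2))), hj, u, ?_,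
    rfl, rfl⟩
  rw [← map_one (Ideal.Quotient.mk (I ^ m)), Ideal.Quotient.eq, ← hst]
  simpa using ht

lemma HasResidue.sub_mem {I : Ideal R} {m : ℕ} {x y : Fin 3 → R}
    {c : Fin 3 × (R ⧸ I ^ m) × (R ⧸ I ^ m)} (hx : HasResidue I m x c) (hy : HasResidue I m y c)
    (i : Fin 3) : y c.1 * x i - x c.1 * y i ∈ I ^ m := by
  obtain ⟨-, u, h0, h1, h2⟩ := hx
  obtain ⟨-, v, g0, g1, g2⟩ := hy
  have key : Ideal.Quotient.mk (I ^ m) (u * x i) = Ideal.Quotient.mk (I ^ m) (v * y i) := by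
    have : ∀ j i : Fin 3, i = j ∨ i = j + 1 ∨ i = j + 2 := by decide
    rcases this c.1 i with h | h | h <;> rw [h]
    · rw [h0, g0]
    · rw [h1, g1]
    · rw [h2, g2]
  rw [← Ideal.Quotient.eq]
  simp only [map_mul] at *
  generalize Ideal.Quotient.mk (I ^ m) (x i) = xi at *
  generalize Ideal.Quotient.mk (I ^ m) (y i) = yi at *
  generalize Ideal.Quotient.mk (I ^ m) (x c.1) = xj at *
  generalize Ideal.Quotient.mk (I ^ m) (y c.1) = yj at *
  linear_combination -(yj * xi) * h0 + xj * yi * g0 + xj * yj * key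

lemma natCast_notMem_of_not_dvd {I : Ideal R} (hI : I ≠ ⊤) {p n : ℕ} (hp : p.Prime)
    (hpI : (p : R) ∈ I) (h : ¬ p ∣ n) : (n : R) ∉ I := by
  intro hn
  obtain ⟨u, v, huv⟩ := Nat.isCoprime_iff_coprime.2 ((Nat.Prime.coprime_iff_not_dvd hp).2 h)
  apply hI
  rw [Ideal.eq_top_iff_one]
  have : ((u * p + v * n : ℤ) : R) = 1 := by rw [huv]; simp
  rw [← this]
  push_cast
  exact add_mem (Ideal.mul_mem_left _ _ hpI) (Ideal.mul_mem_left _ _ hn)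

end Residues

namespace SplitPencil

variable {k K : Type*} [Field k] [NumberField k] [Field K] [NumberField K] [Algebra k K]
  {P : SplitPencil k K}

lemma BoundedBy.D_le {v : AbsoluteValue (𝓞 K) ℝ} {H : ℝ} (hP : P.BoundedBy v H) {Z : ℝ}
    {a b : 𝓞 k} (ha : v (algebraMap (𝓞 k) (𝓞 K) a) ≤ Z) (hb : v (algebraMap (𝓞 k) (𝓞 K) b) ≤ Z)
    (i : Fin 6) : v (P.D a b i) ≤ 2 * H * Z := by
  refine (v.sub_le_add _ _).trans ?_
  rw [map_mul, map_mul]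
  have hH : 0 ≤ H := (v.nonneg _).trans hP.γ
  have h1 := mul_le_mul hP.γ ha (v.nonneg _) hH
  have h2 := mul_le_mul (hP.μ i) hb (v.nonneg _) hH
  linarith

lemma BoundedBy.L_le {v : AbsoluteValue (𝓞 K) ℝ} {H : ℝ} (hP : P.BoundedBy v H) {X : ℝ}
    {x : Fin 3 → 𝓞 k} (hx : ∀ j, v (algebraMap (𝓞 k) (𝓞 K) (x j)) ≤ X) (i : Fin 6) :
    v (P.L i x) ≤ 3 * H * X :=
  v.linForm_le (hP.l i) hx

lemma BoundedBy.qdisc_conic_le {v : AbsoluteValue (𝓞 K) ℝ} {H : ℝ} (hP : P.BoundedBy v H) {Z : ℝ}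
    {a b : 𝓞 k} (ha : v (algebraMap (𝓞 k) (𝓞 K) a) ≤ Z) (hb : v (algebraMap (𝓞 k) (𝓞 K) b) ≤ Z) :
    v (algebraMap (𝓞 k) (𝓞 K) (qdisc (P.conic a b))) ≤ 16 * (4 * H * Z ^ 2) ^ 3 := by
  have hZ : 0 ≤ Z := (v.nonneg _).trans ha
  have hH : 0 ≤ H := (v.nonneg _).trans hP.γ
  have hnat : ∀ n : ℕ, v (n : 𝓞 K) ≤ n := fun n => by
    induction n with
    | zero => simp
    | succ n ih => push_cast; exact (v.add_le _ _).trans (by rw [map_one]; linarith)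
  have bd : ∀ s t : 𝓞 K, ∀ S T : ℝ, v s ≤ S → v t ≤ T → v (s * t) ≤ S * T := fun s t S T hs ht => by
    rw [map_mul]; exact mul_le_mul hs ht (v.nonneg _) ((v.nonneg _).trans hs)
  set a' := algebraMap (𝓞 k) (𝓞 K) a
  set b' := algebraMap (𝓞 k) (𝓞 K) b
  have hc : ∀ i, v (algebraMap (𝓞 k) (𝓞 K) (P.conic a b i)) ≤ 4 * H * Z ^ 2 := by
    intro i
    have e : algebraMap (𝓞 k) (𝓞 K) (P.conic a b i) = a' * a' * algebraMap (𝓞 k) (𝓞 K) (P.q₁ i) +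
        (2 : ℕ) * (a' * b' * algebraMap (𝓞 k) (𝓞 K) (P.q₃ i)) -
        b' * b' * algebraMap (𝓞 k) (𝓞 K) (P.q₂ i) := by
      simp only [conic, pencil, map_sub, map_add, map_mul, map_pow, map_ofNat, a', b']
      push_cast; ring
    rw [e]
    refine (v.sub_le_add _ _).trans ((add_le_add_left (v.add_le _ _) _).trans ?_)
    have h1 := bd _ _ _ _ (bd _ _ _ _ ha ha) (hP.q₁ i)
    have h2 := bd _ _ _ _ (hnat 2) (bd _ _ _ _ (bd _ _ _ _ ha hb) (hP.q₃ i))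
    have h3 := bd _ _ _ _ (bd _ _ _ _ hb hb) (hP.q₂ i)
    push_cast at h2 ⊢
    linarith
  set c := fun i => algebraMap (𝓞 k) (𝓞 K) (P.conic a b i) with hcdef
  set T := 4 * H * Z ^ 2
  have e : algebraMap (𝓞 k) (𝓞 K) (qdisc (P.conic a b)) = (8 : ℕ) * (c 0 * c 1 * c 2) +
      (2 : ℕ) * (c 3 * c 4 * c 5) -
      (2 : ℕ) * (c 0 * (c 3 * c 3) + c 1 * (c 4 * c 4) + c 2 * (c 5 * c 5)) := by
    simp only [qdisc, map_sub, map_add, map_mul, map_pow, map_ofNat, c]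
    push_cast; ring
  rw [e]
  have h3 : ∀ i j l, v (c i * (c j * c l)) ≤ T ^ 3 := fun i j l =>
    (bd _ _ _ _ (hc i) (bd _ _ _ _ (hc j) (hc l))).trans (by ring_nf; rfl)
  have h4 := bd _ _ _ _ (hnat 8) (h3 0 1 2)
  have h5 := bd _ _ _ _ (hnat 2) (h3 3 4 5)
  have h6 := bd _ _ _ _ (hnat 2) ((v.add_le _ _).trans (add_le_add ((v.add_le _ _).trans
    (add_le_add (h3 0 3 3) (h3 1 4 4))) (h3 2 5 5)))
  refine (v.sub_le_add _ _).trans ((add_le_add_left (v.add_le _ _) _).trans ?_)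
  rw [mul_assoc (c 0), mul_assoc (c 3)]
  push_cast at h4 h5 h6 ⊢
  linarith

variable (P)

lemma exists_good_prime (M₀ : ℕ) {M : ℕ} {C₀ ε : ℝ} (hC : 1 ≤ C₀) (hε : 0 < ε) :
    ∃ C : ℝ, 1 ≤ C ∧ ∀ X Y : ℝ, 1 ≤ X → 1 ≤ Y → Y ≤ C₀ * X → ∀ a b : 𝓞 k,
      P.GoodParam M C₀ Y a b → qdisc (P.conic a b) ≠ 0 → ∃ (p : ℕ) (𝔭 : Ideal (𝓞 k)),
      p.Prime ∧ M₀ < p ∧ 𝔭.IsPrime ∧ 𝔭 ≠ ⊥ ∧ (p : 𝓞 k) ∈ 𝔭 ∧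
      ¬ p ∣ Ideal.absNorm (Ideal.span {∏ i, P.D a b i}) ∧ qdisc (P.conic a b) ∉ 𝔭 ∧
      2 ≤ Ideal.absNorm 𝔭 ∧ (Ideal.absNorm 𝔭 : ℝ) ≤ C * X ^ ε := by
  obtain ⟨H, hH, hP⟩ := P.exists_boundedBy
  set d := Module.finrank ℚ k with hd
  set D := Module.finrank ℚ K with hD
  have hd0 : 0 < d := Module.finrank_pos
  set Z := C₀ * C₀ with hZ
  have hZ1 : 0 ≤ Z := by positivity
  set A : ℝ := ((2 * H * Z) ^ D) ^ 6 * (16 * (4 * H * Z ^ 2) ^ 3) ^ D with hA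
  set κ : ℝ := ((D * 6 + 6 * D : ℕ) : ℝ) with hκ
  obtain ⟨C, hC1, hCp⟩ := exists_prime_not_dvd A κ (ε / d) (by positivity) (by positivity) M₀
  refine ⟨C ^ d, one_le_pow₀ hC1, ?_⟩
  intro X Y hX hY hYX a b hab hq
  have hX0 : 0 ≤ X := by linarith
  have hYZ : C₀ * Y ≤ Z * X := by
    rw [hZ, mul_assoc]; gcongr
  have ha : ∀ w : InfinitePlace K, integerAbs w (algebraMap (𝓞 k) (𝓞 K) a) ≤ Z * X := fun w =>
    (hab.le_left (w.comap (algebraMap k K))).trans hYZ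
  have hb : ∀ w : InfinitePlace K, integerAbs w (algebraMap (𝓞 k) (𝓞 K) b) ≤ Z * X := fun w =>
    (hab.le_right (w.comap (algebraMap k K))).trans hYZ
  set q' := algebraMap (𝓞 k) (𝓞 K) (qdisc (P.conic a b)) with hq'
  have hq'0 : q' ≠ 0 := (map_ne_zero_iff _ (FaithfulSMul.algebraMap_injective (𝓞 k) (𝓞 K))).2 hq
  set δ := ∏ i, P.D a b i with hδ
  have hδ0 : δ ≠ 0 := Finset.prod_ne_zero_iff.2 fun i _ => hab.D_ne_zero i
  set N := Ideal.absNorm (Ideal.span {δ}) * Ideal.absNorm (Ideal.span {q'}) with hN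
  have hN0 : N ≠ 0 := by
    rw [hN]
    exact mul_ne_zero (by simpa [Ideal.absNorm_eq_zero_iff] using hδ0)
      (by simpa [Ideal.absNorm_eq_zero_iff] using hq'0)
  have hNδ : (Ideal.absNorm (Ideal.span {δ}) : ℝ) ≤ ((2 * H * (Z * X)) ^ D) ^ 6 := by
    have h1 : ∀ w : InfinitePlace K, w (δ : K) ≤ (2 * H * (Z * X)) ^ 6 := by
      intro w
      rw [← integerAbs_apply, hδ, map_prod]
      refine (Finset.prod_le_prod (fun i _ => (integerAbs w).nonneg _)
        fun i _ => (hP w).D_le (ha w) (hb w) i).trans (le_of_eq ?_)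
      simp
    refine (absNorm_span_singleton_le h1).trans (le_of_eq ?_)
    rw [← pow_mul, ← pow_mul, mul_comm 6]
  have hNq : (Ideal.absNorm (Ideal.span {q'}) : ℝ) ≤ (16 * (4 * H * (Z * X) ^ 2) ^ 3) ^ D :=
    absNorm_span_singleton_le fun w => (hP w).qdisc_conic_le (ha w) (hb w)
  have hNle : (N : ℝ) ≤ A * X ^ κ := by
    rw [hN, hκ, Real.rpow_natCast]
    push_cast
    refine (mul_le_mul hNδ hNq (Nat.cast_nonneg _) (by positivity)).trans (le_of_eq ?_)
    have e : 16 * (4 * H * (Z * X) ^ 2) ^ 3 = (16 * (4 * H * Z ^ 2) ^ 3) * X ^ 6 := by ring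
    rw [hA, e, ← mul_assoc (2 * H), mul_pow _ X, mul_pow _ (X ^ 6), mul_pow _ (X ^ D), pow_add,
      pow_mul, pow_mul]
    ring
  obtain ⟨p, hp, hpN, hMp, hpX⟩ := hCp X hX N hN0 hNle
  obtain ⟨𝔭, h𝔭, h𝔭0, hp𝔭, hle, hle'⟩ := exists_prime_ideal_over k hp
  refine ⟨p, 𝔭, hp, hMp, h𝔭, h𝔭0, hp𝔭, fun h => hpN (h.mul_right _), ?_, hp.two_le.trans hle, ?_⟩
  · intro h
    have h1 : ¬ p ∣ Ideal.absNorm (Ideal.span {q'}) := fun h => hpN (h.mul_left _)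
    have h2 : ¬ p ∣ Ideal.absNorm (Ideal.span {qdisc (P.conic a b)}) := by
      intro h3
      apply h1
      have e : Ideal.span {q'} =
          (Ideal.span {qdisc (P.conic a b)}).map (algebraMap (𝓞 k) (𝓞 K)) := by
        rw [Ideal.map_span, Set.image_singleton]
      rw [e, Ideal.absNorm_algebraMap]
      refine h3.trans (dvd_pow_self _ ?_)
      have := finrank_mul_finrank_ringOfIntegers (k := k) (K := K)
      intro h0
      rw [h0, mul_zero] at this
      exact (Module.finrank_pos (R := ℚ) (M := K)).ne this
    refine natCast_notMem_of_not_dvd h𝔭.ne_top hp hp𝔭 h2 ?_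
    exact (Ideal.span_singleton_le_iff_mem 𝔭).2 h (Ideal.absNorm_mem _)
  · have hX' : 0 ≤ X ^ (ε / d) := by positivity
    calc (Ideal.absNorm 𝔭 : ℝ) ≤ (p : ℝ) ^ d := by exact_mod_cast hle'
      _ ≤ (C * X ^ (ε / d)) ^ d := by gcongr
      _ = C ^ d * X ^ ε := by
        rw [mul_pow, ← Real.rpow_mul_natCast hX0, div_mul_cancel₀ _ (by positivity)]

end SplitPencil

lemma exists_pow_gt_of_two_le {q : ℝ} (hq : 2 ≤ q) (T : ℝ) :
    ∃ m : ℕ, T < q ^ m ∧ q ^ m ≤ q * max 1 T := by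
  classical
  have h : ∃ m : ℕ, T < q ^ m := pow_unbounded_of_one_lt T (by linarith)
  refine ⟨Nat.find h, Nat.find_spec h, ?_⟩
  rcases hm : Nat.find h with _ | n
  · rw [pow_zero]
    exact one_le_mul_of_one_le_of_one_le (by linarith) (le_max_left _ _)
  · have h1 : ¬ T < q ^ n := Nat.find_min h (by omega)
    rw [pow_succ, mul_comm]
    have := (not_lt.1 h1).trans (le_max_right 1 T)
    gcongr

namespace SplitPencil

variable {k K : Type*} [Field k] [NumberField k] [Field K] [NumberField K] [Algebra k K]
  (P : SplitPencil k K)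

lemma exists_prod_ncard_dvd_le {M : ℕ} {C₀ ε : ℝ} (hC : 1 ≤ C₀) (hε : 0 < ε) :
    ∃ C : ℝ, 1 ≤ C ∧ ∀ X Y : ℝ, 1 ≤ X → 1 ≤ Y → Y ≤ C₀ * X → ∀ a b : 𝓞 k,
      P.GoodParam M C₀ Y a b →
      ∏ i, ({J : Ideal (𝓞 K) | J ∣ Ideal.span {P.D a b i}}.ncard : ℝ) ≤ C * X ^ ε := by
  obtain ⟨H, hH, hP⟩ := P.exists_boundedBy
  set D := Module.finrank ℚ K with hD
  have hD0 : 0 < D := Module.finrank_pos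
  obtain ⟨C₁, hC₁, h₁⟩ := exists_ncard_ideal_dvd_le K (ε := ε / (D * 6)) (by positivity)
  set Z := 2 * H * (C₀ * C₀) with hZ
  have hZ1 : 1 ≤ Z := one_le_mul_of_one_le_of_one_le
    (one_le_mul_of_one_le_of_one_le one_le_two hH) (one_le_mul_of_one_le_of_one_le hC hC)
  refine ⟨(C₁ * (Z ^ D) ^ (ε / (D * 6))) ^ 6, one_le_pow₀ (one_le_mul_of_one_le_of_one_le hC₁
    (Real.one_le_rpow (one_le_pow₀ hZ1) (by positivity))), ?_⟩
  intro X Y hX hY hYX a b hab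
  have hX0 : 0 ≤ X := by linarith
  have key : ∀ i, ({J : Ideal (𝓞 K) | J ∣ Ideal.span {P.D a b i}}.ncard : ℝ) ≤
      C₁ * (Z ^ D) ^ (ε / (D * 6)) * X ^ (ε / 6) := by
    intro i
    refine (h₁ _ (by simpa using hab.D_ne_zero i)).trans ?_
    have h2 : (Ideal.absNorm (Ideal.span {P.D a b i}) : ℝ) ≤ Z ^ D * X ^ D := by
      rw [← mul_pow]
      refine absNorm_span_singleton_le fun w => ?_
      refine ((hP w).D_le (hab.le_left (w.comap (algebraMap k K)))
        (hab.le_right (w.comap (algebraMap k K))) i).trans ?_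
      rw [hZ, mul_assoc (2 * H), mul_assoc C₀]
      gcongr
    calc C₁ * (Ideal.absNorm (Ideal.span {P.D a b i}) : ℝ) ^ (ε / (D * 6))
        ≤ C₁ * (Z ^ D * X ^ D) ^ (ε / (D * 6)) := by gcongr
      _ = C₁ * ((Z ^ D) ^ (ε / (D * 6)) * X ^ (ε / 6)) := by
        rw [Real.mul_rpow (by positivity) (by positivity), ← Real.rpow_natCast_mul hX0]
        congr 3
        field_simp
      _ = _ := by ring
  refine (Finset.prod_le_prod (fun i _ => Nat.cast_nonneg _) fun i _ => key i).trans (le_of_eq ?_)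
  rw [Finset.prod_const, Finset.card_univ, Fintype.card_fin, mul_pow _ (X ^ (ε / 6)),
    ← Real.rpow_mul_natCast hX0]
  congr 2
  push_cast
  ring

variable {P} in
lemma GoodParam.qdisc_conic_ne_zero {M : ℕ} {C₀ Y : ℝ} {a b : 𝓞 k}
    (hab : P.GoodParam M C₀ Y a b) : qdisc (P.conic a b) ≠ 0 := by
  intro h
  have h0 : ![a, b] ≠ 0 := by
    intro e
    have ha : a = 0 := congrFun e 0
    have hb : b = 0 := congrFun e 1
    apply hab.D_ne_zero 0
    rw [D, ha, hb, map_zero, mul_zero, mul_zero, sub_zero]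
  obtain ⟨i, hi⟩ := P.qdisc_eq_zero a b h0 h
  exact hab.D_ne_zero i (by rw [D, hi, sub_self])

/-- A bound for the number of points on a single conic of the pencil. -/
lemma exists_conic_count_le (M₀ : ℕ) {M : ℕ} (hM₀ : M₀ ≠ 0) (hM : M ≠ 0) {C₀ ε : ℝ} (hC : 1 ≤ C₀)
    (hε : 0 < ε) :
    ∃ C : ℝ, 1 ≤ C ∧ ∀ X Y : ℝ, 1 ≤ X → 1 ≤ Y → Y ≤ C₀ * X → ∀ a b : 𝓞 k,
      P.GoodParam M C₀ Y a b → ∀ S : Finset (Fin 3 → 𝓞 k),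
      (∀ x ∈ S, qf (P.conic a b) x = 0 ∧ (∀ (w : InfinitePlace k) j, w (x j : k) ≤ X) ∧
        (M₀ : 𝓞 k) ∈ Ideal.span (Set.range x) ∧ ∀ i, P.L i x ≠ 0) →
      (∀ x ∈ S, ∀ y ∈ S, x ≠ y → NonProp x y) →
      (S.card : ℝ) ≤ C * X ^ ε * (max 1 ((X / Y ^ 2) ^ Module.finrank ℚ k)) ^ 2 := by
  classical
  obtain ⟨H, hH, hP⟩ := P.exists_boundedBy
  set d := Module.finrank ℚ k with hd
  obtain ⟨C₁, hC₁, h₁⟩ := P.exists_prod_ncard_dvd_le (M := M) hC (ε := ε / 3) (by positivity)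
  obtain ⟨C₂, hC₂, h₂⟩ := exists_log_bins_le (Module.finrank ℚ K)
    (Fintype.card (InfinitePlace K × Fin 6)) (Z := 3 * H) (ε := ε / 3) (by linarith)
    (by positivity)
  obtain ⟨C₃, hC₃, h₃⟩ := P.exists_good_prime M₀ (M := M) hC (ε := ε / 6) (by positivity)
  obtain ⟨A, hA, h₄⟩ := P.exists_three_point_bound hM hC
  refine ⟨2 * (C₁ * C₂ * (3 * (C₃ * A ^ d) ^ 2)), ?_, ?_⟩
  · have : 1 ≤ (C₃ * A ^ d) ^ 2 :=
      one_le_pow₀ (one_le_mul_of_one_le_of_one_le hC₃ (one_le_pow₀ hA))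
    exact one_le_mul_of_one_le_of_one_le one_le_two
      (one_le_mul_of_one_le_of_one_le (one_le_mul_of_one_le_of_one_le hC₁ hC₂)
        (one_le_mul_of_one_le_of_one_le (by norm_num) this))
  intro X Y hX hY hYX a b hab S hS hS'
  have hX0 : 0 < X := by linarith
  obtain ⟨p, 𝔭, hp, hMp, h𝔭, h𝔭0, hp𝔭, hpD, hq, hN2, hNX⟩ :=
    h₃ X Y hX hY hYX a b hab hab.qdisc_conic_ne_zero
  have hmax : 𝔭.IsMaximal := h𝔭.isMaximal h𝔭0
  set Φ := max 1 ((X / Y ^ 2) ^ d) with hΦ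
  have hΦ1 : 1 ≤ Φ := le_max_left _ _
  obtain ⟨m, hm, hm'⟩ := exists_pow_gt_of_two_le (q := (Ideal.absNorm 𝔭 : ℝ))
    (by exact_mod_cast hN2) ((A * X) ^ d / Y ^ (2 * d))
  have hfin : Finite (𝓞 k ⧸ 𝔭 ^ m) :=
    Ideal.finiteQuotientOfFreeOfNeBot _ (pow_ne_zero m h𝔭0)
  have := Fintype.ofFinite (𝓞 k ⧸ 𝔭 ^ m)
  set n : ℕ := ⌈Module.finrank ℚ K * Real.logb 2 (3 * H * X)⌉₊ with hn
  have hres : ∀ x : Fin 3 → 𝓞 k, ∃ c, x ∈ S → HasResidue 𝔭 m x c := by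
    intro x
    by_cases hx : x ∈ S
    · have : ∃ j, x j ∉ 𝔭 := by
        by_contra! hj
        refine natCast_notMem_of_not_dvd h𝔭.ne_top hp hp𝔭 (Nat.not_dvd_of_pos_of_lt
          (Nat.pos_of_ne_zero hM₀) hMp) ?_
        refine (Ideal.span_le.2 ?_) (hS x hx).2.2.1
        rintro _ ⟨j, rfl⟩
        exact hj j
      obtain ⟨j, hj⟩ := this
      obtain ⟨c, hc⟩ := exists_hasResidue m hj
      exact ⟨c, fun _ => hc⟩
    · exact ⟨(0, 0, 0), fun h => absurd h hx⟩
  choose res hres using hres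
  let cls (x : Fin 3 → 𝓞 k) : (Fin 6 → Ideal (𝓞 K)) × (InfinitePlace K × Fin 6 → ℤ) ×
      (Fin 3 × (𝓞 k ⧸ 𝔭 ^ m) × (𝓞 k ⧸ 𝔭 ^ m)) :=
    (fun i => Ideal.span {P.D a b i, P.L i x}, fun q => ⌊Real.logb 2 (q.1 (P.L q.2 x : K))⌋, res x)
  have hdf : ∀ i, {J : Ideal (𝓞 K) | J ∣ Ideal.span {P.D a b i}}.Finite := fun i =>
    finite_setOf_ideal_dvd (by simpa using hab.D_ne_zero i)
  let T₁ : Finset (Fin 6 → Ideal (𝓞 K)) := Fintype.piFinset fun i => (hdf i).toFinset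
  let T₂ : Finset (InfinitePlace K × Fin 6 → ℤ) :=
    Fintype.piFinset fun _ => Finset.Icc (-(n : ℤ)) n
  let T := T₁ ×ˢ T₂ ×ˢ (Finset.univ : Finset (Fin 3 × (𝓞 k ⧸ 𝔭 ^ m) × (𝓞 k ⧸ 𝔭 ^ m)))
  have hmaps : ∀ x ∈ S, cls x ∈ T := by
    intro x hx
    simp only [T, Finset.mem_product, Finset.mem_univ, and_true, T₁, T₂, Fintype.mem_piFinset, cls]
    refine ⟨fun i => ?_, fun q => ?_⟩
    · rw [Set.Finite.mem_toFinset, Set.mem_ofPred_eq, Ideal.dvd_iff_le]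
      exact Ideal.span_mono (by simp)
    · refine floor_logb_mem_Icc ((hS x hx).2.2.2 _) ?_ (fun w => ?_) _
      · exact one_le_mul_of_one_le_of_one_le (by linarith) hX
      · exact (hP w).L_le (fun j => (hS x hx).2.1 (w.comap (algebraMap k K)) j) _
  have hfib : ∀ c ∈ T, (S.filter fun x => cls x = c).card ≤ 2 := by
    intro c _
    by_contra! hcard
    obtain ⟨x, hx, y, hy, z, hz, hxy, hxz, hyz⟩ := Finset.two_lt_card.1 hcard
    have hmem : ∀ q ∈ ({x, y, z} : Set (Fin 3 → 𝓞 k)), q ∈ S ∧ cls q = c := by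
      rintro q (rfl | rfl | rfl)
      exacts [Finset.mem_filter.1 hx, Finset.mem_filter.1 hy, Finset.mem_filter.1 hz]
    have hresc : ∀ q ∈ ({x, y, z} : Set (Fin 3 → 𝓞 k)), HasResidue 𝔭 m q c.2.2 := by
      intro q hq
      have h1 := hres q (hmem q hq).1
      rw [← (hmem q hq).2]
      exact h1
    have hb := h₄ X Y hX hY a b hab p 𝔭 hp h𝔭 hp𝔭 hpD hq m c.2.2.1 x y z
      (hS' x (hmem x (by simp)).1 y (hmem y (by simp)).1 hxy)
      (hS' y (hmem y (by simp)).1 z (hmem z (by simp)).1 hyz)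
      (hS' x (hmem x (by simp)).1 z (hmem z (by simp)).1 hxz)
      (fun q hq => ⟨(hS q (hmem q hq).1).1, (hS q (hmem q hq).1).2.1, (hresc q hq).1⟩)
      (fun q hq r hr => ?_)
    · rw [div_lt_iff₀ (by positivity)] at hm
      exact absurd hm (not_lt.2 hb)
    · have hqr : cls q = cls r := (hmem q hq).2.trans (hmem r hr).2.symm
      refine ⟨fun i => ?_, fun w i => ?_, fun i => (hresc q hq).sub_mem (hresc r hr) i⟩
      · have h1 : Ideal.span {P.D a b i, P.L i q} = Ideal.span {P.D a b i, P.L i r} :=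
          congrFun (congrArg Prod.fst hqr) i
        have h2 : P.L i q ∈ Ideal.span {P.D a b i, P.L i r} := h1 ▸ Ideal.subset_span (by simp)
        obtain ⟨u, v, h⟩ := Ideal.mem_span_pair.1 h2
        exact ⟨u, v, h.symm⟩
      · have h1 := congrFun (congrArg (fun e => e.2.1) hqr) (w, i)
        refine le_two_mul_of_floor_logb_eq (w.pos_iff.2 ?_) (w.pos_iff.2 ?_) h1
        · simpa using (hS q (hmem q hq).1).2.2.2 i
        · simpa using (hS r (hmem r hr).1).2.2.2 i
  have hcard := Finset.card_le_mul_card_image_of_maps_to hmaps 2 hfib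
  have hT₁ : (T₁.card : ℝ) ≤ C₁ * X ^ (ε / 3) := by
    refine le_trans (le_of_eq ?_) (h₁ X Y hX hY hYX a b hab)
    simp only [T₁, Fintype.card_piFinset]
    push_cast
    exact Finset.prod_congr rfl fun i _ => by rw [Set.ncard_eq_toFinset_card _ (hdf i)]
  have hT₂ : (T₂.card : ℝ) ≤ C₂ * X ^ (ε / 3) := by
    refine le_trans (le_of_eq ?_) (h₂ X hX)
    simp only [T₂]
    rw [Fintype.card_piFinset, Finset.prod_const, Int.card_Icc, ← hn, Nat.cast_pow,
      Finset.card_univ]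
    congr 2
    omega
  have hT₃ : ((Finset.univ : Finset (Fin 3 × (𝓞 k ⧸ 𝔭 ^ m) × (𝓞 k ⧸ 𝔭 ^ m))).card : ℝ) ≤
      3 * (C₃ * A ^ d) ^ 2 * X ^ (ε / 3) * Φ ^ 2 := by
    have h5 : Fintype.card (𝓞 k ⧸ 𝔭 ^ m) = Ideal.absNorm 𝔭 ^ m := by
      rw [← map_pow, Ideal.absNorm_apply, Submodule.cardQuot_apply, Nat.card_eq_fintype_card]
    rw [Finset.card_univ, Fintype.card_prod, Fintype.card_prod, Fintype.card_fin, h5]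
    have h6 : (Ideal.absNorm 𝔭 : ℝ) ^ m ≤ C₃ * X ^ (ε / 6) * (A ^ d * Φ) := by
      refine hm'.trans (mul_le_mul hNX ?_ (by positivity) (by positivity))
      apply max_le
      · exact one_le_mul_of_one_le_of_one_le (one_le_pow₀ hA) hΦ1
      · rw [pow_mul, ← div_pow, mul_div_assoc, mul_pow]
        gcongr
        exact le_max_right _ _
    push_cast
    calc (3 : ℝ) * ((Ideal.absNorm 𝔭 : ℝ) ^ m * (Ideal.absNorm 𝔭 : ℝ) ^ m)
        = 3 * ((Ideal.absNorm 𝔭 : ℝ) ^ m) ^ 2 := by ring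
      _ ≤ 3 * (C₃ * X ^ (ε / 6) * (A ^ d * Φ)) ^ 2 := by gcongr
      _ = 3 * (C₃ * A ^ d) ^ 2 * (X ^ (ε / 6)) ^ 2 * Φ ^ 2 := by ring
      _ = _ := by
        rw [← Real.rpow_mul_natCast hX0.le]
        congr 3
        push_cast; ring
  have hXε : X ^ (ε / 3) * X ^ (ε / 3) * X ^ (ε / 3) = X ^ ε := by
    rw [← Real.rpow_add hX0, ← Real.rpow_add hX0]; congr 1; ring
  calc (S.card : ℝ) ≤ ((2 * T.card : ℕ) : ℝ) := by exact_mod_cast hcard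
    _ = 2 * (T₁.card * (T₂.card *
        ((Finset.univ : Finset (Fin 3 × (𝓞 k ⧸ 𝔭 ^ m) × (𝓞 k ⧸ 𝔭 ^ m))).card : ℝ))) := by
      simp only [T, Finset.card_product]; push_cast; ring
    _ ≤ 2 * (C₁ * X ^ (ε / 3) * (C₂ * X ^ (ε / 3) *
        (3 * (C₃ * A ^ d) ^ 2 * X ^ (ε / 3) * Φ ^ 2))) := by gcongr
    _ = 2 * (C₁ * C₂ * (3 * (C₃ * A ^ d) ^ 2)) * (X ^ (ε / 3) * X ^ (ε / 3) * X ^ (ε / 3)) *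
        Φ ^ 2 := by ring
    _ = _ := by rw [hXε]

end SplitPencil

section Transfer

variable {R : Type*} [CommRing R]

lemma NonProp.of_mul_eq [IsDomain R] {g c g' c' : R} (hc : c ≠ 0) (hc' : c' ≠ 0)
    {x y x' y' : Fin 3 → R} (h : ∀ i, g * y i = c * x i)
    (h' : ∀ i, g' * y' i = c' * x' i) (hxx : NonProp x x') : NonProp y y' := by
  obtain ⟨i, j, hij⟩ := hxx
  refine ⟨i, j, fun h0 => mul_ne_zero (mul_ne_zero hc hc') hij ?_⟩
  linear_combination g * g' * h0 - c' * x' j * h i - g * y i * h' j + c' * x' i * h j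
    + g * y j * h' i

lemma qf_of_mul_eq {g c : R} {x y : Fin 3 → R} (h : ∀ i, g * y i = c * x i) (q : Fin 6 → R) :
    g ^ 2 * qf q y = c ^ 2 * qf q x := by
  rw [← qf_smul, ← qf_smul]
  exact congrArg _ (funext h)

lemma linForm_of_mul_eq {g c : R} {x y : Fin 3 → R} (h : ∀ i, g * y i = c * x i)
    (l : Fin 3 → R) : g * linForm l y = c * linForm l x := by
  simp only [linForm]
  linear_combination l 0 * h 0 + l 1 * h 1 + l 2 * h 2

lemma qf_pencil_of_mul_eq {g c a b a' b' : R} (ha : g * a' = c * a) (hb : g * b' = c * b)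
    (q₁ q₂ q₃ : Fin 6 → R) (x : Fin 3 → R) :
    g ^ 2 * qf (pencil q₁ q₂ q₃ a' b') x = c ^ 2 * qf (pencil q₁ q₂ q₃ a b) x := by
  rw [qf_pencil, qf_pencil]
  linear_combination qf q₁ x * (g * a' + c * a) * ha + 2 * qf q₃ x * (g * a' * hb + c * b * ha)
    - qf q₂ x * (g * b' + c * b) * hb

lemma exists_sq_eq_of_mul_eq [IsDomain R] [IsIntegrallyClosed R] {g c : R} (hg : g ≠ 0)
    {x y : Fin 3 → R}
    (h : ∀ i, g * y i = c * x i) {q₁ q₂ q₃ : Fin 6 → R}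
    (hx : ∃ T, T ^ 2 = qf q₃ x ^ 2 + qf q₁ x * qf q₂ x) :
    ∃ T, T ^ 2 = qf q₃ y ^ 2 + qf q₁ y * qf q₂ y := by
  obtain ⟨T, hT⟩ := hx
  have e : (c ^ 2 * T) ^ 2 = (g ^ 2) ^ 2 * (qf q₃ y ^ 2 + qf q₁ y * qf q₂ y) := by
    have h1 := qf_of_mul_eq h q₁
    have h2 := qf_of_mul_eq h q₂
    have h3 := qf_of_mul_eq h q₃
    calc (c ^ 2 * T) ^ 2 = (c ^ 2 * qf q₃ x) ^ 2 + (c ^ 2 * qf q₁ x) * (c ^ 2 * qf q₂ x) := by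
          linear_combination c ^ 4 * hT
      _ = _ := by rw [← h1, ← h2, ← h3]; ring
  obtain ⟨t, ht⟩ := (IsIntegrallyClosed.pow_dvd_pow_iff two_ne_zero).1 (Dvd.intro _ e.symm)
  refine ⟨t, mul_left_cancel₀ (pow_ne_zero 2 (pow_ne_zero 2 hg)) ?_⟩
  rw [← e, ht]; ring

end Transfer

namespace SplitPencil

variable {k K : Type*} [Field k] [NumberField k] [Field K] [NumberField K] [Algebra k K]
  (P : SplitPencil k K)

lemma D_ne_zero {a b : 𝓞 k} (hab : ![a, b] ≠ 0) {x : Fin 3 → 𝓞 k}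
    (hx : qf (P.conic a b) x = 0) (i : Fin 6) (h : P.L i x ≠ 0) (h' : P.L' i x ≠ 0) :
    P.D a b i ≠ 0 := by
  intro h0
  have h1 := P.sq_mul_sing_left hx i
  have h2 := P.sq_mul_sing_right hx i
  rw [h0, zero_mul] at h1 h2
  have hs : P.sing i x ≠ 0 := by
    intro hs
    have := P.e_mul_sing i x
    rw [hs, mul_zero] at this
    exact mul_ne_zero h h' this.symm
  have ha : a = 0 := by simpa [hs] using h1
  have hb : b = 0 := by simpa [hs] using h2
  exact hab (by simp [ha, hb])

/-- Every small point of the surface lies on a conic with small, well-normalized parameter. -/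
lemma exists_goodParam :
    ∃ (M : ℕ) (C : ℝ), M ≠ 0 ∧ 1 ≤ C ∧ ∀ X : ℝ, 1 ≤ X → ∀ x : Fin 3 → 𝓞 k,
      (∀ (w : InfinitePlace k) j, w (x j : k) ≤ X) →
      (∃ T, T ^ 2 = qf P.q₃ x ^ 2 + qf P.q₁ x * qf P.q₂ x) →
      (∀ i, P.L i x ≠ 0 ∧ P.L' i x ≠ 0) →
      ∃ (a b : 𝓞 k) (Y : ℝ), 1 ≤ Y ∧ Y ≤ C * X ∧ P.GoodParam M C Y a b ∧
        qf (P.conic a b) x = 0 := by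
  obtain ⟨C₁, M, hC₁, hM, h₁⟩ := exists_balanced_rep k
  obtain ⟨C₂, hC₂, h₂⟩ := exists_parameter P.q₁ P.q₂ P.q₃
  set d := Module.finrank ℚ k with hd
  have hd0 : 0 < d := Module.finrank_pos
  have hC : C₁ ≤ C₁ * C₂ := le_mul_of_one_le_right (by linarith) hC₂
  refine ⟨M, C₁ * C₂, hM, one_le_mul_of_one_le_of_one_le hC₁ hC₂, fun X hX x hx hT hL => ?_⟩
  obtain ⟨a, b, hab, hq, hR⟩ := h₂ X hX x hx hT
  obtain ⟨g, c, y, hg, hc, hy, hle, hge, hspan⟩ := h₁ ![a, b] hab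
  have hy' : y = ![y 0, y 1] := by
    funext i; fin_cases i <;> rfl
  have hR1 := one_le_heightFn hab
  have hq' : qf (P.conic (y 0) (y 1)) x = 0 := by
    have := qf_pencil_of_mul_eq (hy 0) (hy 1) P.q₁ P.q₂ P.q₃ x
    simp only [Matrix.cons_val_zero, Matrix.cons_val_one] at this
    rw [hq, mul_zero] at this
    exact (mul_eq_zero.1 this).resolve_left (pow_ne_zero 2 hg)
  have hy0 : ![y 0, y 1] ≠ 0 := by
    rw [← hy']
    rintro rfl
    apply hab
    funext i
    have := hy i
    simpa [hc] using this.symm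
  have hY1 : 1 ≤ heightFn ![a, b] ^ (1 / (d : ℝ)) := Real.one_le_rpow hR1 (by positivity)
  refine ⟨y 0, y 1, heightFn ![a, b] ^ (1 / (d : ℝ)), hY1, ?_, ⟨?_, ?_, ?_, ?_, ?_⟩, hq'⟩
  · calc heightFn ![a, b] ^ (1 / (d : ℝ)) ≤ (C₂ * X ^ d) ^ (1 / (d : ℝ)) := by gcongr
      _ = C₂ ^ (1 / (d : ℝ)) * X := by
        rw [Real.mul_rpow (by linarith) (by positivity), one_div,
          Real.pow_rpow_inv_natCast (by linarith) hd0.ne']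
      _ ≤ C₂ ^ (1 : ℝ) * X := by
        gcongr
        rw [div_le_one (by positivity)]
        exact_mod_cast hd0
      _ ≤ _ := by
        rw [Real.rpow_one]
        gcongr
        exact le_mul_of_one_le_left (by linarith) hC₁
  · intro w
    exact (hle w 0).trans (by gcongr)
  · intro w
    exact (hle w 1).trans (by gcongr)
  · intro w
    obtain ⟨i, hi⟩ := hge w
    have : ∀ z : k, C₁ * w z ≤ C₁ * C₂ * w z := fun z => by gcongr
    fin_cases i
    · exact Or.inl (hi.trans (this _))
    · exact Or.inr (hi.trans (this _))
  · rw [← hy']; exact hspan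
  · exact fun i => P.D_ne_zero hy0 hq' i (hL i).1 (hL i).2

end SplitPencil

namespace SplitPencil

variable {k K : Type*} [Field k] [NumberField k] [Field K] [NumberField K] [Algebra k K]
  (P : SplitPencil k K)

lemma sq_mul_max_sq_le {Q X A : ℝ} (hQ : 0 < Q) (hX : 1 ≤ X) (hQ1 : 1 ≤ Q) (hQX : Q ≤ A * X) :
    Q ^ 2 * (max 1 (X / Q ^ 2)) ^ 2 ≤ (A ^ 2 + 1) * X ^ 2 := by
  have h1 : (max 1 (X / Q ^ 2)) ^ 2 ≤ 1 + (X / Q ^ 2) ^ 2 := by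
    rcases max_cases 1 (X / Q ^ 2) with ⟨h, _⟩ | ⟨h, _⟩ <;> rw [h] <;>
      nlinarith [sq_nonneg (X / Q ^ 2)]
  calc Q ^ 2 * (max 1 (X / Q ^ 2)) ^ 2 ≤ Q ^ 2 * (1 + (X / Q ^ 2) ^ 2) := by gcongr
    _ = Q ^ 2 + X ^ 2 / Q ^ 2 := by field_simp
    _ ≤ (A * X) ^ 2 + X ^ 2 := by
      gcongr
      exact div_le_self (by positivity) (one_le_pow₀ hQ1)
    _ = _ := by ring

/-- The number of points in a box. -/
lemma exists_box_count_le (M₀ : ℕ) (hM₀ : M₀ ≠ 0) {ε : ℝ} (hε : 0 < ε) :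
    ∃ C : ℝ, 1 ≤ C ∧ ∀ X : ℝ, 1 ≤ X → ∀ S : Finset (Fin 3 → 𝓞 k),
      (∀ x ∈ S, (∀ (w : InfinitePlace k) j, w (x j : k) ≤ X) ∧
        (M₀ : 𝓞 k) ∈ Ideal.span (Set.range x) ∧
        (∃ T, T ^ 2 = qf P.q₃ x ^ 2 + qf P.q₁ x * qf P.q₂ x) ∧
        ∀ i, P.L i x ≠ 0 ∧ P.L' i x ≠ 0) →
      (∀ x ∈ S, ∀ y ∈ S, x ≠ y → NonProp x y) →
      (S.card : ℝ) ≤ C * X ^ (2 * (Module.finrank ℚ k : ℝ) + ε) := by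
  classical
  obtain ⟨M, C₀, hM, hC₀, h₀⟩ := P.exists_goodParam
  obtain ⟨C₁, hC₁, h₁⟩ := P.exists_conic_count_le M₀ hM₀ hM (ε := ε / 2) hC₀ (by positivity)
  obtain ⟨C₂, hC₂, h₂⟩ := exists_ncard_box_le k
  obtain ⟨C₃, hC₃, h₃⟩ := exists_log_bins_le 1 1 (ε := ε / 2) hC₀ (by positivity)
  set d := Module.finrank ℚ k with hd
  have hA : 1 ≤ (C₂ * (C₀ * 2) ^ d) ^ 2 := one_le_pow₀ (one_le_mul_of_one_le_of_one_le hC₂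
    (one_le_pow₀ (by linarith)))
  refine ⟨C₃ * ((C₂ * (C₀ * 2) ^ d) ^ 2 * C₁ * ((C₀ ^ d) ^ 2 + 1)),
    one_le_mul_of_one_le_of_one_le hC₃ (one_le_mul_of_one_le_of_one_le
      (one_le_mul_of_one_le_of_one_le hA hC₁) (by nlinarith [sq_nonneg (C₀ ^ d)])), ?_⟩
  intro X hX S hS hS'
  have hX0 : 0 < X := by linarith
  have hch : ∀ x : Fin 3 → 𝓞 k, ∃ (p : 𝓞 k × 𝓞 k) (Y : ℝ), x ∈ S → 1 ≤ Y ∧ Y ≤ C₀ * X ∧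
      P.GoodParam M C₀ Y p.1 p.2 ∧ qf (P.conic p.1 p.2) x = 0 := by
    intro x
    by_cases hx : x ∈ S
    · obtain ⟨a, b, Y, h⟩ := h₀ X hX x (hS x hx).1 (hS x hx).2.2.1 (hS x hx).2.2.2
      exact ⟨(a, b), Y, fun _ => h⟩
    · exact ⟨(0, 0), 0, fun h => absurd h hx⟩
  choose p Y hpY using hch
  set n : ℕ := ⌈Real.logb 2 (C₀ * X)⌉₊ with hn
  let lev (x : Fin 3 → 𝓞 k) : ℕ := ⌊Real.logb 2 (Y x)⌋₊
  have hlev1 : ∀ x ∈ S, (2 : ℝ) ^ lev x ≤ Y x := by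
    intro x hx
    have := (hpY x hx).1
    rw [← Real.rpow_natCast, ← Real.le_logb_iff_rpow_le one_lt_two (by linarith)]
    exact Nat.floor_le (Real.logb_nonneg one_lt_two this)
  have hlev2 : ∀ x ∈ S, Y x ≤ 2 * 2 ^ lev x := by
    intro x hx
    have := (hpY x hx).1
    rw [← pow_succ', ← Real.rpow_natCast, ← Real.logb_le_iff_le_rpow one_lt_two (by linarith)]
    push_cast
    exact (Nat.lt_floor_add_one _).le
  have hmaps : ∀ x ∈ S, lev x ∈ Finset.range (n + 1) := by
    intro x hx
    obtain ⟨h1, h2, -⟩ := hpY x hx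
    rw [Finset.mem_range, Nat.lt_succ_iff, hn]
    refine (Nat.floor_le_floor ?_).trans (Nat.floor_le_ceil _)
    exact Real.logb_le_logb_of_le one_lt_two (by linarith) h2
  have hfib : ∀ j ∈ Finset.range (n + 1), ((S.filter fun x => lev x = j).card : ℝ) ≤
      (C₂ * (C₀ * 2) ^ d) ^ 2 * C₁ * ((C₀ ^ d) ^ 2 + 1) * X ^ (2 * (d : ℝ) + ε / 2) := by
    intro j _
    set Sj := S.filter fun x => lev x = j with hSj
    rcases Sj.eq_empty_or_nonempty with he | ⟨x₀, hx₀⟩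
    · rw [he, Finset.card_empty, Nat.cast_zero]
      have : 0 < C₁ := by linarith
      positivity
    have hmem : ∀ x ∈ Sj, x ∈ S ∧ lev x = j := fun x hx => Finset.mem_filter.1 hx
    obtain ⟨hbf, hbc⟩ := h₂ (C₀ * (2 * 2 ^ j)) (one_le_mul_of_one_le_of_one_le hC₀
      (one_le_mul_of_one_le_of_one_le one_le_two (one_le_pow₀ one_le_two)))
    set bx := hbf.toFinset with hbx
    have hmaps' : ∀ x ∈ Sj, p x ∈ bx ×ˢ bx := by
      intro x hx
      obtain ⟨hxS, hxj⟩ := hmem x hx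
      obtain ⟨h1, h2, h3, h4⟩ := hpY x hxS
      have h5 := hlev2 x hxS
      rw [hxj] at h5
      rw [Finset.mem_product, hbx, Set.Finite.mem_toFinset, Set.Finite.mem_toFinset]
      refine ⟨fun w => (h3.le_left w).trans (by gcongr), fun w => (h3.le_right w).trans (by gcongr)⟩
    have hQ : (((2 : ℝ) ^ j) ^ d) ≤ C₀ ^ d * X ^ d := by
      obtain ⟨hxS, hxj⟩ := hmem x₀ hx₀
      rw [← mul_pow, ← hxj]
      gcongr
      exact (hlev1 x₀ hxS).trans (hpY x₀ hxS).2.1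
    have hfib' : ∀ c ∈ bx ×ˢ bx, ((Sj.filter fun x => p x = c).card : ℝ) ≤
        C₁ * X ^ (ε / 2) * (max 1 (X ^ d / ((2 ^ j) ^ d) ^ 2)) ^ 2 := by
      intro c _
      rcases (Sj.filter fun x => p x = c).eq_empty_or_nonempty with he | ⟨x₁, hx₁⟩
      · rw [he, Finset.card_empty, Nat.cast_zero]
        have : 0 < C₁ := by linarith
        positivity
      obtain ⟨hx₁S, hx₁c⟩ := Finset.mem_filter.1 hx₁
      obtain ⟨hx₁S, hx₁j⟩ := hmem x₁ hx₁S
      obtain ⟨g1, g2, g3, g4⟩ := hpY x₁ hx₁S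
      rw [hx₁c] at g3
      have hl := hlev1 x₁ hx₁S
      rw [hx₁j] at hl
      refine (h₁ X (Y x₁) hX g1 g2 c.1 c.2 g3 _ ?_ ?_).trans ?_
      · intro x hx
        obtain ⟨hxS, hxc⟩ := Finset.mem_filter.1 hx
        have hxS' := (hmem x hxS).1
        have := hpY x hxS'
        rw [hxc] at this
        exact ⟨this.2.2.2, (hS x hxS').1, (hS x hxS').2.1, fun i => ((hS x hxS').2.2.2 i).1⟩
      · intro x hx y hy
        exact hS' x (hmem x (Finset.mem_filter.1 hx).1).1 y (hmem y (Finset.mem_filter.1 hy).1).1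
      · have : 0 < C₁ := by linarith
        gcongr
        rw [div_pow, ← pow_mul, ← pow_mul, mul_comm 2 d, pow_mul, pow_mul]
        gcongr
    calc (Sj.card : ℝ) = ∑ c ∈ bx ×ˢ bx, ((Sj.filter fun x => p x = c).card : ℝ) := by
          rw [Finset.card_eq_sum_card_fiberwise hmaps']; push_cast; rfl
      _ ≤ ∑ c ∈ bx ×ˢ bx, C₁ * X ^ (ε / 2) * (max 1 (X ^ d / ((2 ^ j) ^ d) ^ 2)) ^ 2 :=
          Finset.sum_le_sum hfib'
      _ = (bx.card : ℝ) ^ 2 * (C₁ * X ^ (ε / 2) * (max 1 (X ^ d / ((2 ^ j) ^ d) ^ 2)) ^ 2) := by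
          rw [Finset.sum_const, nsmul_eq_mul, Finset.card_product]; push_cast; ring
      _ ≤ (C₂ * (C₀ * (2 * 2 ^ j)) ^ d) ^ 2 *
          (C₁ * X ^ (ε / 2) * (max 1 (X ^ d / ((2 ^ j) ^ d) ^ 2)) ^ 2) := by
          have : 0 < C₁ := by linarith
          rw [hbx, ← Set.ncard_eq_toFinset_card _ hbf]
          gcongr
      _ = (C₂ * (C₀ * 2) ^ d) ^ 2 * C₁ * X ^ (ε / 2) *
          (((2 ^ j) ^ d) ^ 2 * (max 1 (X ^ d / ((2 ^ j) ^ d) ^ 2)) ^ 2) := by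
          rw [← mul_assoc C₀, mul_pow (C₀ * 2)]; ring
      _ ≤ (C₂ * (C₀ * 2) ^ d) ^ 2 * C₁ * X ^ (ε / 2) *
          (((C₀ ^ d) ^ 2 + 1) * (X ^ d) ^ 2) := by
          have : 0 < C₁ := by linarith
          exact mul_le_mul_of_nonneg_left (sq_mul_max_sq_le (by positivity) (one_le_pow₀ hX)
            (one_le_pow₀ (one_le_pow₀ one_le_two)) hQ) (by positivity)
      _ = _ := by
          rw [Real.rpow_add hX0, mul_comm 2 (d : ℝ), Real.rpow_mul hX0.le, Real.rpow_natCast]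
          norm_cast
          ring
  have hn1 : ((n + 1 : ℕ) : ℝ) ≤ C₃ * X ^ (ε / 2) := by
    refine le_trans ?_ (h₃ X hX)
    rw [pow_one, Nat.cast_one, one_mul, ← hn]
    exact_mod_cast (by omega : n + 1 ≤ 2 * n + 1)
  calc (S.card : ℝ) = ∑ j ∈ Finset.range (n + 1), ((S.filter fun x => lev x = j).card : ℝ) := by
        rw [Finset.card_eq_sum_card_fiberwise hmaps]; push_cast; rfl
    _ ≤ ∑ j ∈ Finset.range (n + 1),
        (C₂ * (C₀ * 2) ^ d) ^ 2 * C₁ * ((C₀ ^ d) ^ 2 + 1) * X ^ (2 * (d : ℝ) + ε / 2) :=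
        Finset.sum_le_sum hfib
    _ = ((n + 1 : ℕ) : ℝ) *
        ((C₂ * (C₀ * 2) ^ d) ^ 2 * C₁ * ((C₀ ^ d) ^ 2 + 1) * X ^ (2 * (d : ℝ) + ε / 2)) := by
        rw [Finset.sum_const, nsmul_eq_mul, Finset.card_range]
    _ ≤ C₃ * X ^ (ε / 2) *
        ((C₂ * (C₀ * 2) ^ d) ^ 2 * C₁ * ((C₀ ^ d) ^ 2 + 1) * X ^ (2 * (d : ℝ) + ε / 2)) := by
        have : 0 < C₁ := by linarith
        gcongr
    _ = C₃ * ((C₂ * (C₀ * 2) ^ d) ^ 2 * C₁ * ((C₀ ^ d) ^ 2 + 1)) *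
        (X ^ (2 * (d : ℝ) + ε / 2) * X ^ (ε / 2)) := by ring
    _ = _ := by
        rw [← Real.rpow_add hX0]
        congr 2
        ring

/-- The number of points of bounded height on the part of the surface `T² = q₃² + q₁ q₂` where no
linear factor of a singular conic vanishes. -/
theorem exists_height_count_le {ε : ℝ} (hε : 0 < ε) :
    ∃ C : ℝ, 1 ≤ C ∧ ∀ B : ℝ, 1 ≤ B → ∀ S : Finset (Fin 3 → 𝓞 k),
      (∀ x ∈ S, x ≠ 0 ∧ heightFn x ≤ B ∧
        (∃ T, T ^ 2 = qf P.q₃ x ^ 2 + qf P.q₁ x * qf P.q₂ x) ∧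
        ∀ i, P.L i x ≠ 0 ∧ P.L' i x ≠ 0) →
      (∀ x ∈ S, ∀ y ∈ S, x ≠ y → NonProp x y) → (S.card : ℝ) ≤ C * B ^ (2 + ε) := by
  classical
  obtain ⟨C₀, M₀, hC₀, hM₀, h₀⟩ := exists_balanced_rep k
  obtain ⟨C₁, hC₁, h₁⟩ := P.exists_box_count_le M₀ hM₀ hε
  set d := Module.finrank ℚ k with hd
  have hd0 : 0 < d := Module.finrank_pos
  refine ⟨C₁ * C₀ ^ (2 * (d : ℝ) + ε), one_le_mul_of_one_le_of_one_le hC₁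
    (Real.one_le_rpow hC₀ (by positivity)), fun B hB S hS hS' => ?_⟩
  have hB0 : 0 < B := by linarith
  have hch : ∀ x : Fin 3 → 𝓞 k, ∃ (g c : 𝓞 k) (y : Fin 3 → 𝓞 k), x ∈ S →
      g ≠ 0 ∧ c ≠ 0 ∧ (∀ i, g * y i = c * x i) ∧
      (∀ (w : InfinitePlace k) i, w (y i : k) ≤ C₀ * B ^ (1 / (d : ℝ))) ∧
      (M₀ : 𝓞 k) ∈ Ideal.span (Set.range y) := by
    intro x
    by_cases hx : x ∈ S
    · obtain ⟨hx0, hxB, -⟩ := hS x hx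
      obtain ⟨g, c, y, hg, hc, hy, hle, -, hsp⟩ := h₀ x hx0
      have := one_le_heightFn hx0
      exact ⟨g, c, y, fun _ => ⟨hg, hc, hy, fun w i => (hle w i).trans (by gcongr), hsp⟩⟩
    · exact ⟨0, 0, 0, fun h => absurd h hx⟩
  choose g c y hy using hch
  have hnp : ∀ x ∈ S, ∀ x' ∈ S, x ≠ x' → NonProp (y x) (y x') := by
    intro x hx x' hx' hne
    exact (hS' x hx x' hx' hne).of_mul_eq (hy x hx).2.1 (hy x' hx').2.1 (hy x hx).2.2.1
      (hy x' hx').2.2.1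
  have hinj : Set.InjOn y S := by
    intro x hx x' hx' he
    by_contra hne
    obtain ⟨i, j, hij⟩ := hnp x hx x' hx' hne
    rw [he] at hij
    exact hij (by ring)
  have hX : 1 ≤ C₀ * B ^ (1 / (d : ℝ)) :=
    one_le_mul_of_one_le_of_one_le hC₀ (Real.one_le_rpow hB (by positivity))
  have hcount := h₁ _ hX (S.image y) (fun z hz => ?_) (fun z hz z' hz' hne => ?_)
  · rw [Finset.card_image_of_injOn hinj] at hcount
    refine hcount.trans ?_
    rw [Real.mul_rpow (by linarith) (by positivity), ← Real.rpow_mul hB0.le, ← mul_assoc]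
    gcongr
    rw [mul_add]
    have h1 : 1 / (d : ℝ) * (2 * d) = 2 := by field_simp
    have h2 : 1 / (d : ℝ) * ε ≤ 1 * ε := by
      gcongr
      rw [div_le_one (by positivity)]
      exact_mod_cast hd0
    linarith
  · obtain ⟨x, hx, rfl⟩ := Finset.mem_image.1 hz
    obtain ⟨hg, hc, he, hle, hsp⟩ := hy x hx
    obtain ⟨-, -, hT, hL⟩ := hS x hx
    refine ⟨hle, hsp, exists_sq_eq_of_mul_eq hg he hT, fun i => ?_⟩
    have he' : ∀ j, algebraMap (𝓞 k) (𝓞 K) (g x) * algebraMap (𝓞 k) (𝓞 K) (y x j) =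
        algebraMap (𝓞 k) (𝓞 K) (c x) * algebraMap (𝓞 k) (𝓞 K) (x j) := by
      intro j
      rw [← map_mul, he, map_mul]
    have hc' : algebraMap (𝓞 k) (𝓞 K) (c x) ≠ 0 :=
      (map_ne_zero_iff _ (FaithfulSMul.algebraMap_injective _ _)).2 hc
    have key : ∀ l : Fin 3 → 𝓞 K, linForm l (fun j => algebraMap (𝓞 k) (𝓞 K) (x j)) ≠ 0 →
        linForm l (fun j => algebraMap (𝓞 k) (𝓞 K) (y x j)) ≠ 0 := by
      intro l hl h0
      have := linForm_of_mul_eq he' l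
      rw [h0, mul_zero] at this
      exact mul_ne_zero hc' hl this.symm
    exact ⟨key _ (hL i).1, key _ (hL i).2⟩
  · obtain ⟨x, hx, rfl⟩ := Finset.mem_image.1 hz
    obtain ⟨x', hx', rfl⟩ := Finset.mem_image.1 hz'
    exact hnp x hx x' hx' fun h => hne (by rw [h])

end SplitPencil

section Geometry

/-- The cross product of two vectors. -/
def cross {R : Type*} [CommRing R] (x y : Fin 3 → R) : Fin 3 → R :=
  ![x 1 * y 2 - x 2 * y 1, x 2 * y 0 - x 0 * y 2, x 0 * y 1 - x 1 * y 0]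

variable {F : Type*} [Field F]

lemma polarForm_self (c : Fin 6 → F) (x : Fin 3 → F) : polarForm c x x = 2 * qf c x := by
  simp only [polarForm, qf]; ring

lemma polarForm_comm (c : Fin 6 → F) (x y : Fin 3 → F) : polarForm c x y = polarForm c y x := by
  simp only [polarForm]; ring

lemma polarForm_add_smul (c : Fin 6 → F) (s t : F) (x y z : Fin 3 → F) :
    polarForm c (s • x + t • y) z = s * polarForm c x z + t * polarForm c y z := by
  simp only [polarForm, Pi.add_apply, Pi.smul_apply, smul_eq_mul]; ring

lemma qf_add_smul (c : Fin 6 → F) (s t : F) (x y : Fin 3 → F) :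
    qf c (s • x + t • y) = qf c x * s ^ 2 + polarForm c x y * s * t + qf c y * t ^ 2 := by
  simp only [qf, polarForm, Pi.add_apply, Pi.smul_apply, smul_eq_mul]; ring

lemma exists_polarForm_eq_zero {c : Fin 6 → F} (h : qdisc c = 0) :
    ∃ z ≠ 0, ∀ y, polarForm c z y = 0 := by
  obtain ⟨z, hz, h⟩ := Matrix.exists_mulVec_eq_zero_iff.2
    (show (!![2 * c 0, c 5, c 4; c 5, 2 * c 1, c 3; c 4, c 3, 2 * c 2]).det = 0 by
      rw [Matrix.det_fin_three, ← h]
      simp [qdisc]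
      ring)
  refine ⟨z, hz, fun y => ?_⟩
  have h0 := congrFun h 0
  have h1 := congrFun h 1
  have h2 := congrFun h 2
  simp [Matrix.mulVec, dotProduct, Fin.sum_univ_three] at h0 h1 h2
  simp only [polarForm]
  linear_combination y 0 * h0 + y 1 * h1 + y 2 * h2

lemma det3_smul_eq (x y z p : Fin 3 → F) :
    det3 x y z • p = det3 p y z • x + det3 x p z • y + det3 x y p • z := by
  funext i
  fin_cases i <;> simp [det3] <;> ring

lemma exists_det3_ne_zero_of_ne_zero {z : Fin 3 → F} (hz : z ≠ 0) : ∃ x y, det3 x y z ≠ 0 := by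
  by_contra! h
  apply hz
  funext i
  have h0 := h ![0, 1, 0] ![0, 0, 1]
  have h1 := h ![1, 0, 0] ![0, 0, 1]
  have h2 := h ![1, 0, 0] ![0, 1, 0]
  simp [det3] at h0 h1 h2
  fin_cases i
  exacts [h0, h1, h2]

/-- A non-degenerate binary quadratic form over an algebraically closed field splits. -/
lemma exists_binary_factor [IsAlgClosed F] (h2 : (2 : F) ≠ 0) (A B C : F) :
    ∃ α β α' β', α * α' = A ∧ α * β' + α' * β = B ∧ β * β' = C := by
  by_cases hA : A = 0
  · exact ⟨0, 1, B, C, by simp [hA], by simp, by simp⟩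
  · obtain ⟨s, hs⟩ := IsAlgClosed.exists_pow_nat_eq (B ^ 2 - 4 * A * C) two_pos
    refine ⟨A, (B - s) / 2, 1, (B + s) / (2 * A), by ring, ?_, ?_⟩
    · field_simp; ring
    · field_simp
      linear_combination -hs

/-- The pencil attached to `f = q₁ q₂ + q₃²` is invariant under the translation
`q₃ ↦ q₃ + t q₁`. -/
lemma eq_sub_mul_pencil (c₁ c₂ c₃ : Fin 6 → F) (t : F) (x : Fin 3 → F) :
    qf c₁ x * qf c₂ x + qf c₃ x ^ 2 =
      qf (fun i => c₃ i + t * c₁ i) x ^ 2 - qf c₁ x * qf (pencil c₁ c₂ c₃ t 1) x := by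
  rw [qf_pencil]
  simp only [qf]
  ring

/-- Every point of the quartic curve `q₁ q₂ + q₃² = 0` is non-singular. -/
def SmoothQuartic (c₁ c₂ c₃ : Fin 6 → F) : Prop :=
  ∀ z : Fin 3 → F, z ≠ 0 → qf c₁ z * qf c₂ z + qf c₃ z ^ 2 = 0 →
    ∃ y, polarForm c₁ z y * qf c₂ z + qf c₁ z * polarForm c₂ z y +
      2 * qf c₃ z * polarForm c₃ z y ≠ 0

lemma SmoothQuartic.qf_ne_zero {c₁ c₂ c₃ : Fin 6 → F} (hs : SmoothQuartic c₁ c₂ c₃)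
    (h2 : (2 : F) ≠ 0) {t : F} {z : Fin 3 → F} (hz : z ≠ 0)
    (h : ∀ y, polarForm (pencil c₁ c₂ c₃ t 1) z y = 0) :
    qf (fun i => c₃ i + t * c₁ i) z ≠ 0 := by
  intro h0
  have hQ : qf (pencil c₁ c₂ c₃ t 1) z = 0 := by
    have := h z
    rw [polarForm_self] at this
    exact (mul_eq_zero.1 this).resolve_left h2
  obtain ⟨y, hy⟩ := hs z hz (by rw [eq_sub_mul_pencil c₁ c₂ c₃ t, h0, hQ]; ring)
  have h3 : qf c₃ z = -t * qf c₁ z := by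
    simp only [qf] at h0 ⊢
    linear_combination h0
  have hB : polarForm (pencil c₁ c₂ c₃ t 1) z y =
      t ^ 2 * polarForm c₁ z y + 2 * t * polarForm c₃ z y - polarForm c₂ z y := by
    simp only [polarForm, pencil]; ring
  have hQ' := qf_pencil c₁ c₂ c₃ t 1 z
  rw [h y] at hB
  rw [hQ] at hQ'
  apply hy
  linear_combination qf c₁ z * hB + polarForm c₁ z y * hQ' +
    (2 * polarForm c₃ z y + 2 * t * polarForm c₁ z y) * h3

lemma SmoothQuartic.binary_disc_ne_zero [IsAlgClosed F] {c₁ c₂ c₃ : Fin 6 → F}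
    (hs : SmoothQuartic c₁ c₂ c₃) (h2 : (2 : F) ≠ 0) {t : F} {x y z : Fin 3 → F}
    (hd : det3 x y z ≠ 0)
    (hz : ∀ y, polarForm (pencil c₁ c₂ c₃ t 1) z y = 0) :
    polarForm (pencil c₁ c₂ c₃ t 1) x y ^ 2 -
      4 * qf (pencil c₁ c₂ c₃ t 1) x * qf (pencil c₁ c₂ c₃ t 1) y ≠ 0 := by
  set Q := pencil c₁ c₂ c₃ t 1 with hQ
  intro h0
  obtain ⟨s, r, hsr, hx, hy⟩ : ∃ s r : F, (s ≠ 0 ∨ r ≠ 0) ∧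
      2 * s * qf Q x + r * polarForm Q x y = 0 ∧ s * polarForm Q x y + 2 * r * qf Q y = 0 := by
    by_cases h1 : polarForm Q x y = 0 ∧ qf Q y = 0
    · by_cases hx : qf Q x = 0
      · exact ⟨1, 0, by simp, by simp [hx], by simp [h1.1]⟩
      · exact ⟨0, 1, by simp, by simp [h1.1], by simp [h1.2]⟩
    · refine ⟨-2 * qf Q y, polarForm Q x y, ?_, ?_, ?_⟩
      · by_contra! h3
        exact h1 ⟨h3.2, (mul_eq_zero.1 h3.1).resolve_left (neg_ne_zero.2 h2)⟩
      · linear_combination h0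
      · ring
  set w := s • x + r • y with hw
  have hwn : ∀ u, polarForm Q w u = 0 := by
    intro u
    have e : det3 x y z * polarForm Q w u =
        det3 u y z * polarForm Q w x + det3 x u z * polarForm Q w y +
          det3 x y u * polarForm Q w z := by
      have h := congrArg (polarForm Q w) (det3_smul_eq x y z u)
      simp only [polarForm, Pi.add_apply, Pi.smul_apply, smul_eq_mul] at h ⊢
      linear_combination h
    have e1 : polarForm Q w x = 0 := by
      rw [hw, polarForm_add_smul, polarForm_self, polarForm_comm Q y x]
      linear_combination hx
    have e2 : polarForm Q w y = 0 := by
      rw [hw, polarForm_add_smul, polarForm_self]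
      linear_combination hy
    have e3 : polarForm Q w z = 0 := by rw [polarForm_comm, hz]
    rw [e1, e2, e3] at e
    exact (mul_eq_zero.1 (by linear_combination e)).resolve_left hd
  have hz0 : z ≠ 0 := by rintro rfl; apply hd; simp [det3]
  have hq := hs.qf_ne_zero h2 hz0 hz
  set q := fun i => c₃ i + t * c₁ i
  obtain ⟨α, β, α', β', hα, hβ, hγ⟩ := exists_binary_factor h2 (qf q w) (polarForm q w z) (qf q z)
  have hβ0 : β ≠ 0 := by rintro rfl; exact hq (by rw [← hγ, zero_mul])
  have hne : (1 : F) • w + (-α / β) • z ≠ 0 := by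
    intro h
    have e1 : det3 ((1 : F) • w + (-α / β) • z) y z = s * det3 x y z := by
      simp only [det3, hw, Pi.add_apply, Pi.smul_apply, smul_eq_mul]; ring
    have e2 : det3 x ((1 : F) • w + (-α / β) • z) z = r * det3 x y z := by
      simp only [det3, hw, Pi.add_apply, Pi.smul_apply, smul_eq_mul]; ring
    rw [h] at e1 e2
    simp only [det3, Pi.zero_apply] at e1 e2
    rcases hsr with h | h
    · exact mul_ne_zero h hd (by simp only [det3]; linear_combination -e1)
    · exact mul_ne_zero h hd (by simp only [det3]; linear_combination -e2)
  refine hs.qf_ne_zero h2 hne (t := t) (fun u => ?_) ?_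
  · rw [polarForm_add_smul, hwn, hz]; ring
  · change qf q _ = 0
    rw [qf_add_smul, ← hα, ← hβ, ← hγ]
    field_simp
    ring

/-- A singular member of the pencil is a product of two independent linear forms. -/
lemma SmoothQuartic.exists_factor [IsAlgClosed F] {c₁ c₂ c₃ : Fin 6 → F}
    (hs : SmoothQuartic c₁ c₂ c₃) (h2 : (2 : F) ≠ 0) {t : F}
    (ht : qdisc (pencil c₁ c₂ c₃ t 1) = 0) :
    ∃ l l' v : Fin 3 → F, det3 l l' v ≠ 0 ∧
      ∀ x, qf (pencil c₁ c₂ c₃ t 1) x = linForm l x * linForm l' x := by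
  obtain ⟨z, hz, hn⟩ := exists_polarForm_eq_zero ht
  obtain ⟨x, y, hd⟩ := exists_det3_ne_zero_of_ne_zero hz
  have hD := hs.binary_disc_ne_zero h2 hd hn
  set Q := pencil c₁ c₂ c₃ t 1
  obtain ⟨α, β, α', β', hα, hβ, hγ⟩ := exists_binary_factor h2 (qf Q x) (polarForm Q x y) (qf Q y)
  set δ := det3 x y z
  refine ⟨α • cross y z + β • cross z x, (δ ^ 2)⁻¹ • (α' • cross y z + β' • cross z x),
    cross x y, ?_, fun p => ?_⟩
  · have e : det3 (α • cross y z + β • cross z x)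
        ((δ ^ 2)⁻¹ • (α' • cross y z + β' • cross z x)) (cross x y) =
        (δ ^ 2)⁻¹ * (α * β' - α' * β) * det3 x y z ^ 2 := by
      simp [det3, cross]; ring
    rw [e]
    refine mul_ne_zero (mul_ne_zero (inv_ne_zero (pow_ne_zero 2 hd)) fun h0 => hD ?_)
      (pow_ne_zero 2 hd)
    rw [← hα, ← hβ, ← hγ]
    linear_combination (α * β' - α' * β) * h0
  · have e : δ ^ 2 * qf Q p = qf Q x * det3 p y z ^ 2 +
        polarForm Q x y * det3 p y z * det3 x p z + qf Q y * det3 x p z ^ 2 := by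
      have h1 : qf Q (δ • p) = δ ^ 2 * qf Q p := qf_smul Q δ p
      have h3 : qf Q z = 0 := by
        have := hn z
        rw [polarForm_self] at this
        exact (mul_eq_zero.1 this).resolve_left h2
      have h4 : ∀ u (r : F), qf Q (u + r • z) = qf Q u := by
        intro u r
        have h5 := qf_add_smul Q 1 r u z
        rw [one_smul, polarForm_comm, hn, h3] at h5
        rw [h5]; ring
      rw [← h1, det3_smul_eq, h4, qf_add_smul]
    have e1 : linForm (α • cross y z + β • cross z x) p = α * det3 p y z + β * det3 x p z := by
      simp [linForm, cross, det3]; ring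
    have e2 : linForm ((δ ^ 2)⁻¹ • (α' • cross y z + β' • cross z x)) p =
        (δ ^ 2)⁻¹ * (α' * det3 p y z + β' * det3 x p z) := by
      simp [linForm, cross, det3]; ring
    have hd' : δ ≠ 0 := hd
    rw [e1, e2, ← mul_right_inj' (pow_ne_zero 2 hd'), e, ← hα, ← hβ, ← hγ]
    field_simp
    ring

end Geometry

section Discriminant

open Polynomial

lemma map_polarForm {R S : Type*} [CommRing R] [CommRing S] (φ : R →+* S) (c : Fin 6 → R)
    (x y : Fin 3 → R) :
    φ (polarForm c x y) = polarForm (fun i => φ (c i)) (fun i => φ (x i)) (fun i => φ (y i)) := by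
  simp [polarForm, map_ofNat]

variable {F : Type*} [Field F]

/-- The generic member of the pencil. -/
noncomputable def pencilPoly (c₁ c₂ c₃ : Fin 6 → F) : Fin 6 → F[X] :=
  pencil (fun i => C (c₁ i)) (fun i => C (c₂ i)) (fun i => C (c₃ i)) X 1

/-- The discriminant of the pencil. -/
noncomputable def discPoly (c₁ c₂ c₃ : Fin 6 → F) : F[X] := qdisc (pencilPoly c₁ c₂ c₃)

lemma eval_pencilPoly (c₁ c₂ c₃ : Fin 6 → F) (t : F) :
    (fun i => evalRingHom t (pencilPoly c₁ c₂ c₃ i)) = pencil c₁ c₂ c₃ t 1 := by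
  rw [pencilPoly, map_pencil]
  simp

lemma eval_discPoly (c₁ c₂ c₃ : Fin 6 → F) (t : F) :
    (discPoly c₁ c₂ c₃).eval t = qdisc (pencil c₁ c₂ c₃ t 1) := by
  rw [← eval_pencilPoly, ← map_qdisc]; rfl

lemma eval_qf_pencilPoly (c₁ c₂ c₃ : Fin 6 → F) (t : F) (x : Fin 3 → F) :
    (qf (pencilPoly c₁ c₂ c₃) fun i => C (x i)).eval t = qf (pencil c₁ c₂ c₃ t 1) x := by
  rw [← coe_evalRingHom, map_qf, eval_pencilPoly]
  simp

lemma eval_polarForm_pencilPoly (c₁ c₂ c₃ : Fin 6 → F) (t : F) (x y : Fin 3 → F) :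
    (polarForm (pencilPoly c₁ c₂ c₃) (fun i => C (x i)) fun i => C (y i)).eval t =
      polarForm (pencil c₁ c₂ c₃ t 1) x y := by
  rw [← coe_evalRingHom, map_polarForm, eval_pencilPoly]
  simp

lemma natDegree_discPoly_le (c₁ c₂ c₃ : Fin 6 → F) : (discPoly c₁ c₂ c₃).natDegree ≤ 6 := by
  have h : ∀ i, (pencilPoly c₁ c₂ c₃ i).natDegree ≤ 2 := by
    intro i; simp only [pencilPoly, pencil]; compute_degree!
  have h3 : ∀ i j l, (pencilPoly c₁ c₂ c₃ i * pencilPoly c₁ c₂ c₃ j *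
      pencilPoly c₁ c₂ c₃ l).natDegree ≤ 6 := fun i j l =>
    natDegree_mul_le_of_le (natDegree_mul_le_of_le (h i) (h j)) (h l)
  have h3' : ∀ i j, (pencilPoly c₁ c₂ c₃ i * pencilPoly c₁ c₂ c₃ j ^ 2).natDegree ≤ 6 := by
    intro i j; rw [pow_two, ← mul_assoc]; exact h3 i j j
  have h2 : ∀ p : F[X], p.natDegree ≤ 6 → (2 * p).natDegree ≤ 6 := by
    intro p hp
    refine (natDegree_mul_le).trans ?_
    rw [natDegree_ofNat]; omega
  have h8 : ∀ p : F[X], p.natDegree ≤ 6 → (8 * p).natDegree ≤ 6 := by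
    intro p hp
    refine (natDegree_mul_le).trans ?_
    rw [natDegree_ofNat]; omega
  exact natDegree_sub_le_of_le (natDegree_add_le_of_degree_le (h8 _ (h3 _ _ _)) (h2 _ (h3 _ _ _)))
    (h2 _ (natDegree_add_le_of_degree_le (natDegree_add_le_of_degree_le (h3' _ _) (h3' _ _))
      (h3' _ _)))

lemma coeff_discPoly (c₁ c₂ c₃ : Fin 6 → F) : (discPoly c₁ c₂ c₃).coeff 6 = qdisc c₁ := by
  have h : ∀ i, (pencilPoly c₁ c₂ c₃ i).natDegree ≤ 2 := by
    intro i; simp only [pencilPoly, pencil]; compute_degree!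
  have hc : ∀ i, (pencilPoly c₁ c₂ c₃ i).coeff 2 = c₁ i := by
    intro i; simp only [pencilPoly, pencil]; compute_degree!
  have h3 : ∀ i j l, (pencilPoly c₁ c₂ c₃ i * pencilPoly c₁ c₂ c₃ j *
      pencilPoly c₁ c₂ c₃ l).coeff 6 = c₁ i * c₁ j * c₁ l := by
    intro i j l
    rw [show 6 = 4 + 2 from rfl, coeff_mul_add_eq_of_natDegree_le
      (natDegree_mul_le_of_le (h i) (h j)) (h l),
      coeff_mul_add_eq_of_natDegree_le (h i) (h j), hc, hc, hc]
  have h3' : ∀ i j, (pencilPoly c₁ c₂ c₃ i * pencilPoly c₁ c₂ c₃ j ^ 2).coeff 6 =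
      c₁ i * c₁ j ^ 2 := by
    intro i j; rw [pow_two, ← mul_assoc, h3]; ring
  simp only [discPoly, qdisc, coeff_sub, coeff_add, coeff_ofNat_mul, h3, h3']

lemma polarForm_pencilPoly_dvd {c₁ c₂ c₃ : Fin 6 → F} {t : F} {z : Fin 3 → F}
    (hz : ∀ y, polarForm (pencil c₁ c₂ c₃ t 1) z y = 0) (y : Fin 3 → F) :
    X - C t ∣ polarForm (pencilPoly c₁ c₂ c₃) (fun i => C (y i)) fun i => C (z i) := by
  rw [dvd_iff_isRoot, IsRoot, eval_polarForm_pencilPoly, polarForm_comm, hz]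

lemma SmoothQuartic.not_sq_dvd_discPoly [IsAlgClosed F] {c₁ c₂ c₃ : Fin 6 → F}
    (hs : SmoothQuartic c₁ c₂ c₃) (h2 : (2 : F) ≠ 0) (t : F) :
    ¬ (X - C t) ^ 2 ∣ discPoly c₁ c₂ c₃ := by
  intro hdvd
  have ht : qdisc (pencil c₁ c₂ c₃ t 1) = 0 := by
    rw [← eval_discPoly]
    exact dvd_iff_isRoot.1 ((dvd_pow_self _ two_ne_zero).trans hdvd)
  obtain ⟨z, hz, hn⟩ := exists_polarForm_eq_zero ht
  obtain ⟨x, y, hd⟩ := exists_det3_ne_zero_of_ne_zero hz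
  have hD := hs.binary_disc_ne_zero h2 hd hn
  have hq := hs.qf_ne_zero h2 hz hn
  have hQz : qf (pencil c₁ c₂ c₃ t 1) z = 0 := by
    have := hn z
    rw [polarForm_self] at this
    exact (mul_eq_zero.1 this).resolve_left h2
  set Q := pencilPoly c₁ c₂ c₃ with hQ
  set S : F[X] := X - C t with hS
  let x' : Fin 3 → F[X] := fun i => C (x i)
  let y' : Fin 3 → F[X] := fun i => C (y i)
  let z' : Fin 3 → F[X] := fun i => C (z i)
  obtain ⟨G, hG, hGt⟩ : ∃ G, qf Q z' = S * G ∧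
      G.eval t = 2 * qf (fun i => c₃ i + t * c₁ i) z := by
    refine ⟨C (qf c₁ z) * (X + C t) + 2 * C (qf c₃ z), ?_, ?_⟩
    · rw [qf_pencil] at hQz
      have e : qf c₂ z = t ^ 2 * qf c₁ z + 2 * t * qf c₃ z := by linear_combination -hQz
      have e' : ∀ c : Fin 6 → F, qf (fun i => C (c i)) z' = C (qf c z) :=
        fun c => (map_qf C c z).symm
      rw [hQ, pencilPoly, qf_pencil, e', e', e', e, hS]
      simp only [map_add, map_mul, map_pow, map_ofNat]
      ring
    · simp only [eval_add, eval_mul, eval_C, eval_X, eval_ofNat, qf]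
      ring
  obtain ⟨Hx, hHx⟩ := polarForm_pencilPoly_dvd hn x
  obtain ⟨Hy, hHy⟩ := polarForm_pencilPoly_dvd hn y
  have key : S ^ 2 ∣ S * (G * (polarForm Q x' y' ^ 2 - 4 * qf Q x' * qf Q y')) * 2 := by
    have h1 := det3_sq_mul_qdisc Q x' y' z'
    obtain ⟨W, hW⟩ := hdvd
    have hW' : qdisc Q = S ^ 2 * W := hW
    change polarForm Q x' z' = S * Hx at hHx
    change polarForm Q y' z' = S * Hy at hHy
    rw [hG, hHx, hHy, hW'] at h1
    refine ⟨-(det3 x' y' z' ^ 2 * W) + 2 * (polarForm Q x' y' * Hx * Hy) -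
      2 * (qf Q x' * Hy ^ 2 + qf Q y' * Hx ^ 2), ?_⟩
    linear_combination h1
  rw [pow_two, mul_assoc S, mul_dvd_mul_iff_left (X_sub_C_ne_zero t), hS, dvd_iff_isRoot, IsRoot,
    eval_mul, eval_mul, hGt, eval_sub, eval_mul, eval_mul, eval_pow, eval_qf_pencilPoly,
    eval_qf_pencilPoly, eval_polarForm_pencilPoly, eval_ofNat, eval_ofNat] at key
  exact mul_ne_zero (mul_ne_zero (mul_ne_zero h2 hq) hD) h2 key

/-- The singular members of the pencil of conics attached to a smooth quartic: there are six of
them, and each splits into two distinct lines. -/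
theorem SmoothQuartic.exists_splitting [IsAlgClosed F] {c₁ c₂ c₃ : Fin 6 → F}
    (hs : SmoothQuartic c₁ c₂ c₃) (h2 : (2 : F) ≠ 0) (hc : qdisc c₁ ≠ 0) :
    ∃ (r : Fin 6 → F) (l l' v : Fin 6 → Fin 3 → F), Function.Injective r ∧
      (∀ t, qdisc (pencil c₁ c₂ c₃ t 1) = 0 → ∃ i, t = r i) ∧
      ∀ i, det3 (l i) (l' i) (v i) ≠ 0 ∧
        ∀ x, qf (pencil c₁ c₂ c₃ (r i) 1) x = linForm (l i) x * linForm (l' i) x := by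
  classical
  set p := discPoly c₁ c₂ c₃ with hp
  have hdeg : p.natDegree = 6 :=
    natDegree_eq_of_le_of_coeff_ne_zero (natDegree_discPoly_le _ _ _)
      (by rw [coeff_discPoly]; exact hc)
  have hp0 : p ≠ 0 := by intro h; rw [h] at hdeg; simp at hdeg
  have hnodup : p.roots.Nodup := by
    rw [Multiset.nodup_iff_count_le_one]
    intro t
    rw [count_roots]
    by_contra! h
    exact hs.not_sq_dvd_discPoly h2 t ((le_rootMultiplicity_iff hp0).1 h)
  have hcard : p.roots.toFinset.card = 6 := by
    rw [Multiset.toFinset_card_of_nodup hnodup, ← hdeg]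
    exact splits_iff_card_roots.1 (IsAlgClosed.splits p)
  let E := p.roots.toFinset.equivFinOfCardEq hcard
  have hroot : ∀ t, qdisc (pencil c₁ c₂ c₃ t 1) = 0 ↔ t ∈ p.roots.toFinset := by
    intro t
    rw [Multiset.mem_toFinset, mem_roots hp0, IsRoot, hp, eval_discPoly]
  have hf : ∀ i : Fin 6, ∃ l l' v : Fin 3 → F, det3 l l' v ≠ 0 ∧
      ∀ x, qf (pencil c₁ c₂ c₃ (E.symm i) 1) x = linForm l x * linForm l' x :=
    fun i => hs.exists_factor h2 ((hroot _).2 (E.symm i).2)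
  choose l l' v h using hf
  refine ⟨fun i => E.symm i, l, l', v, ?_, fun t ht => ?_, h⟩
  · exact Subtype.val_injective.comp E.symm.injective
  · exact ⟨E ⟨t, (hroot t).1 ht⟩, by simp⟩

end Discriminant

section Polynomials

open MvPolynomial Pointwise

lemma exists_eq_qf_of_isHomogeneous {k : Type*} [Field k] {q : MvPolynomial (Fin 3) k}
    (hq : q.IsHomogeneous 2) : ∃ c : Fin 6 → k, q = qf (fun i => C (c i)) X := by
  have h : q ∈ Submodule.span k
      (Set.range (X : Fin 3 → MvPolynomial (Fin 3) k) *
        Set.range (X : Fin 3 → MvPolynomial (Fin 3) k)) := by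
    have e := homogeneousSubmodule_one_pow (σ := Fin 3) (R := k) 2
    rw [homogeneousSubmodule_one_eq_span_X, pow_two, Submodule.span_mul_span] at e
    rw [e]
    exact hq
  clear hq
  induction h using Submodule.span_induction with
  | mem x hx =>
    obtain ⟨_, ⟨i, rfl⟩, _, ⟨j, rfl⟩, rfl⟩ := Set.mem_mul.1 hx
    fin_cases i <;> fin_cases j
    · exact ⟨![1, 0, 0, 0, 0, 0], by simp [qf]; ring⟩
    · exact ⟨![0, 0, 0, 0, 0, 1], by simp [qf]⟩
    · exact ⟨![0, 0, 0, 0, 1, 0], by simp [qf]⟩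
    · exact ⟨![0, 0, 0, 0, 0, 1], by simp [qf]; ring⟩
    · exact ⟨![0, 1, 0, 0, 0, 0], by simp [qf]; ring⟩
    · exact ⟨![0, 0, 0, 1, 0, 0], by simp [qf]⟩
    · exact ⟨![0, 0, 0, 0, 1, 0], by simp [qf]; ring⟩
    · exact ⟨![0, 0, 0, 1, 0, 0], by simp [qf]; ring⟩
    · exact ⟨![0, 0, 1, 0, 0, 0], by simp [qf]; ring⟩
  | zero => exact ⟨0, by simp [qf]⟩
  | add x y _ _ hx hy =>
    obtain ⟨c, rfl⟩ := hx
    obtain ⟨c', rfl⟩ := hy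
    exact ⟨c + c', by simp [qf]; ring⟩
  | smul a x _ hx =>
    obtain ⟨c, rfl⟩ := hx
    exact ⟨a • c, by simp [qf, smul_eq_C_mul]; ring⟩

variable {k F : Type*} [Field k] [Field F]

lemma eval_qf_X (c : Fin 6 → F) (z : Fin 3 → F) :
    eval z (qf (fun i => C (c i)) X) = qf c z := by
  simp [map_qf]

lemma map_qf_X (φ : k →+* F) (c : Fin 6 → k) :
    map φ (qf (fun i => C (c i)) X) = qf (fun i => C (φ (c i))) X := by
  simp [map_qf]

lemma eval_pderiv_qf_X (c : Fin 6 → F) (z : Fin 3 → F) (i : Fin 3) :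
    eval z (pderiv i (qf (fun i => C (c i)) X)) = polarForm c z (Pi.single i 1) := by
  fin_cases i <;> simp [qf, polarForm, pderiv_X, pow_two] <;> ring

lemma liesOnBitangent_of_linForm_eq_zero {f : MvPolynomial (Fin 3) F} {c₁ c₂ c₃ : Fin 6 → F}
    (hf : ∀ z, eval z f = qf c₁ z * qf c₂ z + qf c₃ z ^ 2) {t : F} {l p : Fin 3 → F}
    (hl : l ≠ 0) (hp : p ≠ 0) (hlp : linForm l p = 0)
    (hQ : ∀ x, linForm l x = 0 → qf (pencil c₁ c₂ c₃ t 1) x = 0) :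
    liesOnBitangent f p := by
  obtain ⟨i, hi⟩ := Function.ne_iff.1 hp
  obtain ⟨j, hj⟩ := Function.ne_iff.1 hl
  have hlq : linForm l (cross l (Pi.single i 1)) = 0 := by
    simp only [linForm, cross, Matrix.cons_val_zero, Matrix.cons_val_one, Matrix.cons_val]; ring
  have hc : cross p (cross l (Pi.single i 1)) = p i • l := by
    simp only [linForm] at hlp
    funext m
    fin_cases i <;> fin_cases m <;> simp [cross] <;> linear_combination -hlp
  refine ⟨p, cross l (Pi.single i 1), ?_, ?_, 1, 0, by simp⟩
  · rw [LinearIndependent.pair_iff]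
    intro s u h
    have h1 : ∀ m, u * (p i * l m) = 0 := by
      intro m
      have e : cross p (s • p + u • cross l (Pi.single i 1)) = u • (p i • l) := by
        rw [← hc]
        funext m
        fin_cases m <;> simp [cross] <;> ring
      rw [h] at e
      have := congrFun e m
      simp only [Pi.smul_apply, smul_eq_mul] at this
      rw [← this]
      fin_cases m <;> simp [cross]
    have hu : u = 0 := (mul_eq_zero.1 (h1 j)).resolve_right (mul_ne_zero hi hj)
    rw [hu, zero_smul, add_zero] at h
    exact ⟨(smul_eq_zero.1 h).resolve_right hp, hu⟩
  · refine ⟨qf (fun i => c₃ i + t * c₁ i) p,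
      polarForm (fun i => c₃ i + t * c₁ i) p (cross l (Pi.single i 1)),
      qf (fun i => c₃ i + t * c₁ i) (cross l (Pi.single i 1)), fun s u => ?_⟩
    rw [hf, eq_sub_mul_pencil c₁ c₂ c₃ t, hQ, qf_add_smul]
    · ring
    · simp only [linForm, Pi.add_apply, Pi.smul_apply, smul_eq_mul] at hlp hlq ⊢
      linear_combination s * hlp + u * hlq

lemma liesOnBitangent_smul {f : MvPolynomial (Fin 3) F} {p : Fin 3 → F} (a : F)
    (h : liesOnBitangent f p) : liesOnBitangent f (a • p) := by
  obtain ⟨P, Q, hPQ, hf, s, u, rfl⟩ := h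
  exact ⟨P, Q, hPQ, hf, a * s, a * u, by simp [smul_smul]⟩

end Polynomials

lemma exists_common_denominator {K ι : Type*} [Field K] [NumberField K] [Finite ι] (f : ι → K) :
    ∃ (n : 𝓞 K) (g : ι → 𝓞 K), n ≠ 0 ∧ ∀ i, (g i : K) = n * f i := by
  obtain ⟨b, hb⟩ := IsLocalization.exist_integer_multiples_of_finite (nonZeroDivisors (𝓞 K)) f
  choose g hg using hb
  exact ⟨b, g, nonZeroDivisors.coe_ne_zero b, fun i =>
    (hg i).trans (Algebra.smul_def _ _)⟩

lemma qdisc_smul {R : Type*} [CommRing R] (s : R) (c : Fin 6 → R) :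
    qdisc (fun i => s * c i) = s ^ 3 * qdisc c := by
  simp only [qdisc]; ring

lemma coe_algebraMap_ringOfIntegers {k K : Type*} [Field k] [Field K] [Algebra k K] (x : 𝓞 k) :
    ((algebraMap (𝓞 k) (𝓞 K) x : 𝓞 K) : K) = algebraMap k K x := rfl

lemma exists_splitPencil {k K : Type*} [Field k] [NumberField k] [Field K] [NumberField K]
    [Algebra k K] {c₁ c₂ c₃ : Fin 6 → k} (hc : qdisc c₁ ≠ 0) {r : Fin 6 → K}
    {l l' v : Fin 6 → Fin 3 → K} (hr : Function.Injective r)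
    (hroot : ∀ t, qdisc (pencil c₁ c₂ c₃ t 1) = 0 → ∃ i, algebraMap k K t = r i)
    (hdet : ∀ i, det3 (l i) (l' i) (v i) ≠ 0)
    (hfac : ∀ i x, qf (pencil (fun j => algebraMap k K (c₁ j)) (fun j => algebraMap k K (c₂ j))
      (fun j => algebraMap k K (c₃ j)) (r i) 1) x = linForm (l i) x * linForm (l' i) x) :
    ∃ (P : SplitPencil k K) (N : 𝓞 k) (m m' : K), N ≠ 0 ∧ m ≠ 0 ∧ m' ≠ 0 ∧
      (∀ j, (P.q₁ j : k) = N * c₁ j) ∧ (∀ j, (P.q₂ j : k) = N * c₂ j) ∧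
      (∀ j, (P.q₃ j : k) = N * c₃ j) ∧ (∀ i j, (P.l i j : K) = m * l i j) ∧
      ∀ i j, (P.l' i j : K) = m' * l' i j := by
  obtain ⟨N, q, hN, hq⟩ := exists_common_denominator (Sum.elim c₁ (Sum.elim c₂ c₃))
  obtain ⟨n, g, hn, hg⟩ := exists_common_denominator
    (Sum.elim r (Sum.elim (fun p : Fin 6 × Fin 3 => l p.1 p.2)
      (Sum.elim (fun p : Fin 6 × Fin 3 => l' p.1 p.2) (fun p : Fin 6 × Fin 3 => v p.1 p.2))))
  have hq₁ : ∀ j, (q (.inl j) : k) = N * c₁ j := fun j => hq _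
  have hq₂ : ∀ j, (q (.inr (.inl j)) : k) = N * c₂ j := fun j => hq _
  have hq₃ : ∀ j, (q (.inr (.inr j)) : k) = N * c₃ j := fun j => hq _
  have hgr : ∀ i, (g (.inl i) : K) = n * r i := fun j => hg _
  have hgl : ∀ i j, (g (.inr (.inl (i, j))) : K) = n * l i j := fun i j => hg _
  have hgl' : ∀ i j, (g (.inr (.inr (.inl (i, j)))) : K) = n * l' i j := fun i j => hg _
  have hgv : ∀ i j, (g (.inr (.inr (.inr (i, j)))) : K) = n * v i j := fun i j => hg _
  have hnK : (n : K) ≠ 0 := RingOfIntegers.coe_ne_zero_iff.2 hn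
  have hNk : (N : k) ≠ 0 := RingOfIntegers.coe_ne_zero_iff.2 hN
  have hNK : algebraMap k K N ≠ 0 := (map_ne_zero _).2 hNk
  let P : SplitPencil k K :=
    { q₁ := fun j => q (.inl j)
      q₂ := fun j => q (.inr (.inl j))
      q₃ := fun j => q (.inr (.inr j))
      γ := n
      μ := fun i => g (.inl i)
      e := 1
      l := fun i j => algebraMap (𝓞 k) (𝓞 K) N * g (.inr (.inl (i, j)))
      l' := fun i j => g (.inr (.inr (.inl (i, j))))
      v := fun i j => g (.inr (.inr (.inr (i, j))))
      γ_ne_zero := hn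
      μ_injective := fun i i' h => hr (by
        have h' : (g (.inl i) : K) = g (.inl i') := congrArg _ h
        rw [hgr, hgr] at h'
        exact mul_left_cancel₀ hnK h')
      det_ne_zero := fun i h0 => by
        have h1 : algebraMap k K N * (n : K) ^ 3 * det3 (l i) (l' i) (v i) = 0 := by
          have h2 := congrArg (algebraMap (𝓞 K) K) h0
          rw [map_det3, map_zero] at h2
          rw [← h2]
          simp only [det3, map_mul, hgl, hgl', hgv, coe_algebraMap_ringOfIntegers]
          ring
        exact mul_ne_zero (mul_ne_zero hNK (pow_ne_zero 3 hnK)) (hdet i) h1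
      factor := fun i x => by
        apply RingOfIntegers.coe_injective
        have h1 := hfac i (fun j => (x j : K))
        rw [qf_pencil] at h1 ⊢
        simp only [qf, linForm, map_mul, map_add, map_sub, map_pow, map_one, map_ofNat,
          hgl, hgl', hgr, coe_algebraMap_ringOfIntegers, hq₁, hq₂, hq₃] at h1 ⊢
        linear_combination (algebraMap k K N) * (n : K) ^ 2 * h1
      qdisc_eq_zero := fun a b hab h0 => by
        have h1 := congrArg (algebraMap (𝓞 k) k) h0
        rw [map_qdisc, map_pencil, map_zero] at h1
        simp only [hq₁, hq₂, hq₃] at h1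
        by_cases hb : b = 0
        · exfalso
          have ha : (a : k) ≠ 0 := by
            refine RingOfIntegers.coe_ne_zero_iff.2 fun ha => hab ?_
            rw [ha, hb]
            funext i
            fin_cases i <;> rfl
          have e : pencil (fun i => (N : k) * c₁ i) (fun i => (N : k) * c₂ i)
              (fun i => (N : k) * c₃ i) (a : k) (b : k) =
                fun i => ((a : k) ^ 2 * N) * c₁ i := by
            funext i
            simp only [pencil, hb, map_zero]
            ring
          rw [e, qdisc_smul] at h1
          exact mul_ne_zero (pow_ne_zero 3 (mul_ne_zero (pow_ne_zero 2 ha) hNk)) hc h1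
        · have hbk : (b : k) ≠ 0 := RingOfIntegers.coe_ne_zero_iff.2 hb
          have e : pencil (fun i => (N : k) * c₁ i) (fun i => (N : k) * c₂ i)
              (fun i => (N : k) * c₃ i) (a : k) (b : k) =
                fun i => ((b : k) ^ 2 * N) * pencil c₁ c₂ c₃ (a / b : k) 1 i := by
            funext i
            simp only [pencil]
            field_simp
          rw [e, qdisc_smul] at h1
          obtain ⟨i, hi⟩ := hroot _ ((mul_eq_zero.1 h1).resolve_left
            (pow_ne_zero 3 (mul_ne_zero (pow_ne_zero 2 hbk) hNk)))
          refine ⟨i, RingOfIntegers.coe_injective ?_⟩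
          have hbK : algebraMap k K b ≠ 0 := (map_ne_zero _).2 hbk
          rw [map_div₀] at hi
          simp only [map_mul, hgr, coe_algebraMap_ringOfIntegers]
          rw [← hi]
          field_simp }
  refine ⟨P, N, algebraMap k K N * n, n, hN, mul_ne_zero hNK hnK, hnK, hq₁, hq₂, hq₃,
    fun i j => ?_, hgl'⟩
  have : (P.l i j : K) = algebraMap k K N * g (.inr (.inl (i, j))) := by
    simp only [P, map_mul, coe_algebraMap_ringOfIntegers]
  rw [this, hgl]
  ring

lemma exists_splitPencil_of_smoothQuartic {k : Type*} [Field k] [NumberField k]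
    {c₁ c₂ c₃ : Fin 6 → k} (hc : qdisc c₁ ≠ 0)
    (hs : SmoothQuartic (fun j => algebraMap k (AlgebraicClosure k) (c₁ j))
      (fun j => algebraMap k (AlgebraicClosure k) (c₂ j))
      (fun j => algebraMap k (AlgebraicClosure k) (c₃ j))) :
    ∃ (K : IntermediateField k (AlgebraicClosure k)) (_ : NumberField K) (P : SplitPencil k K)
      (N : 𝓞 k), N ≠ 0 ∧
      (∀ j, (P.q₁ j : k) = N * c₁ j) ∧ (∀ j, (P.q₂ j : k) = N * c₂ j) ∧
      (∀ j, (P.q₃ j : k) = N * c₃ j) ∧ ∀ (x : Fin 3 → 𝓞 k) i, P.L i x = 0 ∨ P.L' i x = 0 →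
        ∃ (t : AlgebraicClosure k) (l : Fin 3 → AlgebraicClosure k), l ≠ 0 ∧
          linForm l (fun j => algebraMap k (AlgebraicClosure k) (x j)) = 0 ∧
          ∀ y, linForm l y = 0 → qf (pencil (fun j => algebraMap k (AlgebraicClosure k) (c₁ j))
            (fun j => algebraMap k (AlgebraicClosure k) (c₂ j))
            (fun j => algebraMap k (AlgebraicClosure k) (c₃ j)) t 1) y = 0 := by
  obtain ⟨r, l, l', v, hr, hroot, h⟩ := hs.exists_splitting two_ne_zero (by
    rw [← map_qdisc]
    exact (map_ne_zero _).2 hc)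
  let S : Set (AlgebraicClosure k) := Set.range r ∪
    (Set.range (fun p : Fin 6 × Fin 3 => l p.1 p.2) ∪
      (Set.range (fun p : Fin 6 × Fin 3 => l' p.1 p.2) ∪
        Set.range (fun p : Fin 6 × Fin 3 => v p.1 p.2)))
  let K := IntermediateField.adjoin k S
  have hSK : S ⊆ K := IntermediateField.subset_adjoin k S
  have : Finite S := by
    have : S.Finite := (Set.finite_range _).union ((Set.finite_range _).union
      ((Set.finite_range _).union (Set.finite_range _)))
    exact this
  have : FiniteDimensional k K :=
    IntermediateField.finiteDimensional_adjoin fun x _ => Algebra.IsIntegral.isIntegral x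
  have hK : NumberField K := NumberField.of_module_finite k K
  let r' : Fin 6 → K := fun i => ⟨r i, hSK (.inl ⟨i, rfl⟩)⟩
  let m : Fin 6 → Fin 3 → K := fun i j => ⟨l i j, hSK (.inr (.inl ⟨(i, j), rfl⟩))⟩
  let m' : Fin 6 → Fin 3 → K := fun i j => ⟨l' i j, hSK (.inr (.inr (.inl ⟨(i, j), rfl⟩)))⟩
  let v' : Fin 6 → Fin 3 → K := fun i j => ⟨v i j, hSK (.inr (.inr (.inr ⟨(i, j), rfl⟩)))⟩
  obtain ⟨P, N, n, n', hN, hn, hn', hq₁, hq₂, hq₃, hl, hl'⟩ :=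
    exists_splitPencil (K := K) (c₂ := c₂) (c₃ := c₃) hc (r := r') (l := m) (l' := m') (v := v')
      (fun i i' hi => hr (congrArg Subtype.val hi))
      (fun t ht => by
        obtain ⟨i, hi⟩ := hroot (algebraMap k _ t) (by
          have := congrArg (algebraMap k (AlgebraicClosure k)) ht
          rwa [map_qdisc, map_pencil, map_zero, map_one] at this)
        exact ⟨i, Subtype.ext hi⟩)
      (fun i h0 => (h i).1 (by
        have := congrArg (algebraMap K (AlgebraicClosure k)) h0
        rwa [map_det3, map_zero] at this))
      (fun i x => by
        apply (algebraMap K (AlgebraicClosure k)).injective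
        have := (h i).2 (fun j => algebraMap K (AlgebraicClosure k) (x j))
        rw [map_qf, map_pencil, map_one]
        simp only [linForm, map_add, map_mul] at this ⊢
        exact this)
  refine ⟨K, hK, P, N, hN, hq₁, hq₂, hq₃, fun x i hx => ?_⟩
  have key : ∀ (a : Fin 3 → 𝓞 K) (s : K) (w : Fin 3 → K), s ≠ 0 → (∀ j, (a j : K) = s * w j) →
      linForm a (fun j => algebraMap (𝓞 k) (𝓞 K) (x j)) = 0 →
      linForm (fun j => (w j : AlgebraicClosure k))
        (fun j => algebraMap k (AlgebraicClosure k) (x j)) = 0 := by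
    intro a s w hs ha h0
    have h1 := congrArg (algebraMap (𝓞 K) K) h0
    simp only [linForm, map_add, map_mul, ha, coe_algebraMap_ringOfIntegers, map_zero] at h1
    have h2 : linForm w (fun j => algebraMap k K (x j)) = 0 := by
      refine (mul_eq_zero.1 ?_).resolve_left hs
      rw [← h1, linForm]
      ring
    have h3 := congrArg (algebraMap K (AlgebraicClosure k)) h2
    simpa [linForm] using h3
  have hne := (h i).1
  rcases hx with hx | hx
  · refine ⟨r i, l i, ?_, key (P.l i) n (m i) hn (hl i) hx, fun y hy => ?_⟩
    · intro h0
      rw [h0] at hne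
      simp [det3] at hne
    · rw [(h i).2, hy, zero_mul]
  · refine ⟨r i, l' i, ?_, key (P.l' i) n' (m' i) hn' (hl' i) hx, fun y hy => ?_⟩
    · intro h0
      rw [h0] at hne
      simp [det3] at hne
    · rw [(h i).2, hy, mul_zero]

section Counting

open MvPolynomial

lemma Set.finite_and_ncard_le_of_forall_finset {α : Type*} {G : Set α} {D : ℝ}
    (h : ∀ I : Finset α, (∀ x ∈ I, x ∈ G) → (I.card : ℝ) ≤ D) :
    G.Finite ∧ (G.ncard : ℝ) ≤ D := by
  have hG : G.Finite := by
    by_contra hG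
    obtain ⟨I, hI, hc⟩ := Set.Infinite.exists_subset_card_eq hG (⌊D⌋₊ + 1)
    have h1 := h I fun x hx => hI hx
    rw [hc] at h1
    have h2 := Nat.lt_floor_add_one D
    push_cast at h1
    linarith
  refine ⟨hG, ?_⟩
  rw [Set.ncard_eq_toFinset_card G hG]
  exact h _ fun x hx => by simpa using hx

lemma smoothQuartic_of_pderiv_ne_zero {F : Type*} [Field F] {c₁ c₂ c₃ : Fin 6 → F}
    {f : MvPolynomial (Fin 3) F}
    (hf : f = qf (fun i => C (c₁ i)) X * qf (fun i => C (c₂ i)) X +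
      qf (fun i => C (c₃ i)) X ^ 2)
    (hs : ∀ z : Fin 3 → F, z ≠ 0 → eval z f = 0 → (fun i => eval z (pderiv i f)) ≠ 0) :
    SmoothQuartic c₁ c₂ c₃ := by
  intro z hz h0
  obtain ⟨i, hi⟩ := Function.ne_iff.1 (hs z hz (by
    rw [hf, map_add, map_mul, map_pow, eval_qf_X, eval_qf_X, eval_qf_X, h0]))
  refine ⟨Pi.single i 1, fun h1 => hi ?_⟩
  rw [hf, map_add, Derivation.leibniz, Derivation.leibniz_pow]
  simp only [map_add, map_mul, map_pow, smul_eq_mul, eval_qf_X, eval_pderiv_qf_X,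
    Pi.zero_apply, nsmul_eq_mul, Nat.cast_ofNat, map_ofNat]
  rw [← h1]
  ring

lemma qdisc_ne_zero_of_pderiv_ne_zero {F : Type*} [Field F] (h2 : (2 : F) ≠ 0) {c : Fin 6 → F}
    (h : ∀ z : Fin 3 → F, z ≠ 0 → eval z (qf (fun i => C (c i)) X) = 0 →
      (fun i => eval z (pderiv i (qf (fun i => C (c i)) X))) ≠ 0) : qdisc c ≠ 0 := by
  intro h0
  obtain ⟨z, hz, hzp⟩ := exists_polarForm_eq_zero h0
  refine h z hz ?_ (funext fun i => ?_)
  · have := hzp z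
    rw [polarForm_self] at this
    rw [eval_qf_X]
    exact (mul_eq_zero.1 this).resolve_left h2
  · rw [eval_pderiv_qf_X, hzp]; rfl

lemma exists_smul_eq_of_not_nonProp {k : Type*} [Field k] [NumberField k] {x y : Fin 3 → 𝓞 k}
    (hx : x ≠ 0) (hy : y ≠ 0) (h : ¬ NonProp x y) :
    ∃ a : kˣ, a • (fun i => (y i : k)) = fun i => (x i : k) := by
  simp only [NonProp, not_exists, not_not] at h
  obtain ⟨j, hj⟩ := Function.ne_iff.1 hy
  have hjk : (y j : k) ≠ 0 := RingOfIntegers.coe_ne_zero_iff.2 hj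
  have hxj : x j ≠ 0 := by
    intro h0
    apply hx
    funext i
    have h1 := h i j
    rw [h0, zero_mul, sub_zero] at h1
    exact (mul_eq_zero.1 h1).resolve_right hj
  have hxk : (x j : k) ≠ 0 := RingOfIntegers.coe_ne_zero_iff.2 hxj
  refine ⟨Units.mk0 ((x j : k) / y j) (div_ne_zero hxk hjk), funext fun i => ?_⟩
  have h1 := congrArg (algebraMap (𝓞 k) k) (h i j)
  simp only [map_sub, map_mul, map_zero] at h1
  simp only [Pi.smul_apply, Units.smul_def, Units.val_mk0, smul_eq_mul]
  field_simp
  linear_combination -h1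

theorem exists_projective_count_le {k : Type*} [Field k] [NumberField k]
    {c₁ c₂ c₃ : Fin 6 → k} (hc : qdisc c₁ ≠ 0)
    (hs : SmoothQuartic (fun j => algebraMap k (AlgebraicClosure k) (c₁ j))
      (fun j => algebraMap k (AlgebraicClosure k) (c₂ j))
      (fun j => algebraMap k (AlgebraicClosure k) (c₃ j)))
    {f : MvPolynomial (Fin 3) k} (hf : ∀ z, eval z f = qf c₁ z * qf c₂ z + qf c₃ z ^ 2)
    (hf' : ∀ z, eval z (map (algebraMap k (AlgebraicClosure k)) f) =
      qf (fun j => algebraMap k (AlgebraicClosure k) (c₁ j)) z *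
        qf (fun j => algebraMap k (AlgebraicClosure k) (c₂ j)) z +
        qf (fun j => algebraMap k (AlgebraicClosure k) (c₃ j)) z ^ 2)
    {ε : ℝ} (hε : 0 < ε) :
    ∃ C : ℝ, 1 ≤ C ∧ ∀ B : ℝ, 1 ≤ B → ∀ I : Finset (Projectivization k (Fin 3 → k)),
      (∀ π ∈ I, ∃ (z : Fin 3 → 𝓞 k) (hz : (fun i => (z i : k)) ≠ 0),
        π = Projectivization.mk k (fun i => (z i : k)) hz ∧ heightFn z ≤ B ∧
        (∃ t : k, t ^ 2 = eval (fun i => (z i : k)) f) ∧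
        ¬ liesOnBitangent (map (algebraMap k (AlgebraicClosure k)) f)
          (fun i => algebraMap k (AlgebraicClosure k) (z i))) →
      (I.card : ℝ) ≤ C * B ^ (2 + ε) := by
  classical
  obtain ⟨K, _, P, N, hN, hq₁, hq₂, hq₃, hL⟩ := exists_splitPencil_of_smoothQuartic hc hs
  obtain ⟨C, hC, h⟩ := P.exists_height_count_le hε
  refine ⟨C, hC, fun B hB I hI => ?_⟩
  choose! z hz hπ hzB ht hb using hI
  have hz0 : ∀ π ∈ I, z π ≠ 0 := by
    intro π hπI h0
    exact hz π hπI (by rw [h0]; funext i; exact map_zero _)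
  have hinj : Set.InjOn z I := by
    intro π hπI π' hπI' hzz
    rw [hπ π hπI, hπ π' hπI']
    simp only [hzz]
  rw [← Finset.card_image_of_injOn hinj]
  refine h B hB _ ?_ ?_
  · intro x hx
    obtain ⟨π, hπI, rfl⟩ := Finset.mem_image.1 hx
    refine ⟨hz0 π hπI, hzB π hπI, ?_, ?_⟩
    · obtain ⟨t, ht⟩ := ht π hπI
      have e : ((N : k) * t) ^ 2 =
          ((qf P.q₃ (z π) ^ 2 + qf P.q₁ (z π) * qf P.q₂ (z π) : 𝓞 k) : k) := by
        rw [mul_pow, ht, hf]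
        simp only [map_add, map_mul, map_pow, map_qf, hq₁, hq₂, hq₃]
        simp only [qf]
        ring
      have hint : IsIntegral ℤ ((N : k) * t) := by
        refine IsIntegral.of_pow two_pos ?_
        rw [e]
        exact RingOfIntegers.isIntegral_coe _
      refine ⟨⟨(N : k) * t, hint⟩, RingOfIntegers.coe_injective ?_⟩
      exact (map_pow (algebraMap (𝓞 k) k) _ 2).trans e
    · have key : ∀ i, ¬ (P.L i (z π) = 0 ∨ P.L' i (z π) = 0) := by
        intro i h0
        obtain ⟨t, l, hl, hlz, hQ⟩ := hL _ i h0
        refine hb π hπI (liesOnBitangent_of_linForm_eq_zero hf' hl ?_ hlz hQ)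
        intro h1
        apply hz π hπI
        funext j
        have := congrFun h1 j
        simpa using this
      intro i
      exact not_or.1 (key i)
  · intro x hx y hy hxy
    obtain ⟨π, hπI, rfl⟩ := Finset.mem_image.1 hx
    obtain ⟨π', hπI', rfl⟩ := Finset.mem_image.1 hy
    by_contra hnp
    apply hxy
    congr 1
    rw [hπ π hπI, hπ π' hπI', Projectivization.mk_eq_mk_iff]
    exact exists_smul_eq_of_not_nonProp (hz0 π hπI) (hz0 π' hπI') hnp

end Counting

/-- Theorem 1.3: del Pezzo surfaces of degree 2 with a conic bundle
structure:  let `X ⊂ ℙ(2,1,1,1)` be the del Pezzo surface of degree `2` given by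
`t² = f(x₁,x₂,x₃)` with `f` a non-singular quartic form over the number field `k`,
containing a non-singular conic defined over `k` (equivalently, `f = q₁q₂ + q₃²` for
quadratic forms over `k` with `q₁` non-singular).  Let `U ⊂ X` be the complement of the
`56` exceptional curves (the preimages of the `28` bitangents of the quartic curve
`f = 0`), and let the height of `[t, x]` be `H_k([x₁,x₂,x₃])`.  Then for every `ε > 0`
there is `C = C(ε, X, k)` with `N(U, k, B) ≤ C·B^{2+ε}` for all `B ≥ 1`. -/
theorem dp2_point_count {k : Type*} [Field k] [NumberField k]
    (f : MvPolynomial (Fin 3) k)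
    (hdeg : f.IsHomogeneous 4)
    -- the quartic curve `f = 0` is non-singular (over `k̄`):
    (hsmooth : ∀ z : Fin 3 → AlgebraicClosure k, z ≠ 0 →
      MvPolynomial.eval z (MvPolynomial.map (algebraMap k (AlgebraicClosure k)) f) = 0 →
      (fun i => MvPolynomial.eval z (MvPolynomial.pderiv i
        (MvPolynomial.map (algebraMap k (AlgebraicClosure k)) f))) ≠ 0)
    -- `X` contains a non-singular conic defined over `k`:
    (hconic : ∃ q₁ q₂ q₃ : MvPolynomial (Fin 3) k,
      q₁.IsHomogeneous 2 ∧ q₂.IsHomogeneous 2 ∧ q₃.IsHomogeneous 2 ∧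
      f = q₁ * q₂ + q₃ ^ 2 ∧
      (∀ y : Fin 3 → AlgebraicClosure k, y ≠ 0 →
        MvPolynomial.eval y (MvPolynomial.map (algebraMap k (AlgebraicClosure k)) q₁) = 0 →
        (fun i => MvPolynomial.eval y (MvPolynomial.pderiv i
          (MvPolynomial.map (algebraMap k (AlgebraicClosure k)) q₁))) ≠ 0))
    (ε : ℝ) (hε : 0 < ε) :
    ∃ C : ℝ, 0 < C ∧ ∀ B : ℝ, 1 ≤ B →
      (let U : Set (Quot (wpRel k)) :=
        {cl | ∃ p : k × (Fin 3 → k), Quot.mk (wpRel k) p = cl ∧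
          p.2 ≠ 0 ∧
          p.1 ^ 2 = MvPolynomial.eval p.2 f ∧
          ¬ liesOnBitangent (MvPolynomial.map (algebraMap k (AlgebraicClosure k)) f)
            (fun i => algebraMap k (AlgebraicClosure k) (p.2 i)) ∧
          ∃ (z : Fin 3 → 𝓞 k) (hz : (fun i => (z i : k)) ≠ 0) (hp : p.2 ≠ 0),
            Projectivization.mk k (fun i => (z i : k)) hz = Projectivization.mk k p.2 hp ∧
            heightFn z ≤ B};
      U.Finite ∧ (U.ncard : ℝ) ≤ C * B ^ (2 + ε)) := by
  obtain ⟨q₁, q₂, q₃, h₁, h₂, h₃, hf, hq⟩ := hconic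
  obtain ⟨c₁, rfl⟩ := exists_eq_qf_of_isHomogeneous h₁
  obtain ⟨c₂, rfl⟩ := exists_eq_qf_of_isHomogeneous h₂
  obtain ⟨c₃, rfl⟩ := exists_eq_qf_of_isHomogeneous h₃
  have hmap : MvPolynomial.map (algebraMap k (AlgebraicClosure k)) f = _ :=
    congrArg (MvPolynomial.map (algebraMap k (AlgebraicClosure k))) hf
  rw [map_add, map_mul, map_pow, map_qf_X, map_qf_X, map_qf_X] at hmap
  have hev : ∀ z, MvPolynomial.eval z f = qf c₁ z * qf c₂ z + qf c₃ z ^ 2 := by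
    intro z
    rw [hf, map_add, map_mul, map_pow, eval_qf_X, eval_qf_X, eval_qf_X]
  have hev' : ∀ z, MvPolynomial.eval z (MvPolynomial.map (algebraMap k (AlgebraicClosure k)) f) =
      qf (fun j => algebraMap k (AlgebraicClosure k) (c₁ j)) z *
        qf (fun j => algebraMap k (AlgebraicClosure k) (c₂ j)) z +
        qf (fun j => algebraMap k (AlgebraicClosure k) (c₃ j)) z ^ 2 := by
    intro z
    rw [hmap, map_add, map_mul, map_pow, eval_qf_X, eval_qf_X, eval_qf_X]
  have hc : qdisc c₁ ≠ 0 := by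
    rw [map_qf_X] at hq
    have := qdisc_ne_zero_of_pderiv_ne_zero two_ne_zero hq
    rw [← map_qdisc] at this
    exact (map_ne_zero _).1 this
  obtain ⟨C, hC, hcount⟩ := exists_projective_count_le hc
    (smoothQuartic_of_pderiv_ne_zero hmap hsmooth) hev hev' hε
  refine ⟨2 * C, by linarith, fun B hB => ?_⟩
  intro U
  let G : Set (Projectivization k (Fin 3 → k)) :=
    {π | ∃ (z : Fin 3 → 𝓞 k) (hz : (fun i => (z i : k)) ≠ 0),
        π = Projectivization.mk k (fun i => (z i : k)) hz ∧ heightFn z ≤ B ∧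
        (∃ t : k, t ^ 2 = MvPolynomial.eval (fun i => (z i : k)) f) ∧
        ¬ liesOnBitangent (MvPolynomial.map (algebraMap k (AlgebraicClosure k)) f)
          (fun i => algebraMap k (AlgebraicClosure k) (z i))}
  obtain ⟨hGfin, hGcard⟩ := Set.finite_and_ncard_le_of_forall_finset (G := G)
    (fun I hI => hcount B hB I hI)
  have hG : ∀ π, ∃ (t : k) (z : Fin 3 → 𝓞 k), π ∈ G →
      ∃ hz : (fun i => (z i : k)) ≠ 0, π = Projectivization.mk k (fun i => (z i : k)) hz ∧
        t ^ 2 = MvPolynomial.eval (fun i => (z i : k)) f := by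
    intro π
    by_cases hπ : π ∈ G
    · obtain ⟨z, hz, hπz, -, ⟨t, ht⟩, -⟩ := hπ
      exact ⟨t, z, fun _ => ⟨hz, hπz, ht⟩⟩
    · exact ⟨0, 0, fun h => absurd h hπ⟩
  choose t z hG using hG
  have hsub : U ⊆ (fun π => Quot.mk (wpRel k) (t π, fun i => (z π i : k))) '' G ∪
      (fun π => Quot.mk (wpRel k) (-t π, fun i => (z π i : k))) '' G := by
    rintro _ ⟨p, rfl, hp, hpf, hpb, w, hw, _, hpw, hwB⟩
    have hmem : Projectivization.mk k p.2 hp ∈ G := by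
      refine ⟨w, hw, hpw.symm, hwB, ?_, fun hb => hpb ?_⟩
      · obtain ⟨a, ha⟩ := (Projectivization.mk_eq_mk_iff' k _ _ hw hp).1 hpw
        refine ⟨a ^ 2 * p.1, ?_⟩
        rw [← ha, mul_pow, hpf, hev, hev]
        simp only [qf, Pi.smul_apply, smul_eq_mul]
        ring
      · obtain ⟨a, ha⟩ := (Projectivization.mk_eq_mk_iff' k _ _ hp hw).1 hpw.symm
        have := liesOnBitangent_smul (algebraMap k (AlgebraicClosure k) a) hb
        rw [← ha]
        simpa only [Pi.smul_def, smul_eq_mul, map_mul] using this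
    obtain ⟨hz, hπ, ht⟩ := hG _ hmem
    obtain ⟨a, ha⟩ := (Projectivization.mk_eq_mk_iff' k _ _ hz hp).1 hπ.symm
    have ha0 : a ≠ 0 := by
      rintro rfl
      exact hz (by rw [← ha, zero_smul])
    have h2 : (a ^ 2 * p.1) ^ 2 = t (Projectivization.mk k p.2 hp) ^ 2 := by
      rw [ht, ← ha, mul_pow, hpf, hev, hev]
      simp only [qf, Pi.smul_apply, smul_eq_mul]
      ring
    rcases sq_eq_sq_iff_eq_or_eq_neg.1 h2 with h | h
    · exact .inl ⟨_, hmem, (Quot.sound ⟨a, ha0, h.symm, ha.symm⟩).symm⟩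
    · exact .inr ⟨_, hmem, (Quot.sound ⟨a, ha0, h.symm, ha.symm⟩).symm⟩
  have hfin := (hGfin.image (fun π => Quot.mk (wpRel k) (t π, fun i => (z π i : k)))).union
    (hGfin.image (fun π => Quot.mk (wpRel k) (-t π, fun i => (z π i : k))))
  refine ⟨hfin.subset hsub, ?_⟩
  have hcard : U.ncard ≤ G.ncard + G.ncard :=
    (Set.ncard_le_ncard hsub hfin).trans ((Set.ncard_union_le _ _).trans
      (add_le_add (Set.ncard_image_le hGfin) (Set.ncard_image_le hGfin)))
  have hcard' : (U.ncard : ℝ) ≤ G.ncard + G.ncard := by exact_mod_cast hcard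
  linarith
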